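/- Let G = ⟨x, y ∣ x³ = y⁵ = W(x,y)² = 1⟩ be a generalised triangle group of type (3,5,2) and let τ ∈ ℂ[λ] be the trace polynomial of W. If τ has a multiple root, i.e. there exists α ∈ ℂ such that (λ − α)² divides τ, then G contains a subgroup isomorphic to the free group of rank 2. -/

import Mathlib

open Matrix Polynomial

/-- The generators `x`, `y` of the free group of rank 2. -/
def xgen : FreeGroup (Fin 2) := FreeGroup.of 0
def ygen : FreeGroup (Fin 2) := FreeGroup.of 1

/-- The word `W = x^{α(1)} y^{β(1)} ⋯ x^{α(k)} y^{β(k)}`. -/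
def Wword (k : ℕ) (a b : Fin k → ℕ) : FreeGroup (Fin 2) :=
  (List.ofFn fun i : Fin k => xgen ^ a i * ygen ^ b i).prod

/-- The relators `x³, y⁵, W²` of a generalised triangle group of type (3,5,2). -/
def triRels (k : ℕ) (a b : Fin k → ℕ) : Set (FreeGroup (Fin 2)) :=
  {xgen ^ 3, ygen ^ 5, (Wword k a b) ^ 2}

/-- The generalised triangle group `⟨x, y ∣ x³ = y⁵ = W² = 1⟩` of type (3,5,2). -/
abbrev TriGroup (k : ℕ) (a b : Fin k → ℕ) : Type := PresentedGroup (triRels k a b)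

/-- `W(X,Y)`: the image of a word `w ∈ F₂` under the homomorphism `F₂ → SL(2,ℂ)`
sending `x ↦ X` and `y ↦ Y`. -/
noncomputable def wEval (X Y : SpecialLinearGroup (Fin 2) ℂ) (w : FreeGroup (Fin 2)) :
    SpecialLinearGroup (Fin 2) ℂ :=
  FreeGroup.lift ![X, Y] w

/-- `τ` is a trace polynomial of `w` if `tr (w(X,Y)) = τ(tr (XY))` whenever
`tr X = 1` and `tr Y = (1+√5)/2`. -/
def IsTracePolynomial (w : FreeGroup (Fin 2)) (τ : Polynomial ℂ) : Prop :=
  ∀ X Y : SpecialLinearGroup (Fin 2) ℂ,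
    Matrix.trace (X : Matrix (Fin 2) (Fin 2) ℂ) = 1 →
    Matrix.trace (Y : Matrix (Fin 2) (Fin 2) ℂ) = (1 + (Real.sqrt 5 : ℂ)) / 2 →
    Matrix.trace ((wEval X Y w : SpecialLinearGroup (Fin 2) ℂ) : Matrix (Fin 2) (Fin 2) ℂ) =
      τ.eval (Matrix.trace ((X * Y : SpecialLinearGroup (Fin 2) ℂ) : Matrix (Fin 2) (Fin 2) ℂ))

/-- contains a free group of rank two -/
def HasF2 (G : Type*) [Group G] : Prop :=
  ∃ φ : FreeGroup (Fin 2) →* G, Function.Injective φ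

theorem HasF2.subgroup {G : Type*} [Group G] (h : HasF2 G) :
    ∃ H : Subgroup G, Nonempty (H ≃* FreeGroup (Fin 2)) := by
  obtain ⟨φ, hφ⟩ := h
  exact ⟨φ.range, ⟨(MonoidHom.ofInjective hφ).symm⟩⟩

theorem HasF2.of_inj {G G' : Type*} [Group G] [Group G'] (h : HasF2 G) (f : G →* G')
    (hf : Function.Injective f) : HasF2 G' := by
  obtain ⟨φ, hφ⟩ := h
  exact ⟨f.comp φ, hf.comp hφ⟩

abbrev SL2 := Matrix.SpecialLinearGroup (Fin 2) ℂ

theorem sl2_sq_of_center {A : SL2} (h : A ∈ Subgroup.center SL2) : A ^ 2 = 1 := by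
  rw [Matrix.SpecialLinearGroup.mem_center_iff] at h
  obtain ⟨r, hr, hA⟩ := h
  apply Subtype.ext
  rw [Matrix.SpecialLinearGroup.coe_pow, ← hA, ← map_pow]
  rw [Fintype.card_fin] at hr
  rw [hr]; simp

theorem hasF2_of_center {rels : Set (FreeGroup (Fin 2))} (ρ : FreeGroup (Fin 2) →* SL2)
    (h : ∀ r ∈ rels, ρ r ∈ Subgroup.center SL2) (u v : FreeGroup (Fin 2))
    (inj : Function.Injective (FreeGroup.lift ![ρ u, ρ v])) : HasF2 (PresentedGroup rels) := by
  refine ⟨(PresentedGroup.mk rels).comp (FreeGroup.lift ![u, v]), ?_⟩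
  rw [injective_iff_map_eq_one]
  intro w hw
  have h1 : FreeGroup.lift ![u, v] w ∈ Subgroup.normalClosure rels := by
    rwa [MonoidHom.comp_apply, PresentedGroup.mk_eq_one_iff] at hw
  have h2 : Subgroup.normalClosure rels ≤ (Subgroup.center SL2).comap ρ :=
    Subgroup.normalClosure_le_normal (fun r hr => h r hr)
  have h3 := sl2_sq_of_center (h2 h1)
  have h4 : ρ.comp (FreeGroup.lift ![u, v]) = FreeGroup.lift ![ρ u, ρ v] := by
    ext i; fin_cases i <;> simp
  have h5 : FreeGroup.lift ![ρ u, ρ v] (w ^ 2) = 1 := by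
    rw [map_pow, ← h4]; exact h3
  have h6 : w ^ 2 = 1 := (injective_iff_map_eq_one _).1 inj _ h5
  exact (pow_eq_one_iff_left two_ne_zero).1 h6

/-- nonzero vectors -/
def NZ := {v : Fin 2 → ℂ // v ≠ 0}

noncomputable instance : MulAction SL2 NZ where
  smul A v := ⟨A.1.mulVec v.1, fun h => v.2 (by
    have := congrArg (A⁻¹.1.mulVec) h
    rw [mulVec_mulVec, ← Matrix.SpecialLinearGroup.coe_mul, inv_mul_cancel] at this
    simpa using this)⟩
  one_smul v := Subtype.ext (by
    change (1 : SL2).1.mulVec v.1 = v.1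
    simp)
  mul_smul A B v := Subtype.ext (by
    change (A * B).1.mulVec v.1 = A.1.mulVec (B.1.mulVec v.1)
    rw [mulVec_mulVec, Matrix.SpecialLinearGroup.coe_mul])

theorem NZ.smul_zero (A : SL2) (v : NZ) : (A • v).1 0 = A.1 0 0 * v.1 0 + A.1 0 1 * v.1 1 := by
  change A.1.mulVec v.1 0 = _
  simp [mulVec, dotProduct]
theorem NZ.smul_one (A : SL2) (v : NZ) : (A • v).1 1 = A.1 1 0 * v.1 0 + A.1 1 1 * v.1 1 := by
  change A.1.mulVec v.1 1 = _
  simp [mulVec, dotProduct]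

open scoped Pointwise in
theorem pingpong (d h : SL2) (h01 : d.1 0 1 = 0) (h10 : d.1 1 0 = 0) (hd : 1 < ‖d.1 0 0‖)
    (hh : ∀ i j, h.1 i j ≠ 0) :
    ∃ n : ℕ, Function.Injective (FreeGroup.lift ![d ^ n, h * d ^ n * h⁻¹]) := by
  -- constants
  set S := ‖h.1 0 0‖ + ‖h.1 0 1‖ + ‖h.1 1 0‖ + ‖h.1 1 1‖ with hS
  obtain ⟨R, hR1, hR⟩ : ∃ R : ℝ, 1 < R ∧ ∀ i j, S ≤ R * ‖h.1 i j‖ := by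
    refine ⟨1 + 1 + ∑ i, ∑ j, S / ‖h.1 i j‖, ?_, ?_⟩
    · have : 0 ≤ ∑ i, ∑ j, S / ‖h.1 i j‖ := by positivity
      linarith
    · intro i j
      have hp : 0 < ‖h.1 i j‖ := norm_pos_iff.2 (hh i j)
      have h1 : S / ‖h.1 i j‖ ≤ ∑ i, ∑ j, S / ‖h.1 i j‖ := by
        refine le_trans ?_ (Finset.single_le_sum (f := fun i => ∑ j, S / ‖h.1 i j‖)
          (fun _ _ => by positivity) (Finset.mem_univ i))
        exact Finset.single_le_sum (f := fun j => S / ‖h.1 i j‖)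
          (fun _ _ => by positivity) (Finset.mem_univ j)
      have h2 : S = S / ‖h.1 i j‖ * ‖h.1 i j‖ := by field_simp
      refine h2.le.trans (mul_le_mul_of_nonneg_right ?_ hp.le)
      linarith
  obtain ⟨n, hn⟩ := pow_unbounded_of_one_lt R hd
  refine ⟨n, ?_⟩
  have hdet : d.1 0 0 * d.1 1 1 = 1 := by
    have := d.2
    rw [det_fin_two, h01, h10] at this
    simpa using this
  have hμ : d.1 0 0 ≠ 0 := left_ne_zero_of_mul_eq_one hdet
  have hdm : d.1 = diagonal ![d.1 0 0, d.1 1 1] := by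
    ext i j; fin_cases i <;> fin_cases j <;> simp [h01, h10]
  have hpow : ∀ m : ℕ, (d ^ m).1 = diagonal ![d.1 0 0 ^ m, d.1 1 1 ^ m] := by
    intro m
    rw [Matrix.SpecialLinearGroup.coe_pow, hdm, diagonal_pow]
    congr 1; ext i; fin_cases i <;> simp
  have e00 : (d ^ n).1 0 0 = d.1 0 0 ^ n := by rw [hpow]; simp
  have e01 : (d ^ n).1 0 1 = 0 := by rw [hpow]; simp
  have e10 : (d ^ n).1 1 0 = 0 := by rw [hpow]; simp
  have e11 : (d ^ n).1 1 1 = d.1 1 1 ^ n := by rw [hpow]; simp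
  have hinv : ((d ^ n)⁻¹).1 = (d ^ n).1.adjugate := Matrix.SpecialLinearGroup.coe_inv _
  have f00 : ((d ^ n)⁻¹).1 0 0 = d.1 1 1 ^ n := by rw [hinv, adjugate_fin_two]; simp [e11]
  have f01 : ((d ^ n)⁻¹).1 0 1 = 0 := by rw [hinv, adjugate_fin_two]; simp [e01]
  have f10 : ((d ^ n)⁻¹).1 1 0 = 0 := by rw [hinv, adjugate_fin_two]; simp [e10]
  have f11 : ((d ^ n)⁻¹).1 1 1 = d.1 0 0 ^ n := by rw [hinv, adjugate_fin_two]; simp [e00]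
  have hnn : ‖d.1 0 0 ^ n‖ * ‖d.1 1 1 ^ n‖ = 1 := by
    rw [← norm_mul, ← mul_pow, hdet]; simp
  have hMR : R < ‖d.1 0 0 ^ n‖ := by rwa [norm_pow]
  generalize d.1 0 0 ^ n = M at *
  generalize d.1 1 1 ^ n = N at *
  have hR0 : 0 < R := by linarith
  have hM0 : 0 < ‖M‖ := by linarith
  have hN0 : 0 < ‖N‖ := by
    rcases (norm_nonneg N).eq_or_lt with h | h
    · rw [← h] at hnn; simp at hnn
    · exact h
  have hNR : R * ‖N‖ < 1 := by
    rw [← hnn]; exact mul_lt_mul_of_pos_right hMR hN0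
  let X1 : Set NZ := {v | R * ‖v.1 1‖ < ‖v.1 0‖}
  let Y1 : Set NZ := {v | R * ‖v.1 0‖ < ‖v.1 1‖}
  have hXY : Disjoint X1 Y1 := by
    rw [Set.disjoint_left]
    intro v h1 h2
    simp only [X1, Y1, Set.mem_ofPred_eq] at h1 h2
    nlinarith [norm_nonneg (v.1 0), norm_nonneg (v.1 1)]
  have hv0 : ∀ v : NZ, 0 < ‖v.1 0‖ ∨ 0 < ‖v.1 1‖ := by
    intro v
    by_contra hc
    push Not at hc
    apply v.2
    ext i; fin_cases i
    · simpa using hc.1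
    · simpa using hc.2
  have a1 : (d ^ n) • Y1ᶜ ⊆ X1 := by
    rintro _ ⟨v, hv, rfl⟩
    simp only [X1, Y1, Set.mem_ofPred_eq, Set.mem_compl_iff, not_lt] at hv ⊢
    rw [NZ.smul_zero, NZ.smul_one, e00, e01, e10, e11]
    simp only [zero_mul, add_zero, zero_add, norm_mul]
    have hx : 0 < ‖v.1 0‖ := by
      rcases hv0 v with h | h
      · exact h
      · nlinarith
    calc R * (‖N‖ * ‖v.1 1‖) ≤ R * ‖N‖ * (R * ‖v.1 0‖) := by
          rw [← mul_assoc]; gcongr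
      _ < 1 * (R * ‖v.1 0‖) := by gcongr
      _ < ‖M‖ * ‖v.1 0‖ := by rw [one_mul]; gcongr
  have a2 : (d ^ n)⁻¹ • X1ᶜ ⊆ Y1 := by
    rintro _ ⟨v, hv, rfl⟩
    simp only [X1, Y1, Set.mem_ofPred_eq, Set.mem_compl_iff, not_lt] at hv ⊢
    rw [NZ.smul_zero, NZ.smul_one, f00, f01, f10, f11]
    simp only [zero_mul, add_zero, zero_add, norm_mul]
    have hx : 0 < ‖v.1 1‖ := by
      rcases hv0 v with h | h
      · nlinarith
      · exact h
    calc R * (‖N‖ * ‖v.1 0‖) ≤ R * ‖N‖ * (R * ‖v.1 1‖) := by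
          rw [← mul_assoc]; gcongr
      _ < 1 * (R * ‖v.1 1‖) := by gcongr
      _ < ‖M‖ * ‖v.1 1‖ := by rw [one_mul]; gcongr
  -- disjointness of translates
  have key : ∀ p q r s x y : ℂ, ‖p‖ + ‖q‖ + ‖s‖ ≤ R * ‖r‖ → R * ‖y‖ < ‖x‖ →
      ‖p * x + q * y‖ ≤ R * ‖r * x + s * y‖ := by
    intro p q r s x y h1 h2
    have hy : ‖y‖ ≤ ‖x‖ := by nlinarith [norm_nonneg y]
    have h3 : ‖p * x + q * y‖ ≤ ‖p‖ * ‖x‖ + ‖q‖ * ‖y‖ := by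
      refine (norm_add_le _ _).trans ?_; simp
    have h4 : ‖r‖ * ‖x‖ - ‖s‖ * ‖y‖ ≤ ‖r * x + s * y‖ := by
      have := norm_sub_le (r * x + s * y) (s * y)
      simp only [add_sub_cancel_right, norm_mul] at this
      linarith
    have h5 : R * (‖s‖ * ‖y‖) ≤ ‖s‖ * ‖x‖ := by nlinarith [norm_nonneg s]
    have h6 : ‖q‖ * ‖y‖ ≤ ‖q‖ * ‖x‖ := by gcongr
    have h7 := mul_le_mul_of_nonneg_right h1 (norm_nonneg x)
    have h8 := mul_le_mul_of_nonneg_left h4 hR0.le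
    nlinarith
  have n00 := norm_nonneg (h.1 0 0)
  have n01 := norm_nonneg (h.1 0 1)
  have n10 := norm_nonneg (h.1 1 0)
  have n11 := norm_nonneg (h.1 1 1)
  have dXX : Disjoint X1 (h • X1) := by
    rw [Set.disjoint_right]
    rintro _ ⟨v, hv, rfl⟩ hc
    simp only [X1, Set.mem_ofPred_eq, NZ.smul_zero, NZ.smul_one] at hv hc
    have := key (h.1 0 0) (h.1 0 1) (h.1 1 0) (h.1 1 1) _ _ (by linarith [hR 1 0]) hv
    linarith
  have dXY : Disjoint X1 (h • Y1) := by
    rw [Set.disjoint_right]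
    rintro _ ⟨v, hv, rfl⟩ hc
    simp only [X1, Y1, Set.mem_ofPred_eq, NZ.smul_zero, NZ.smul_one] at hv hc
    have := key (h.1 0 1) (h.1 0 0) (h.1 1 1) (h.1 1 0) _ _ (by linarith [hR 1 1]) hv
    rw [add_comm, add_comm (h.1 1 1 * _)] at this
    linarith
  have dYX : Disjoint Y1 (h • X1) := by
    rw [Set.disjoint_right]
    rintro _ ⟨v, hv, rfl⟩ hc
    simp only [X1, Y1, Set.mem_ofPred_eq, NZ.smul_zero, NZ.smul_one] at hv hc
    have := key (h.1 1 0) (h.1 1 1) (h.1 0 0) (h.1 0 1) _ _ (by linarith [hR 0 0]) hv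
    linarith
  have dYY : Disjoint Y1 (h • Y1) := by
    rw [Set.disjoint_right]
    rintro _ ⟨v, hv, rfl⟩ hc
    simp only [Y1, Set.mem_ofPred_eq, NZ.smul_zero, NZ.smul_one] at hv hc
    have := key (h.1 1 1) (h.1 1 0) (h.1 0 1) (h.1 0 0) _ _ (by linarith [hR 0 1]) hv
    rw [add_comm, add_comm (h.1 0 1 * _)] at this
    linarith
  have hne : X1.Nonempty := ⟨⟨![1, 0], by intro h; simpa using congrFun h 0⟩, by change R * ‖(0:ℂ)‖ < ‖(1:ℂ)‖; simp⟩
  have hc : ∀ (e : SL2) (A B : Set NZ), e • Aᶜ ⊆ B → (h * e * h⁻¹) • (h • A)ᶜ ⊆ h • B := by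
    intro e A B hAB
    rw [← Set.smul_set_compl, mul_assoc, mul_smul, mul_smul, inv_smul_smul]
    exact Set.smul_set_mono hAB
  apply FreeGroup.injective_lift_of_ping_pong _ ![X1, h • X1] ![Y1, h • Y1]
  · intro i; fin_cases i
    · exact hne
    · exact hne.smul_set
  · intro i j hij; fin_cases i <;> fin_cases j
    · exact absurd rfl hij
    · exact dXX
    · exact dXX.symm
    · exact absurd rfl hij
  · intro i j hij; fin_cases i <;> fin_cases j
    · exact absurd rfl hij
    · exact dYY
    · exact dYY.symm
    · exact absurd rfl hij
  · intro i j; fin_cases i <;> fin_cases j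
    · exact hXY
    · exact dXY
    · exact dYX.symm
    · exact (Set.disjoint_smul_set).2 hXY
  · intro i; fin_cases i
    · exact a1
    · exact hc _ _ _ a1
  · intro i; fin_cases i
    · exact a2
    · have := hc _ _ _ a2
      have e : (![d ^ n, h * d ^ n * h⁻¹]⁻¹ : Fin 2 → SL2) 1 = h * (d ^ n)⁻¹ * h⁻¹ := by
        simp [mul_assoc]
      change (![d ^ n, h * d ^ n * h⁻¹]⁻¹ : Fin 2 → SL2) 1 • (h • X1)ᶜ ⊆ h • Y1
      rw [e]; exact this

theorem sl2_det (A : SL2) : A.1 0 0 * A.1 1 1 - A.1 0 1 * A.1 1 0 = 1 := by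
  have := A.2
  rwa [det_fin_two] at this

theorem sl2_mul (A B : SL2) (i j : Fin 2) :
    (A * B).1 i j = A.1 i 0 * B.1 0 j + A.1 i 1 * B.1 1 j := by
  rw [Matrix.SpecialLinearGroup.coe_mul, mul_apply, Fin.sum_univ_two]

theorem sl2_inv (A : SL2) : A⁻¹.1 0 0 = A.1 1 1 ∧ A⁻¹.1 0 1 = - A.1 0 1 ∧
    A⁻¹.1 1 0 = - A.1 1 0 ∧ A⁻¹.1 1 1 = A.1 0 0 := by
  rw [Matrix.SpecialLinearGroup.coe_inv, adjugate_fin_two]; simp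

theorem sl2_trace (A : SL2) : A.1.trace = A.1 0 0 + A.1 1 1 := trace_fin_two _

theorem sl2_ext {A B : SL2} (h00 : A.1 0 0 = B.1 0 0) (h01 : A.1 0 1 = B.1 0 1)
    (h10 : A.1 1 0 = B.1 1 0) (h11 : A.1 1 1 = B.1 1 1) : A = B := by
  apply Subtype.ext
  ext i j; fin_cases i <;> fin_cases j <;> assumption

theorem exists_big_eigenvalue (t : ℂ) (ht : ¬ (t.im = 0 ∧ |t.re| ≤ 2)) :
    ∃ μ : ℂ, 1 < ‖μ‖ ∧ μ * μ - t * μ + 1 = 0 := by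
  obtain ⟨s, hs⟩ := IsSquare.exists_sq ((t ^ 2 - 4)) (IsAlgClosed.exists_eq_mul_self _)
  have h1 : ∀ μ : ℂ, μ * μ - t * μ + 1 = 0 → ‖μ‖ ≠ 1 := by
    intro μ hμ hn
    apply ht
    have h2 : μ * (starRingEnd ℂ) μ = 1 := by
      rw [Complex.mul_conj, Complex.normSq_eq_norm_sq, hn]; simp
    have hμ0 : μ ≠ 0 := by rintro rfl; simp at hn
    have h3 : t = μ + (starRingEnd ℂ) μ := by
      apply mul_left_cancel₀ hμ0
      linear_combination -hμ - h2
    rw [Complex.add_conj] at h3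
    rw [h3]
    refine ⟨Complex.ofReal_im _, ?_⟩
    rw [Complex.ofReal_re, abs_mul]
    have := Complex.abs_re_le_norm μ
    rw [hn] at this
    norm_num; linarith
  set μ := (t + s) / 2
  have h4 : μ * μ - t * μ + 1 = 0 := by
    simp only [μ]; linear_combination -hs / 4
  rcases lt_trichotomy ‖μ‖ 1 with h | h | h
  · refine ⟨μ⁻¹, ?_, ?_⟩
    · have hμ0 : μ ≠ 0 := by intro h0; rw [h0] at h4; simp at h4
      rw [norm_inv]
      exact (one_lt_inv₀ (norm_pos_iff.2 hμ0)).2 h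
    · have hμ0 : μ ≠ 0 := by intro h0; rw [h0] at h4; simp at h4
      field_simp
      linear_combination h4
  · exact absurd h (h1 μ h4)
  · exact ⟨μ, h, h4⟩

theorem exists_diag (g : SL2) (ht : ¬ (g.1.trace.im = 0 ∧ |g.1.trace.re| ≤ 2)) :
    ∃ P d : SL2, g = P * d * P⁻¹ ∧ d.1 0 1 = 0 ∧ d.1 1 0 = 0 ∧ 1 < ‖d.1 0 0‖ := by
  obtain ⟨μ, hμ, hq⟩ := exists_big_eigenvalue _ ht
  have hμ0 : μ ≠ 0 := by rintro rfl; simp at hq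
  have hne : μ ≠ μ⁻¹ := by
    intro h
    have : ‖μ‖ = ‖μ‖⁻¹ := by conv_lhs => rw [h, norm_inv]
    have h2 : ‖μ‖⁻¹ < 1 := inv_lt_one_of_one_lt₀ hμ
    linarith
  rw [sl2_trace] at hq
  have hdet := sl2_det g
  have ev : ∀ ν : ℂ, ν * ν - (g.1 0 0 + g.1 1 1) * ν + 1 = 0 → ∃ v : Fin 2 → ℂ, v ≠ 0 ∧
      g.1 0 0 * v 0 + g.1 0 1 * v 1 = ν * v 0 ∧ g.1 1 0 * v 0 + g.1 1 1 * v 1 = ν * v 1 := by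
    intro ν hν
    have : (g.1 - ν • (1 : Matrix (Fin 2) (Fin 2) ℂ)).det = 0 := by
      rw [det_fin_two]
      simp
      linear_combination hν + hdet
    obtain ⟨v, hv0, hv⟩ := exists_mulVec_eq_zero_iff.2 this
    refine ⟨v, hv0, ?_, ?_⟩
    · have := congrFun hv 0
      simp [mulVec, dotProduct] at this
      linear_combination this
    · have := congrFun hv 1
      simp [mulVec, dotProduct] at this
      linear_combination this
  obtain ⟨v, hv0, v1, v2⟩ := ev μ hq
  obtain ⟨w, hw0, w1, w2⟩ := ev μ⁻¹ (by field_simp; linear_combination hq)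
  set D := v 0 * w 1 - w 0 * v 1 with hD
  have hD0 : D ≠ 0 := by
    intro h0
    have hsub : μ - μ⁻¹ ≠ 0 := sub_ne_zero.2 hne
    have hs0 : v 0 * w 1 = w 0 * v 1 := by linear_combination h0
    apply hw0
    have k1 : (μ - μ⁻¹) * (v 0 * w 0) = 0 := by
      linear_combination w 0 * (-v1) + v 0 * w1 - g.1 0 1 * hs0
    have k2 : (μ - μ⁻¹) * (v 1 * w 1) = 0 := by
      linear_combination w 1 * (-v2) + v 1 * w2 + g.1 1 0 * hs0
    have k1' := (mul_eq_zero.1 k1).resolve_left hsub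
    have k2' := (mul_eq_zero.1 k2).resolve_left hsub
    have hv : v 0 ≠ 0 ∨ v 1 ≠ 0 := by
      by_contra hc
      push Not at hc
      exact hv0 (by ext i; fin_cases i <;> simp [hc.1, hc.2])
    rcases hv with hv | hv
    · have a : w 0 = 0 := (mul_eq_zero.1 k1').resolve_left hv
      have b : w 1 = 0 := by
        rw [a, zero_mul] at hs0; exact (mul_eq_zero.1 hs0).resolve_left hv
      ext i; fin_cases i <;> simp [a, b]
    · have a : w 1 = 0 := (mul_eq_zero.1 k2').resolve_left hv
      have b : w 0 = 0 := by
        rw [a, mul_zero] at hs0; exact (mul_eq_zero.1 hs0.symm).resolve_right hv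
      ext i; fin_cases i <;> simp [a, b]
  let P : SL2 := ⟨!![v 0 / D, w 0; v 1 / D, w 1], by
    rw [det_fin_two_of]; field_simp; linear_combination -hD⟩
  let d : SL2 := ⟨!![μ, 0; 0, μ⁻¹], by rw [det_fin_two_of]; field_simp; ring⟩
  refine ⟨P, d, ?_, rfl, rfl, hμ⟩
  rw [eq_mul_inv_iff_mul_eq]
  apply sl2_ext <;> rw [sl2_mul, sl2_mul] <;> simp [P, d] <;> field_simp
  · linear_combination v1
  · field_simp at w1; linear_combination w1
  · linear_combination v2
  · field_simp at w2; linear_combination w2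

theorem free_of_lox (X g : SL2) (hX : X.1.trace = 1)
    (ht : ¬ (g.1.trace.im = 0 ∧ |g.1.trace.re| ≤ 2))
    (hc : (X * g * X⁻¹ * g⁻¹).1.trace ≠ 2) :
    ∃ n k : ℕ, Function.Injective (FreeGroup.lift
      ![g ^ n, (X * g ^ k * X) * g ^ n * (X * g ^ k * X)⁻¹]) := by
  obtain ⟨P, d, rfl, d01, d10, hd⟩ := exists_diag g ht
  obtain ⟨Z, rfl⟩ : ∃ Z, X = P * Z * P⁻¹ := ⟨P⁻¹ * X * P, by group⟩
  have trc : ∀ A : SL2, (P * A * P⁻¹).1.trace = A.1.trace := by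
    intro A
    rw [Matrix.SpecialLinearGroup.coe_mul, Matrix.SpecialLinearGroup.coe_mul, trace_mul_comm,
      ← mul_assoc, ← Matrix.SpecialLinearGroup.coe_mul, inv_mul_cancel]; simp
  have e1 : P * Z * P⁻¹ * (P * d * P⁻¹) * (P * Z * P⁻¹)⁻¹ * (P * d * P⁻¹)⁻¹ =
    P * (Z * d * Z⁻¹ * d⁻¹) * P⁻¹ := by group
  rw [e1, trc] at hc
  rw [trc, sl2_trace] at hX
  have hdd := sl2_det d
  have hZ := sl2_det Z
  rw [d01, zero_mul, sub_zero] at hdd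
  obtain ⟨i1, i2, i3, i4⟩ := sl2_inv Z
  obtain ⟨j1, j2, j3, j4⟩ := sl2_inv d
  have hqr : Z.1 0 1 * Z.1 1 0 ≠ 0 := by
    intro h0
    apply hc
    rw [sl2_trace]
    simp only [sl2_mul, i1, i2, i3, i4, j1, j2, j3, j4, d01, d10]
    linear_combination (2 * (Z.1 0 0 * Z.1 1 1)) * hdd + 2 * hZ + 2 * h0 - (d.1 0 0 ^ 2 + d.1 1 1 ^ 2) * h0
  have hdm : d.1 = diagonal ![d.1 0 0, d.1 1 1] := by
    ext i j; fin_cases i <;> fin_cases j <;> simp [d01, d10]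
  have hpow : ∀ m : ℕ, (d ^ m).1 = diagonal ![d.1 0 0 ^ m, d.1 1 1 ^ m] := by
    intro m
    rw [Matrix.SpecialLinearGroup.coe_pow, hdm, diagonal_pow]
    congr 1; ext i; fin_cases i <;> simp
  have e00 : ∀ n : ℕ, (d ^ n).1 0 0 = d.1 0 0 ^ n := by intro n; rw [hpow]; simp
  have e01 : ∀ n : ℕ, (d ^ n).1 0 1 = 0 := by intro n; rw [hpow]; simp
  have e10 : ∀ n : ℕ, (d ^ n).1 1 0 = 0 := by intro n; rw [hpow]; simp
  have e11 : ∀ n : ℕ, (d ^ n).1 1 1 = d.1 1 1 ^ n := by intro n; rw [hpow]; simp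
  -- choose k
  have hZq := left_ne_zero_of_mul hqr
  have hZr := right_ne_zero_of_mul hqr
  have key : ∀ A B : ℂ, (A ≠ 0 ∨ B ≠ 0) → ∀ᶠ k : ℕ in Filter.atTop,
      A * d.1 0 0 ^ k + B * d.1 1 1 ^ k ≠ 0 := by
    intro A B hAB
    by_cases hA : A = 0
    · refine Filter.Eventually.of_forall fun k => ?_
      have hB : B ≠ 0 := by tauto
      rw [hA, zero_mul, zero_add]
      exact mul_ne_zero hB (pow_ne_zero _ (right_ne_zero_of_mul_eq_one hdd))
    · have := (tendsto_pow_atTop_atTop_of_one_lt hd).eventually_gt_atTop (‖B‖ / ‖A‖)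
      filter_upwards [this] with k hk h0
      have hdk : d.1 0 0 ^ k * d.1 1 1 ^ k = 1 := by rw [← mul_pow, hdd, one_pow]
      have h1 : A * (d.1 0 0 ^ k) ^ 2 = - B := by
        linear_combination d.1 0 0 ^ k * h0 - B * hdk
      have h2 : ‖A‖ * (‖d.1 0 0‖ ^ k) ^ 2 = ‖B‖ := by
        have := congrArg norm h1
        simpa using this
      have h3 : 1 ≤ ‖d.1 0 0‖ ^ k := one_le_pow₀ hd.le
      have hA' : 0 < ‖A‖ := norm_pos_iff.2 hA
      rw [div_lt_iff₀ hA'] at hk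
      have h4 := mul_le_mul_of_nonneg_left h3 (by positivity : 0 ≤ ‖A‖ * ‖d.1 0 0‖ ^ k)
      linarith
  have hps : Z.1 0 0 ≠ 0 ∨ Z.1 1 1 ≠ 0 := by
    by_contra hcon
    push Not at hcon
    rw [hcon.1, hcon.2] at hX
    simp at hX
  obtain ⟨k, k1, k2, k3⟩ := ((key (Z.1 0 0 ^ 2) (Z.1 0 1 * Z.1 1 0) (Or.inr hqr)).and
    ((key (Z.1 0 0) (Z.1 1 1) hps).and
    (key (Z.1 0 1 * Z.1 1 0) (Z.1 1 1 ^ 2) (Or.inl hqr)))).exists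
  obtain ⟨n, hn⟩ := pingpong d (Z * d ^ k * Z) d01 d10 hd (by
    intro i j
    fin_cases i <;> fin_cases j <;> simp only [Fin.zero_eta, Fin.mk_one, sl2_mul, e00, e01, e10, e11]
    · convert k1 using 1; ring
    · convert mul_ne_zero hZq k2 using 1; ring
    · convert mul_ne_zero hZr k2 using 1; ring
    · convert k3 using 1; ring)
  refine ⟨n, k, ?_⟩
  have hconj : FreeGroup.lift ![(P * d * P⁻¹) ^ n, (P * Z * P⁻¹ * (P * d * P⁻¹) ^ k * (P * Z * P⁻¹)) *
      (P * d * P⁻¹) ^ n * (P * Z * P⁻¹ * (P * d * P⁻¹) ^ k * (P * Z * P⁻¹))⁻¹] =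
      (MulAut.conj P).toMonoidHom.comp (FreeGroup.lift ![d ^ n, (Z * d ^ k * Z) * d ^ n * (Z * d ^ k * Z)⁻¹]) := by
    ext i : 1
    fin_cases i
    · simp [conj_pow]
    · simp [conj_pow]; group
  rw [hconj]
  exact (MulAut.conj P).injective.comp hn

theorem mat2_sq {R : Type*} [CommRing R] (A : Matrix (Fin 2) (Fin 2) R) (h : A.det = 1) :
    A ^ 2 = A.trace • A - 1 := by
  rw [det_fin_two] at h
  ext i j
  fin_cases i <;> fin_cases j <;>
    simp [pow_two, mul_apply, Fin.sum_univ_two, trace_fin_two] <;> first | ring1 | linear_combination -h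

theorem mat2_cube {R : Type*} [CommRing R] (A : Matrix (Fin 2) (Fin 2) R) (h : A.det = 1)
    (ht : A.trace = 1) : A ^ 3 = -1 := by
  have h2 := mat2_sq A h
  rw [ht, one_smul] at h2
  calc A ^ 3 = A ^ 2 * A := by rw [pow_succ]
    _ = A ^ 2 - A := by rw [h2, sub_mul, ← pow_two, h2, one_mul]
    _ = -1 := by rw [h2]; noncomm_ring

theorem mat2_five {R : Type*} [CommRing R] (A : Matrix (Fin 2) (Fin 2) R) (h : A.det = 1) (p : R)
    (hp : p ^ 2 = p + 1) (ht : A.trace = p) : A ^ 5 = -1 := by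
  have h2 := mat2_sq A h
  rw [ht] at h2
  have h3 : A ^ 3 = p • A - p • 1 := by
    rw [pow_succ, h2, sub_mul, smul_mul_assoc, ← pow_two, h2, smul_sub, smul_smul, ← pow_two, hp, add_smul]
    simp
    abel
  have h4 : A ^ 4 = A - p • 1 := by
    rw [pow_succ, h3, sub_mul, smul_mul_assoc, ← pow_two, h2, smul_sub, smul_smul, ← pow_two, hp, add_smul]
    simp only [smul_mul_assoc, one_mul]
    simp
    abel
  rw [pow_succ, h4, sub_mul, ← pow_two, h2]
  simp

theorem center_of_neg {A : SL2} (h : A.1 = -1) : A ∈ Subgroup.center SL2 := by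
  rw [Subgroup.mem_center_iff]
  intro g
  apply Subtype.ext
  rw [Matrix.SpecialLinearGroup.coe_mul, Matrix.SpecialLinearGroup.coe_mul, h]; simp

theorem rels_center (k : ℕ) (a b : Fin k → ℕ) (X Y : SL2) (p : ℂ) (hp : p ^ 2 = p + 1)
    (hX : X.1.trace = 1) (hY : Y.1.trace = p) (hW : (wEval X Y (Wword k a b)).1.trace = 0) :
    ∀ r ∈ triRels k a b, FreeGroup.lift ![X, Y] r ∈ Subgroup.center SL2 := by
  intro r hr
  apply center_of_neg
  rcases hr with rfl | rfl | rfl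
  · rw [map_pow]
    simp only [xgen, FreeGroup.lift_apply_of, Matrix.cons_val_zero]
    exact mat2_cube _ X.2 hX
  · rw [map_pow]
    simp only [ygen, FreeGroup.lift_apply_of, Matrix.cons_val_one]
    exact mat2_five _ Y.2 p hp hY
  · rw [map_pow]
    have := mat2_sq _ (wEval X Y (Wword k a b)).2
    rw [hW] at this
    rw [zero_smul, zero_sub] at this
    exact this

theorem hasF2_of_traces (k : ℕ) (a b : Fin k → ℕ) (X Y : SL2) (p : ℝ) (hp : p ^ 2 = p + 1)
    (hX : X.1.trace = 1) (hY : Y.1.trace = p) (hW : (wEval X Y (Wword k a b)).1.trace = 0)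
    (hred : (X * Y).1.trace ^ 2 - p * (X * Y).1.trace + p - 2 ≠ 0) :
    HasF2 (TriGroup k a b) ∨ ((X * Y).1.trace.im = 0 ∧
      (X * Y).1.trace.re ^ 2 - p * (X * Y).1.trace.re + p - 2 < 0) := by
  by_contra hcon
  push Not at hcon
  obtain ⟨hno, hcon⟩ := hcon
  have rc := rels_center k a b X Y p (by exact_mod_cast hp) hX hY hW
  have hpc : (p : ℂ) ^ 2 = p + 1 := by exact_mod_cast hp
  set l := (X * Y).1.trace with hl
  have hX' := hX
  have hY' := hY
  have hl' := hl
  rw [sl2_trace] at hX' hY' hl'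
  rw [sl2_mul, sl2_mul] at hl'
  have dX := sl2_det X
  have dY := sl2_det Y
  obtain ⟨i1, i2, i3, i4⟩ := sl2_inv X
  obtain ⟨j1, j2, j3, j4⟩ := sl2_inv Y
  have trcomm : ∀ A B : SL2, (A * B * A⁻¹ * B⁻¹).1.trace =
      A.1.trace ^ 2 + B.1.trace ^ 2 + (A * B).1.trace ^ 2 - A.1.trace * B.1.trace * (A * B).1.trace - 2 := by
    intro A B
    obtain ⟨i1, i2, i3, i4⟩ := sl2_inv A
    obtain ⟨j1, j2, j3, j4⟩ := sl2_inv B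
    have dA := sl2_det A
    have dB := sl2_det B
    simp only [sl2_trace, sl2_mul, i1, i2, i3, i4, j1, j2, j3, j4]
    generalize A.1 0 0 = a0 at *
    generalize A.1 0 1 = a1 at *
    generalize A.1 1 0 = a2 at *
    generalize B.1 0 0 = b0 at *
    generalize B.1 0 1 = b1 at *
    generalize B.1 1 0 = b2 at *
    generalize A.1 1 1 = a3 at *
    generalize B.1 1 1 = b3 at *
    linear_combination ((b0^2 + 2*b0*b3+b3^2) - 2 * (b0*b3 - b1*b2)) * dA + ((a0^2 + 2*a0*a3+a3^2) - 2) * dB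
  by_cases him : l.im = 0
  · -- commutator
    have hge := hcon him
    have hlr : l = (l.re : ℂ) := by apply Complex.ext <;> simp [him]
    have hgt : 0 < l.re ^ 2 - p * l.re + p - 2 := by
      apply lt_of_le_of_ne hge
      intro h
      apply hred
      rw [hlr]
      exact_mod_cast h.symm
    set g := X * Y * X⁻¹ * Y⁻¹ with hg
    have tg : g.1.trace = ((l.re ^ 2 - p * l.re + p : ℝ) : ℂ) := by
      rw [hg, trcomm, ← hl, hX, hY, hlr]
      push_cast
      simp only [Complex.ofReal_re]
      linear_combination hpc
    have tXg : (X * g).1.trace = g.1.trace - 1 := by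
      have e : X * g = X * X * (Y * X⁻¹ * Y⁻¹) := by rw [hg]; group
      have e2 : (X * X).1 = X.1 - 1 := by
        rw [Matrix.SpecialLinearGroup.coe_mul, ← pow_two, mat2_sq _ X.2, hX, one_smul]
      have e3 : (Y * X⁻¹ * Y⁻¹).1.trace = 1 := by
        rw [sl2_trace]
        simp only [sl2_mul, i1, i2, i3, i4, j1, j2, j3, j4]
        linear_combination (X.1 0 0 + X.1 1 1) * dY + hX'
      rw [e, Matrix.SpecialLinearGroup.coe_mul, e2, sub_mul, trace_sub, one_mul, e3,
        ← Matrix.SpecialLinearGroup.coe_mul, hg]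
      exact congrArg (fun Z : SL2 => Z.1.trace - 1) (by group)
    obtain ⟨n, kk, inj⟩ := free_of_lox X g hX (by
      rw [tg]
      rintro ⟨_, h2⟩
      rw [Complex.ofReal_re, abs_le] at h2
      linarith) (by
      rw [trcomm, tXg, hX, tg]
      generalize hq : l.re ^ 2 - p * l.re + p = q at *
      intro h
      have h2 : q ^ 2 - q - 2 = 0 := by
        have : ((q ^ 2 - q - 2 : ℝ) : ℂ) = 0 := by push_cast; linear_combination h
        exact_mod_cast this
      nlinarith)
    apply hno
    refine hasF2_of_center (FreeGroup.lift ![X, Y]) rc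
      ((xgen * ygen * xgen⁻¹ * ygen⁻¹) ^ n)
      ((xgen * (xgen * ygen * xgen⁻¹ * ygen⁻¹) ^ kk * xgen) * (xgen * ygen * xgen⁻¹ * ygen⁻¹) ^ n * (xgen * (xgen * ygen * xgen⁻¹ * ygen⁻¹) ^ kk * xgen)⁻¹) ?_
    convert inj using 4 <;> simp [xgen, ygen, hg]
  · obtain ⟨n, kk, inj⟩ := free_of_lox X (X * Y) hX (by rw [← hl]; tauto) (by
      have e : X * (X * Y) * X⁻¹ * (X * Y)⁻¹ = X * (X * Y * X⁻¹ * Y⁻¹) * X⁻¹ := by group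
      have e3 : (X * (X * Y * X⁻¹ * Y⁻¹) * X⁻¹).1.trace = (X * Y * X⁻¹ * Y⁻¹).1.trace := by
        rw [Matrix.SpecialLinearGroup.coe_mul, trace_mul_comm, ← Matrix.SpecialLinearGroup.coe_mul]
        exact congrArg (fun Z : SL2 => Z.1.trace) (by group)
      rw [e, e3, trcomm, ← hl, hX, hY]
      intro h
      apply hred
      linear_combination h - hpc)
    apply hno
    refine hasF2_of_center (FreeGroup.lift ![X, Y]) rc ((xgen * ygen) ^ n)
      ((xgen * (xgen * ygen) ^ kk * xgen) * (xgen * ygen) ^ n * (xgen * (xgen * ygen) ^ kk * xgen)⁻¹) ?_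
    convert inj using 4 <;> simp [xgen, ygen]

theorem isIntegral_of_mem_adjoin_inv {A K : Type*} [CommRing A] [Field K] [Algebra A K] {z : K}
    (hz : z ≠ 0) (h : z ∈ Algebra.adjoin A {z⁻¹}) : IsIntegral A z := by
  rw [Algebra.adjoin_singleton_eq_range_aeval] at h
  obtain ⟨p, hp⟩ := h
  refine ⟨X ^ (p.natDegree + 1) - p.reverse, ?_, ?_⟩
  · apply monic_X_pow_sub
    exact lt_of_le_of_lt (degree_le_natDegree.trans (Nat.cast_le.2 p.reverse_natDegree_le)) (by exact_mod_cast Nat.lt_succ_self _)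
  · let _ : Invertible z := invertibleOfNonzero hz
    have h1 := eval₂_reverse_mul_pow (algebraMap A K) (⅟z) p
    have hp' : eval₂ (algebraMap A K) (⅟z) p = z := by
      rw [invOf_eq_inv]; exact hp
    rw [hp'] at h1
    rw [invOf_invOf] at h1
    rw [eval₂_sub, eval₂_X_pow, pow_succ, sub_eq_zero]
    have h2 : eval₂ (algebraMap A K) z p.reverse * (z⁻¹ ^ p.natDegree) = z := by
      rw [← invOf_eq_inv]; exact h1
    rw [inv_pow, ← div_eq_mul_inv, div_eq_iff (pow_ne_zero _ hz)] at h2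
    rw [h2, mul_comm]

/-- upper triangular generator -/
def triX {K : Type*} [Field K] (ξ : K) (h : ξ ≠ 0) : Matrix.SpecialLinearGroup (Fin 2) K :=
  ⟨!![ξ, 1; 0, ξ⁻¹], by rw [det_fin_two_of]; simp [h]⟩

/-- lower triangular generator -/
def triY {K : Type*} [Field K] (η z : K) (h : η ≠ 0) : Matrix.SpecialLinearGroup (Fin 2) K :=
  ⟨!![η, 0; z, η⁻¹], by rw [det_fin_two_of]; simp [h]⟩

abbrev AInt := integralClosure ℤ ℂ

/-- invariant for integrality -/
def ZInv (z : ℂ) (n : ℕ) (M : SL2) : Prop :=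
  (∃ u v : AInt, u * v = 1 ∧ ∃ e ∈ Algebra.adjoin AInt {z⁻¹}, M.1 0 0 * z⁻¹ ^ n = u.1 + z⁻¹ * e) ∧
  (∃ e ∈ Algebra.adjoin AInt {z⁻¹}, M.1 0 1 * z⁻¹ ^ n = z⁻¹ * e) ∧
  (∃ e ∈ Algebra.adjoin AInt {z⁻¹}, M.1 1 0 * z⁻¹ ^ n = e) ∧
  (∃ e ∈ Algebra.adjoin AInt {z⁻¹}, M.1 1 1 * z⁻¹ ^ n = e) ∧
  (n ≠ 0 → ∃ e ∈ Algebra.adjoin AInt {z⁻¹}, M.1 1 1 * z⁻¹ ^ n = z⁻¹ * e)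

theorem ZInv.one (z : ℂ) : ZInv z 0 1 := by
  refine ⟨⟨1, 1, by simp, 0, zero_mem _, by simp⟩, ⟨0, zero_mem _, by simp⟩,
    ⟨0, zero_mem _, by simp⟩, ⟨1, one_mem _, by simp⟩, by simp⟩

theorem ZInv.mul {z : ℂ} {n : ℕ} {M F : SL2} (hM : ZInv z n M) (hF : ZInv z 1 F) :
    ZInv z (n + 1) (M * F) := by
  obtain ⟨⟨u, v, huv, e, he, h0⟩, ⟨e1, he1, h1⟩, ⟨e2, he2, h2⟩, ⟨e3, he3, h3⟩, -⟩ := hM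
  obtain ⟨⟨u', v', huv', f, hf, g0⟩, ⟨f1, hf1, g1⟩, ⟨f2, hf2, g2⟩, -, g3⟩ := hF
  obtain ⟨f3, hf3, g3⟩ := g3 one_ne_zero
  rw [pow_one] at g0 g1 g2 g3
  have hw : z⁻¹ ∈ Algebra.adjoin AInt {z⁻¹} := Algebra.subset_adjoin rfl
  have hA : ∀ u : AInt, u.1 ∈ Algebra.adjoin AInt {z⁻¹} := fun u =>
    Subalgebra.algebraMap_mem (Algebra.adjoin AInt {z⁻¹}) u
  have hlast : (M * F).1 1 1 * z⁻¹ ^ (n + 1) = z⁻¹ * (e2 * f1 + e3 * f3) := by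
    rw [sl2_mul, pow_succ]
    linear_combination F.1 0 1 * z⁻¹ * h2 + e2 * g1 + F.1 1 1 * z⁻¹ * h3 + e3 * g3
  refine ⟨⟨u * u', v * v', by rw [mul_mul_mul_comm, huv, huv', one_mul],
    u.1 * f + u'.1 * e + e * (z⁻¹ * f) + e1 * f2, ?_, ?_⟩,
    ⟨(u.1 + z⁻¹ * e) * f1 + z⁻¹ * e1 * f3, ?_, ?_⟩, ⟨e2 * (u'.1 + z⁻¹ * f) + e3 * f2, ?_, ?_⟩,
    ⟨z⁻¹ * (e2 * f1 + e3 * f3), ?_, hlast⟩, fun _ => ⟨(e2 * f1 + e3 * f3), ?_, hlast⟩⟩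
  · exact add_mem (add_mem (add_mem (mul_mem (hA _) hf) (mul_mem (hA _) he))
      (mul_mem he (mul_mem hw hf))) (mul_mem he1 hf2)
  · rw [sl2_mul, pow_succ]
    push_cast
    linear_combination F.1 0 0 * z⁻¹ * h0 + (u.1 + z⁻¹ * e) * g0 + F.1 1 0 * z⁻¹ * h1 + z⁻¹ * e1 * g2
  · exact add_mem (mul_mem (add_mem (hA _) (mul_mem hw he)) hf1) (mul_mem (mul_mem hw he1) hf3)
  · rw [sl2_mul, pow_succ]
    linear_combination F.1 0 1 * z⁻¹ * h0 + (u.1 + z⁻¹ * e) * g1 + F.1 1 1 * z⁻¹ * h1 + z⁻¹ * e1 * g3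
  · exact add_mem (mul_mem he2 (add_mem (hA _) (mul_mem hw hf))) (mul_mem he3 hf2)
  · rw [sl2_mul, pow_succ]
    linear_combination F.1 0 0 * z⁻¹ * h2 + e2 * g0 + F.1 1 0 * z⁻¹ * h3 + e3 * g2
  · exact mul_mem hw (add_mem (mul_mem he2 hf1) (mul_mem he3 hf3))
  · exact add_mem (mul_mem he2 hf1) (mul_mem he3 hf3)

theorem ZInv.list (z : ℂ) (l : List SL2) (hl : ∀ F ∈ l, ZInv z 1 F) : ZInv z l.length l.prod := by
  induction l using List.reverseRecOn with
  | nil => simpa using ZInv.one z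
  | append_singleton l F ih =>
    rw [List.prod_append, List.length_append, List.prod_singleton]
    exact (ih (fun F hF => hl F (by simp [hF]))).mul (hl F (by simp))

theorem wEval_W (X Y : SL2) (k : ℕ) (a b : Fin k → ℕ) :
    wEval X Y (Wword k a b) = (List.ofFn fun i : Fin k => X ^ a i * Y ^ b i).prod := by
  rw [wEval, Wword, map_list_prod, List.map_ofFn]
  congr 2
  ext i : 1
  simp [xgen, ygen]

theorem ZInv.factor (ξ η z : ℂ) (hz : z ≠ 0) (hξ : ξ ^ 2 - ξ + 1 = 0)
    (hη : η ^ 4 - η ^ 3 + η ^ 2 - η + 1 = 0) (h1 : ξ ≠ 0) (h2 : η ≠ 0) (a b : ℕ)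
    (ha : 0 < a ∧ a < 3) (hb : 0 < b ∧ b < 5) :
    ZInv z 1 (triX ξ h1 ^ a * triY η z h2 ^ b) := by
  have iξ : ξ⁻¹ = 1 - ξ := by field_simp; linear_combination hξ
  have iη : η⁻¹ = - η ^ 4 := by
    field_simp
    linear_combination (η + 1) * hη
  have Iξ : IsIntegral ℤ ξ := ⟨X ^ 2 - X + 1, by monicity!, by simpa [eval₂_add, eval₂_sub] using hξ⟩
  have Iη : IsIntegral ℤ η := ⟨X ^ 4 - X ^ 3 + X ^ 2 - X + 1, by monicity!, by
    simpa [eval₂_add, eval₂_sub] using hη⟩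
  -- powers
  have hXa : ∃ c d : ℂ, IsIntegral ℤ c ∧ IsIntegral ℤ d ∧ c * d = 1 ∧ (triX ξ h1 ^ a).1 = !![c, 1; 0, d] := by
    obtain ⟨ha1, ha2⟩ := ha
    interval_cases a
    · refine ⟨ξ, ξ⁻¹, Iξ, ?_, by field_simp, by rw [pow_one]; rfl⟩
      rw [iξ]; exact isIntegral_one.sub Iξ
    · refine ⟨ξ ^ 2, ξ⁻¹ ^ 2, Iξ.pow _, ?_, by field_simp, ?_⟩
      · rw [iξ]; exact (isIntegral_one.sub Iξ).pow _
      · rw [Matrix.SpecialLinearGroup.coe_pow]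
        simp only [triX, pow_two]
        ext i j
        fin_cases i <;> fin_cases j <;> simp [iξ]
  have hYb : ∃ c d V V' : ℂ, IsIntegral ℤ c ∧ IsIntegral ℤ d ∧ c * d = 1 ∧
      IsIntegral ℤ V ∧ IsIntegral ℤ V' ∧ V * V' = 1 ∧
      (triY η z h2 ^ b).1 = !![c, 0; V * z, d] := by
    have Iη' : IsIntegral ℤ η⁻¹ := by rw [iη]; exact (Iη.pow _).neg
    have hp : (η + η⁻¹) * (η + η⁻¹ - 1) = 1 := by
      rw [iη]; linear_combination (η ^ 4 + η ^ 3 - 2 * η - 1) * hη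
    obtain ⟨hb1, hb2⟩ := hb
    have key : ∀ V V' : ℂ, IsIntegral ℤ V → IsIntegral ℤ V' → V * V' = 1 →
      (triY η z h2 ^ b).1 = !![η ^ b, 0; V * z, η⁻¹ ^ b] → _ := fun V V' i1 i2 i3 i4 =>
      (⟨η ^ b, η⁻¹ ^ b, V, V', Iη.pow _, Iη'.pow _, by rw [← mul_pow, mul_inv_cancel₀ h2, one_pow], i1, i2, i3, i4⟩ :
        ∃ c d V V' : ℂ, IsIntegral ℤ c ∧ IsIntegral ℤ d ∧ c * d = 1 ∧
      IsIntegral ℤ V ∧ IsIntegral ℤ V' ∧ V * V' = 1 ∧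
      (triY η z h2 ^ b).1 = !![c, 0; V * z, d])
    interval_cases b
    · apply key 1 1 isIntegral_one isIntegral_one (by simp)
      simp only [pow_one, one_mul]; rfl
    · apply key _ _ (Iη.add Iη') ((Iη.add Iη').sub isIntegral_one) hp
      rw [Matrix.SpecialLinearGroup.coe_pow]
      ext i j
      fin_cases i <;> fin_cases j <;> simp [triY, pow_succ, mul_apply, Fin.sum_univ_two]
      ring
    · apply key _ _ (Iη.add Iη') ((Iη.add Iη').sub isIntegral_one) hp
      rw [Matrix.SpecialLinearGroup.coe_pow]
      ext i j
      fin_cases i <;> fin_cases j <;> simp [triY, pow_succ, mul_apply, Fin.sum_univ_two]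
      rw [iη]; linear_combination (z * (η ^ 4 + η ^ 3 - η)) * hη
    · apply key 1 1 isIntegral_one isIntegral_one (by simp)
      rw [Matrix.SpecialLinearGroup.coe_pow]
      ext i j
      fin_cases i <;> fin_cases j <;> simp [triY, pow_succ, mul_apply, Fin.sum_univ_two]
      rw [iη]; linear_combination (z * (-η ^ 8 - η ^ 7 + η ^ 5 + η ^ 4 + η ^ 3 - η - 1)) * hη
  obtain ⟨c, d, Ic, Id, hcd, hX⟩ := hXa
  obtain ⟨c', d', V, V', Ic', Id', hcd', IV, IV', hV, hY⟩ := hYb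
  have hw : z⁻¹ ∈ Algebra.adjoin AInt {z⁻¹} := Algebra.subset_adjoin rfl
  have hA : ∀ u : ℂ, IsIntegral ℤ u → u ∈ Algebra.adjoin AInt {z⁻¹} := fun u hu =>
    Subalgebra.algebraMap_mem (Algebra.adjoin AInt {z⁻¹}) (⟨u, hu⟩ : AInt)
  have hzz := mul_inv_cancel₀ hz
  have e00 : (triX ξ h1 ^ a * triY η z h2 ^ b).1 0 0 = c * c' + V * z := by
    rw [sl2_mul, hX, hY]; simp
  have e01 : (triX ξ h1 ^ a * triY η z h2 ^ b).1 0 1 = d' := by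
    rw [sl2_mul, hX, hY]; simp
  have e10 : (triX ξ h1 ^ a * triY η z h2 ^ b).1 1 0 = d * (V * z) := by
    rw [sl2_mul, hX, hY]; simp
  have e11 : (triX ξ h1 ^ a * triY η z h2 ^ b).1 1 1 = d * d' := by
    rw [sl2_mul, hX, hY]; simp
  refine ⟨⟨⟨V, IV⟩, ⟨V', IV'⟩, Subtype.ext hV, c * c', hA _ (Ic.mul Ic'), ?_⟩,
    ⟨d', hA _ Id', ?_⟩, ⟨d * V, hA _ (Id.mul IV), ?_⟩, ⟨z⁻¹ * (d * d'), mul_mem hw (hA _ (Id.mul Id')), ?_⟩,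
    fun _ => ⟨d * d', hA _ (Id.mul Id'), ?_⟩⟩
  · rw [e00]; linear_combination V * hzz
  · rw [e01]; ring
  · rw [e10]; linear_combination d * V * hzz
  · rw [e11]; ring
  · rw [e11]; ring

theorem z_integral (ξ η z : ℂ) (hξ : ξ ^ 2 - ξ + 1 = 0)
    (hη : η ^ 4 - η ^ 3 + η ^ 2 - η + 1 = 0) (h1 : ξ ≠ 0) (h2 : η ≠ 0)
    (k : ℕ) (hk : 1 ≤ k) (a b : Fin k → ℕ)
    (ha : ∀ i, 0 < a i ∧ a i < 3) (hb : ∀ i, 0 < b i ∧ b i < 5)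
    (hW : (wEval (triX ξ h1) (triY η z h2) (Wword k a b)).1.trace = 0) : IsIntegral ℤ z := by
  by_cases hz : z = 0
  · rw [hz]; exact isIntegral_zero
  have := ZInv.list z (List.ofFn fun i : Fin k => triX ξ h1 ^ a i * triY η z h2 ^ b i) (by
    intro F hF
    rw [List.mem_ofFn] at hF
    obtain ⟨i, rfl⟩ := hF
    exact ZInv.factor ξ η z hz hξ hη h1 h2 _ _ (ha i) (hb i))
  rw [← wEval_W, List.length_ofFn] at this
  obtain ⟨⟨u, v, huv, e, he, h0⟩, -, -, -, h3⟩ := this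
  obtain ⟨f, hf, h3⟩ := h3 (by omega)
  rw [sl2_trace] at hW
  have hz' : z = -(v.1 * (e + f)) := by
    have huv' : u.1 * v.1 = 1 := by exact_mod_cast congrArg Subtype.val huv
    have : u.1 + z⁻¹ * (e + f) = 0 := by
      linear_combination -h0 - h3 + z⁻¹ ^ k * hW
    have hzz := mul_inv_cancel₀ hz
    linear_combination z * v.1 * this - z * huv' - v.1 * (e + f) * hzz
  have : z ∈ Algebra.adjoin AInt {z⁻¹} := by
    have : -(v.1 * (e + f)) ∈ Algebra.adjoin AInt {z⁻¹} :=
      neg_mem (mul_mem (Subalgebra.algebraMap_mem (Algebra.adjoin AInt {z⁻¹}) v) (add_mem he hf))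
    rwa [← hz'] at this
  exact isIntegral_trans (A := AInt) z (isIntegral_of_mem_adjoin_inv hz this)

theorem red_excl (X Y : SL2) (v : Fin 2 → ℂ) (hv : v ≠ 0) (e f : ℂ) (he : e ^ 30 = 1) (hf : f ^ 30 = 1)
    (hX : X.1.mulVec v = e • v) (hY : Y.1.mulVec v = f • v) (k : ℕ) (a b : Fin k → ℕ) :
    (wEval X Y (Wword k a b)).1.trace ≠ 0 := by
  intro h0
  let S : Submonoid SL2 :=
    { carrier := {A | ∃ ω : ℂ, ω ^ 30 = 1 ∧ A.1.mulVec v = ω • v}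
      one_mem' := ⟨1, by simp, by simp⟩
      mul_mem' := by
        rintro A B ⟨ω, h1, h2⟩ ⟨ω', h1', h2'⟩
        refine ⟨ω * ω', by rw [mul_pow, h1, h1', one_mul], ?_⟩
        rw [Matrix.SpecialLinearGroup.coe_mul, ← mulVec_mulVec, h2', mulVec_smul, h2, smul_smul, mul_comm] }
  have hXS : X ∈ S := ⟨e, he, hX⟩
  have hYS : Y ∈ S := ⟨f, hf, hY⟩
  have hW : wEval X Y (Wword k a b) ∈ S := by
    rw [wEval_W]
    apply Submonoid.list_prod_mem
    intro F hF
    rw [List.mem_ofFn] at hF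
    obtain ⟨i, rfl⟩ := hF
    exact mul_mem (pow_mem hXS _) (pow_mem hYS _)
  obtain ⟨ω, h1, h2⟩ := hW
  have h3 := mat2_sq _ (wEval X Y (Wword k a b)).2
  rw [h0, zero_smul, zero_sub] at h3
  have h4 : (ω * ω) • v = (-1 : ℂ) • v := by
    rw [← smul_smul, ← h2, ← mulVec_smul, ← h2, mulVec_mulVec, ← pow_two, h3]
    simp [neg_mulVec]
  have h5 : ω * ω = -1 := smul_left_injective ℂ hv h4
  have h6 : ω ^ 30 = -1 := by
    calc ω ^ 30 = (ω * ω) ^ 15 := by ring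
      _ = -1 := by rw [h5]; norm_num
  rw [h6] at h1
  norm_num at h1

theorem hasF2_of_tri (k : ℕ) (a b : Fin k → ℕ) (ξ η z : ℂ) (hξ : ξ ^ 2 - ξ + 1 = 0)
    (hη : η ^ 4 - η ^ 3 + η ^ 2 - η + 1 = 0) (h1 : ξ ≠ 0) (h2 : η ≠ 0)
    (hW : (wEval (triX ξ h1) (triY η z h2) (Wword k a b)).1.trace = 0) :
    HasF2 (TriGroup k a b) ∨ ∃ p l : ℝ, p ^ 2 = p + 1 ∧ η + η⁻¹ = p ∧
      ξ * η + ξ⁻¹ * η⁻¹ + z = l ∧ l ^ 2 - p * l + p - 2 < 0 := by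
  have iξ : ξ⁻¹ = 1 - ξ := by field_simp; linear_combination hξ
  have iη : η⁻¹ = - η ^ 4 := by
    field_simp
    linear_combination (η + 1) * hη
  have ξ3 : ξ ^ 3 = -1 := by linear_combination (ξ + 1) * hξ
  have η5 : η ^ 5 = -1 := by linear_combination (η + 1) * hη
  have ξ30 : ξ ^ 30 = 1 := by
    calc ξ ^ 30 = (ξ ^ 3) ^ 10 := by ring
      _ = 1 := by rw [ξ3]; norm_num
  have η30 : η ^ 30 = 1 := by
    calc η ^ 30 = (η ^ 5) ^ 6 := by ring
      _ = 1 := by rw [η5]; norm_num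
  have hp : (η + η⁻¹) * (η + η⁻¹) = η + η⁻¹ + 1 := by
    rw [iη]; linear_combination (η ^ 4 + η ^ 3 - 2 * η - 1) * hη
  obtain ⟨p, hpp, hpe⟩ : ∃ p : ℝ, p ^ 2 = p + 1 ∧ η + η⁻¹ = p := by
    have h5 : (Real.sqrt 5 : ℂ) ^ 2 = 5 := by
      rw [← Complex.ofReal_pow, Real.sq_sqrt (by norm_num)]; norm_num
    have h5' : (Real.sqrt 5) ^ 2 = 5 := Real.sq_sqrt (by norm_num)
    have : (η + η⁻¹ - (1 + Real.sqrt 5) / 2) * (η + η⁻¹ - (1 - Real.sqrt 5) / 2) = 0 := by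
      linear_combination hp - h5 / 4
    rcases mul_eq_zero.1 this with h | h
    · refine ⟨(1 + Real.sqrt 5) / 2, by linear_combination h5' / 4, ?_⟩
      push_cast; linear_combination h
    · refine ⟨(1 - Real.sqrt 5) / 2, by linear_combination h5' / 4, ?_⟩
      push_cast; linear_combination h
  have tX : (triX ξ h1).1.trace = 1 := by
    rw [sl2_trace]; simp [triX, iξ]
  have tY : (triY η z h2).1.trace = p := by
    rw [sl2_trace, ← hpe]; simp [triY]
  have tXY : (triX ξ h1 * triY η z h2).1.trace = ξ * η + ξ⁻¹ * η⁻¹ + z := by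
    rw [sl2_trace, sl2_mul, sl2_mul]; simp [triX, triY]; ring
  have hz0 : z ≠ 0 := by
    rintro rfl
    refine red_excl (triX ξ h1) (triY η 0 h2) ![1, 0] (fun h => by simpa using congrFun h 0) ξ η ξ30 η30 ?_ ?_ k a b hW
    · ext i; fin_cases i <;> simp [triX, mulVec, dotProduct]
    · ext i; fin_cases i <;> simp [triY, mulVec, dotProduct]
  have hz1 : z - (ξ⁻¹ - ξ) * (η - η⁻¹) ≠ 0 := by
    intro h
    refine red_excl (triX ξ h1) (triY η z h2) ![1, ξ⁻¹ - ξ] (fun h => by simpa using congrFun h 0)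
      ξ⁻¹ η (by rw [inv_pow, ξ30, inv_one]) η30 ?_ ?_ k a b hW
    · ext i; fin_cases i <;> simp [triX, mulVec, dotProduct]
    · ext i; fin_cases i
      · simp [triY, mulVec, dotProduct]
      · simp [triY, mulVec, dotProduct]
        linear_combination h
  have hxx : ξ * ξ⁻¹ = 1 := mul_inv_cancel₀ h1
  have hyy : η * η⁻¹ = 1 := mul_inv_cancel₀ h2
  have hfac : (ξ * η + ξ⁻¹ * η⁻¹ + z) ^ 2 - p * (ξ * η + ξ⁻¹ * η⁻¹ + z) + p - 2 =
      z * (z - (ξ⁻¹ - ξ) * (η - η⁻¹)) := by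
    have hpc : (p : ℂ) ^ 2 = p + 1 := by exact_mod_cast hpp
    have hη2 : η ^ 2 - p * η + 1 = 0 := by rw [← hpe]; linear_combination -hyy
    have : η⁻¹ = p - η := by rw [← hpe]; ring
    rw [iξ, this]
    linear_combination (4*η^2-4*η*p+p^2)*hξ - 3*hη2 - hpc
  rcases hasF2_of_traces k a b (triX ξ h1) (triY η z h2) p hpp tX tY hW (by
    rw [tXY, hfac]; exact mul_ne_zero hz0 hz1) with h | ⟨h3, h4⟩
  · exact Or.inl h
  · right
    rw [tXY] at h3 h4
    refine ⟨p, (ξ * η + ξ⁻¹ * η⁻¹ + z).re, hpp, hpe, ?_, h4⟩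
    apply Complex.ext
    · simp
    · rw [h3]; simp

theorem bound_beta (p l : ℝ) (hp : p ^ 2 = p + 1) (h : l ^ 2 - p * l + p - 2 < 0) :
    |p ^ 2 * (l ^ 2 - p * l) * (l ^ 2 - p * l + p - 1)| < 1 := by
  have hp2 : p < 2 := by nlinarith
  have hp3 : -1 < p := by nlinarith
  set q := l ^ 2 - p * l with hq
  have hq1 : -1 < q := by nlinarith [sq_nonneg (l - p / 2)]
  rw [abs_lt]
  have hpp : 0 < p ^ 2 := by rw [hp]; linarith
  constructor
  · have h1 : p ^ 2 * q * (q + p - 1) = (p * (q + (p - 1) / 2)) ^ 2 - 1 / 4 := by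
      linear_combination (-(p ^ 2 - p) / 4 - 1 / 4) * hp
    rw [h1]; nlinarith [sq_nonneg (p * (q + (p - 1) / 2))]
  · have h1 : 1 - p ^ 2 * q * (q + p - 1) = p ^ 2 * ((2 - p - q) * (q + 1)) := by
      linear_combination (p - 1) * hp
    have : 0 < p ^ 2 * ((2 - p - q) * (q + 1)) := by
      apply mul_pos hpp (mul_pos _ _) <;> linarith
    linarith

theorem numfield_zero {K : Type*} [Field K] [NumberField K] (x : K) (hx : IsIntegral ℤ x)
    (h : ∀ σ : K →+* ℂ, ‖σ x‖ < 1) : x = 0 := by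
  by_contra h0
  let w : NumberField.InfinitePlace K := Classical.arbitrary _
  have h1 : ∀ w : NumberField.InfinitePlace K, w x < 1 := by
    intro w
    rw [← NumberField.InfinitePlace.norm_embedding_eq]
    exact h _
  have := NumberField.InfinitePlace.one_le_of_lt_one (w := w) (a := (⟨x, hx⟩ : NumberField.RingOfIntegers K))
    (by intro h; exact h0 (congrArg Subtype.val h)) (fun z _ => h1 z)
  exact absurd this (not_le.2 (h1 w))

theorem map_entry {K : Type*} [Field K] (σ : K →+* ℂ) (A : Matrix.SpecialLinearGroup (Fin 2) K) (i j) :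
    (A.map σ).1 i j = σ (A.1 i j) := rfl

theorem wEval_map {K : Type*} [Field K] (σ : K →+* ℂ) (X Y : Matrix.SpecialLinearGroup (Fin 2) K)
    (w : FreeGroup (Fin 2)) : wEval (X.map σ) (Y.map σ) w = (FreeGroup.lift ![X, Y] w).map σ := by
  have : FreeGroup.lift ![X.map σ, Y.map σ] =
      (Matrix.SpecialLinearGroup.map σ).comp (FreeGroup.lift ![X, Y]) := by
    ext i : 1; fin_cases i <;> simp
  rw [wEval, this]; rfl

theorem special_roots_tri (k : ℕ) (hk : 1 ≤ k) (a b : Fin k → ℕ)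
    (ha : ∀ i, 0 < a i ∧ a i < 3) (hb : ∀ i, 0 < b i ∧ b i < 5)
    (ξ η z : ℂ) (hξ : ξ ^ 2 - ξ + 1 = 0)
    (hη : η ^ 4 - η ^ 3 + η ^ 2 - η + 1 = 0) (h1 : ξ ≠ 0) (h2 : η ≠ 0)
    (hW : (wEval (triX ξ h1) (triY η z h2) (Wword k a b)).1.trace = 0)
    (lam psi : ℂ) (hl : lam = ξ * η + ξ⁻¹ * η⁻¹ + z) (hpsi : psi = η + η⁻¹) :
    HasF2 (TriGroup k a b) ∨ (lam ^ 2 - psi * lam) * (lam ^ 2 - psi * lam + psi - 1) = 0 := by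
  by_cases hF : HasF2 (TriGroup k a b)
  · exact Or.inl hF
  right
  have hz := z_integral ξ η z hξ hη h1 h2 k hk a b ha hb hW
  have Iξ : IsIntegral ℤ ξ := ⟨X ^ 2 - X + 1, by monicity!, by simpa [eval₂_add, eval₂_sub] using hξ⟩
  have Iη : IsIntegral ℤ η := ⟨X ^ 4 - X ^ 3 + X ^ 2 - X + 1, by monicity!, by
    simpa [eval₂_add, eval₂_sub] using hη⟩
  let K := IntermediateField.adjoin ℚ ({ξ, η, z} : Set ℂ)
  have hfin : FiniteDimensional ℚ K := by
    apply IntermediateField.finiteDimensional_adjoin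
    intro x hx
    rcases hx with rfl | rfl | rfl
    · exact Iξ.tower_top
    · exact Iη.tower_top
    · exact hz.tower_top
  have : NumberField K := { to_charZero := inferInstance, to_finiteDimensional := hfin }
  let x : K := ⟨ξ, IntermediateField.subset_adjoin _ _ (by simp)⟩
  let y : K := ⟨η, IntermediateField.subset_adjoin _ _ (by simp)⟩
  let zz : K := ⟨z, IntermediateField.subset_adjoin _ _ (by simp)⟩
  have inj : Function.Injective (algebraMap K ℂ) := (algebraMap K ℂ).injective
  have hx0 : x ≠ 0 := fun h => h1 (congrArg (algebraMap K ℂ) h)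
  have hy0 : y ≠ 0 := fun h => h2 (congrArg (algebraMap K ℂ) h)
  have hx : x ^ 2 - x + 1 = 0 := inj (by simpa using hξ)
  have hy : y ^ 4 - y ^ 3 + y ^ 2 - y + 1 = 0 := inj (by simpa using hη)
  have mX : ∀ σ : K →+* ℂ, ∀ h, (triX x hx0).map σ = triX (σ x) h := by
    intro σ h
    apply sl2_ext <;> (rw [map_entry]; simp [triX])
  have mY : ∀ σ : K →+* ℂ, ∀ h, (triY y zz hy0).map σ = triY (σ y) (σ zz) h := by
    intro σ h
    apply sl2_ext <;> (rw [map_entry]; simp [triY])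
  have trm : ∀ σ : K →+* ℂ, ∀ A : Matrix.SpecialLinearGroup (Fin 2) K, (A.map σ).1.trace = σ A.1.trace := by
    intro σ A
    simp [trace_fin_two, map_entry]
  have hWK : (FreeGroup.lift ![triX x hx0, triY y zz hy0] (Wword k a b)).1.trace = 0 := by
    apply inj
    rw [← trm, ← wEval_map, mX _ h1, mY _ h2, map_zero]
    exact hW
  have Ix : IsIntegral ℤ x := ⟨X ^ 2 - X + 1, by monicity!, by simpa [eval₂_add, eval₂_sub] using hx⟩
  have Iy : IsIntegral ℤ y := ⟨X ^ 4 - X ^ 3 + X ^ 2 - X + 1, by monicity!, by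
    simpa [eval₂_add, eval₂_sub] using hy⟩
  have Iz : IsIntegral ℤ zz := (isIntegral_algebraMap_iff inj).1 hz
  have ix : x⁻¹ = 1 - x := by field_simp; linear_combination hx
  have iy : y⁻¹ = - y ^ 4 := by
    field_simp
    linear_combination (y + 1) * hy
  set P := y + y⁻¹ with hP
  set L := x * y + x⁻¹ * y⁻¹ + zz with hL
  have IP : IsIntegral ℤ P := by rw [hP, iy]; exact Iy.add (Iy.pow _).neg
  have IL : IsIntegral ℤ L := by
    rw [hL, iy, ix]
    exact ((Ix.mul Iy).add ((isIntegral_one.sub Ix).mul (Iy.pow _).neg)).add Iz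
  have Iq : IsIntegral ℤ (L ^ 2 - P * L) := (IL.pow _).sub (IP.mul IL)
  have hβ : P ^ 2 * (L ^ 2 - P * L) * (L ^ 2 - P * L + P - 1) = 0 := by
    apply numfield_zero
    · exact ((IP.pow _).mul Iq).mul ((Iq.add IP).sub isIntegral_one)
    · intro σ
      have sx0 : σ x ≠ 0 := (map_ne_zero σ).2 hx0
      have sy0 : σ y ≠ 0 := (map_ne_zero σ).2 hy0
      have sx : σ x ^ 2 - σ x + 1 = 0 := by simpa using congrArg σ hx
      have sy : σ y ^ 4 - σ y ^ 3 + σ y ^ 2 - σ y + 1 = 0 := by simpa using congrArg σ hy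
      rcases hasF2_of_tri k a b (σ x) (σ y) (σ zz) sx sy sx0 sy0 (by
        rw [← mX, ← mY, wEval_map, trm, hWK, map_zero]) with h | ⟨p, l, hp, e1, e2, hb⟩
      · exact absurd h hF
      · have sP : σ P = p := by rw [← e1, hP]; simp
        have sL : σ L = l := by rw [← e2, hL]; simp
        have := bound_beta p l hp hb
        rw [← Real.norm_eq_abs, ← Complex.norm_real] at this
        simpa [sP, sL] using this
  have hP0 : P ^ 2 ≠ 0 := by
    apply pow_ne_zero
    intro h0
    have e : P ^ 2 = P + 1 := by
      rw [hP, iy]; linear_combination (y ^ 4 + y ^ 3 - 2 * y - 1) * hy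
    rw [h0] at e; norm_num at e
  rw [mul_assoc] at hβ
  have h3 := congrArg (algebraMap K ℂ) ((mul_eq_zero.1 hβ).resolve_left hP0)
  have eP : algebraMap K ℂ P = psi := by rw [hpsi, hP]; simp [x, y]
  have eL : algebraMap K ℂ L = lam := by rw [hl, hL]; simp [x, y, zz]
  simp only [map_mul, map_sub, map_add, map_pow, map_one, map_zero, eP, eL] at h3
  exact h3

noncomputable def phi : ℂ := (1 + (Real.sqrt 5 : ℂ)) / 2

theorem phi_sq : phi ^ 2 = phi + 1 := by
  have h5 : (Real.sqrt 5 : ℂ) ^ 2 = 5 := by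
    rw [← Complex.ofReal_pow, Real.sq_sqrt (by norm_num)]; norm_num
  rw [phi]; linear_combination h5 / 4

theorem roots_four (k : ℕ) (hk : 1 ≤ k) (a b : Fin k → ℕ)
    (ha : ∀ i, 0 < a i ∧ a i < 3) (hb : ∀ i, 0 < b i ∧ b i < 5) (τ : ℂ[X])
    (hτ : IsTracePolynomial (Wword k a b) τ) (α : ℂ) (hα : τ.eval α = 0) :
    HasF2 (TriGroup k a b) ∨ α = 0 ∨ α = phi ∨ α = 1 ∨ α = phi - 1 := by
  obtain ⟨ξ, hξ⟩ : ∃ ξ : ℂ, ξ ^ 2 - ξ + 1 = 0 := by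
    obtain ⟨r, hr⟩ : ∃ r : ℂ, r ^ 2 = -3 := IsAlgClosed.exists_pow_nat_eq _ (by norm_num)
    exact ⟨(1 + r) / 2, by linear_combination hr / 4⟩
  obtain ⟨η, hη⟩ : ∃ η : ℂ, η ^ 2 - phi * η + 1 = 0 := by
    obtain ⟨r, hr⟩ : ∃ r : ℂ, r ^ 2 = phi ^ 2 - 4 := IsAlgClosed.exists_pow_nat_eq _ (by norm_num)
    exact ⟨(phi + r) / 2, by linear_combination hr / 4⟩
  have h1 : ξ ≠ 0 := by rintro rfl; norm_num at hξ
  have h2 : η ≠ 0 := by rintro rfl; norm_num at hη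
  have hp := phi_sq
  have e1 : phi = η + η⁻¹ := by field_simp; linear_combination -hη
  have hη4 : η ^ 4 - η ^ 3 + η ^ 2 - η + 1 = 0 := by
    linear_combination (η ^ 2 + (phi - 1) * η + 1) * hη + (η^2) * hp
  have iξ : ξ⁻¹ = 1 - ξ := by field_simp; linear_combination hξ
  have tX : (triX ξ h1).1.trace = 1 := by
    rw [sl2_trace]; simp [triX, iξ]
  set z := α - ξ * η - ξ⁻¹ * η⁻¹ with hz
  have tY : (triY η z h2).1.trace = phi := by
    rw [sl2_trace, e1]; simp [triY]
  have tXY : (triX ξ h1 * triY η z h2).1.trace = ξ * η + ξ⁻¹ * η⁻¹ + z := by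
    rw [sl2_trace, sl2_mul, sl2_mul]; simp [triX, triY]; ring
  have e2 : α = ξ * η + ξ⁻¹ * η⁻¹ + z := by rw [hz]; ring
  have hW := hτ (triX ξ h1) (triY η z h2) tX tY
  rw [tXY, ← e2, hα] at hW
  rcases special_roots_tri k hk a b ha hb ξ η z hξ hη4 h1 h2 hW α phi e2 e1 with h | h
  · exact Or.inl h
  right
  have : α * (α - phi) * ((α - 1) * (α - (phi - 1))) = 0 := by linear_combination h
  rcases mul_eq_zero.1 this with h | h
  · rcases mul_eq_zero.1 h with h | h
    · exact Or.inl h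
    · exact Or.inr (Or.inl (sub_eq_zero.1 h))
  · rcases mul_eq_zero.1 h with h | h
    · exact Or.inr (Or.inr (Or.inl (sub_eq_zero.1 h)))
    · exact Or.inr (Or.inr (Or.inr (sub_eq_zero.1 h)))

section HNN
variable {G : Type*} [Group G] {A B : Subgroup G} {φ : A ≃* B}

open HNNExtension

/-- data `(L,u,m,R)` of a syllable -/
def syl (b c : G) (x : Fin 2 × Bool) : G × ℤˣ × G × G :=
  if x.1 = 0 then (if x.2 then (1, 1, b, c) else (c⁻¹, 1, b⁻¹, 1))
  else (if x.2 then (1, -1, c, b) else (b⁻¹, -1, c⁻¹, 1))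

def sylF (b c : G) : List (Fin 2 × Bool) → G × List (ℤˣ × G)
  | [] => (1, [])
  | x :: l => ((syl b c x).1, ((syl b c x).2.1, (syl b c x).2.2.1) ::
      (-(syl b c x).2.1, (syl b c x).2.2.2 * (sylF b c l).1) :: (sylF b c l).2)

theorem sylF_chain (b c : G) (hb : b ∉ A) (hc : c ∉ B) (l : List (Fin 2 × Bool))
    (hl : FreeGroup.IsReduced l) :
    (sylF b c l).2.IsChain (fun a b => a.2 ∈ toSubgroup A B a.1 → a.1 = b.1) := by
  induction l with
  | nil => exact List.isChain_nil
  | cons x l ih =>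
    have ih' := ih (by
      unfold FreeGroup.IsReduced at hl ⊢
      exact hl.tail)
    have key : ((-(syl b c x).2.1, (syl b c x).2.2.2 * (sylF b c l).1) :: (sylF b c l).2).IsChain
        (fun a b => a.2 ∈ toSubgroup A B a.1 → a.1 = b.1) := by
      cases l with
      | nil => simp [sylF]
      | cons y l =>
        refine List.IsChain.cons_cons ?_ ih'
        have hxy : x.1 = y.1 → x.2 = y.2 := by
          unfold FreeGroup.IsReduced at hl
          rw [List.isChain_cons_cons] at hl
          exact hl.1
        obtain ⟨x1, x2⟩ := x
        obtain ⟨y1, y2⟩ := y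
        fin_cases x1 <;> fin_cases y1 <;> cases x2 <;> cases y2 <;>
          simp [syl, sylF, hb, hc] at hxy ⊢
    refine List.IsChain.cons_cons ?_ key
    obtain ⟨x1, x2⟩ := x
    fin_cases x1 <;> cases x2 <;> simp [syl, hb, hc]

theorem sylF_prod (b c : G) (l : List (Fin 2 × Bool)) :
    HNNExtension.of (sylF b c l).1 * ((sylF b c l).2.map (fun x : ℤˣ × G => t ^ (x.1 : ℤ) * HNNExtension.of x.2)).prod =
    (FreeGroup.lift ![(t * HNNExtension.of b * t⁻¹ * HNNExtension.of c : HNNExtension G A B φ), t⁻¹ * HNNExtension.of c * t * HNNExtension.of b])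
      (FreeGroup.mk l) := by
  induction l with
  | nil => simp [sylF, ← FreeGroup.one_eq_mk]
  | cons x l ih =>
    have : FreeGroup.mk (x :: l) = FreeGroup.mk [x] * FreeGroup.mk l := by
      simp [FreeGroup.mul_mk]
    rw [this, map_mul, ← ih]
    obtain ⟨x1, x2⟩ := x
    fin_cases x1 <;> cases x2 <;> simp [syl, sylF, mul_assoc]

theorem hnn_free (b c : G) (hb : b ∉ A) (hc : c ∉ B) : HasF2 (HNNExtension G A B φ) := by
  refine ⟨FreeGroup.lift ![(t * HNNExtension.of b * t⁻¹ * HNNExtension.of c), t⁻¹ * HNNExtension.of c * t * HNNExtension.of b], ?_⟩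
  rw [injective_iff_map_eq_one]
  intro w hw
  rw [← FreeGroup.mk_toWord (x := w), ← sylF_prod] at hw
  let W : NormalWord.ReducedWord G A B :=
    ⟨(sylF b c w.toWord).1, (sylF b c w.toWord).2, sylF_chain b c hb hc _ FreeGroup.isReduced_toWord⟩
  have h1 := ReducedWord.toList_eq_nil_of_mem_of_range φ W (by
    change HNNExtension.of _ * _ ∈ _
    rw [hw]; exact one_mem _)
  have h2 : (sylF b c w.toWord).2 = [] := h1
  have : w.toWord = [] := by
    cases h : w.toWord with
    | nil => rfl
    | cons x l => rw [h] at h2; simp [sylF] at h2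
  exact FreeGroup.toWord_eq_nil_iff.1 this
end HNN

section BS
variable {Γ : Type*} [Group Γ] (τ : Γ) (B : Subgroup Γ)

def cA : Subgroup B := (B.comap (MulAut.conj τ).toMonoidHom).subgroupOf B

theorem mem_cA (b : B) : b ∈ cA τ B ↔ τ * b * τ⁻¹ ∈ B := Iff.rfl

def cPhi : cA τ B ≃* cA τ⁻¹ B where
  toFun b := ⟨⟨τ * b.1.1 * τ⁻¹, b.2⟩, by
    rw [mem_cA]
    simp [mul_assoc]⟩
  invFun b := ⟨⟨τ⁻¹ * b.1.1 * τ⁻¹⁻¹, b.2⟩, by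
    rw [mem_cA]
    simp [mul_assoc]⟩
  left_inv b := by ext; simp [mul_assoc]
  right_inv b := by ext; simp [mul_assoc]
  map_mul' a b := by ext; simp [mul_assoc]

abbrev cH := HNNExtension B (cA τ B) (cA τ⁻¹ B) (cPhi τ B)

abbrev cT : cH τ B := HNNExtension.t
abbrev cOf (b : Γ) (hb : b ∈ B) : cH τ B := HNNExtension.of ⟨b, hb⟩

variable {τ B}
theorem cT_of (b : Γ) (hb : b ∈ B) (hb' : τ * b * τ⁻¹ ∈ B) :
    cT τ B * cOf τ B b hb = cOf τ B (τ * b * τ⁻¹) hb' * cT τ B :=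
  HNNExtension.t_mul_of (φ := cPhi τ B) ⟨⟨b, hb⟩, hb'⟩

theorem cT_inv_of (b : Γ) (hb : b ∈ B) (hb' : τ⁻¹ * b * τ ∈ B) :
    (cT τ B)⁻¹ * cOf τ B b hb = cOf τ B (τ⁻¹ * b * τ) hb' * (cT τ B)⁻¹ := by
  have h : τ⁻¹ * b * τ⁻¹⁻¹ ∈ B := by simpa using hb'
  have := HNNExtension.inv_t_mul_of (φ := cPhi τ B) ⟨⟨b, hb⟩, h⟩
  rw [this]
  congr 3
  simp [cPhi]

theorem cOf_congr {g g' : Γ} (e : g = g') (h : g ∈ B) (h' : g' ∈ B) :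
    cOf τ B g h = cOf τ B g' h' := by subst e; rfl

variable (τ B)
def cMu : cH τ B →* Γ :=
  HNNExtension.lift B.subtype τ (by
    rintro ⟨⟨b, hb⟩, h⟩
    simp [cPhi])

variable {τ B}
theorem cMu_of (b : Γ) (hb : b ∈ B) : cMu τ B (cOf τ B b hb) = b := by simp [cMu]
theorem cMu_t : cMu τ B (cT τ B) = τ := by simp [cMu]

variable {I : Type*} (b : I → Γ)
variable (τ) in
def cB (r : ℕ) : Subgroup Γ :=
  Subgroup.closure {g | ∃ l : ℤ, l.natAbs ≤ r ∧ ∃ i, g = τ ^ l * b i * τ ^ (-l)}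

variable {b}
theorem cB_gen (r : ℕ) (l : ℤ) (h : l.natAbs ≤ r) (i : I) : τ ^ l * b i * τ ^ (-l) ∈ cB τ b r :=
  Subgroup.subset_closure ⟨l, h, i, rfl⟩

theorem cB_b (r : ℕ) (i : I) : b i ∈ cB τ b r := by
  simpa using cB_gen (τ := τ) (b := b) r 0 (by simp) i

theorem cB_mono {r s : ℕ} (h : r ≤ s) : cB τ b r ≤ cB τ b s := by
  apply Subgroup.closure_mono
  rintro g ⟨l, hl, i, rfl⟩
  exact ⟨l, hl.trans h, i, rfl⟩

theorem cB_conj {r s : ℕ} (n : ℤ) (h : r + n.natAbs ≤ s) (g : Γ) (hg : g ∈ cB τ b r) :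
    τ ^ n * g * τ ^ (-n) ∈ cB τ b s := by
  have : cB τ b r ≤ (cB τ b s).comap (MulAut.conj (τ ^ n)).toMonoidHom := by
    rw [cB, Subgroup.closure_le]
    rintro g ⟨l, hl, i, rfl⟩
    have := cB_gen (τ := τ) (b := b) s (n + l) (by omega) i
    have e : τ ^ n * (τ ^ l * b i * τ ^ (-l)) * (τ ^ n)⁻¹ = τ ^ (n + l) * b i * τ ^ (-(n + l)) := by
      group
    rw [← e] at this
    exact this
  have := this hg
  rw [_root_.zpow_neg]
  exact this

variable (τ b) in
def cQ (m r : ℕ) : Set (cH τ (cB τ b m)) :=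
  {h | ∃ g, ∃ hg : g ∈ cB τ b m, g ∈ cB τ b r ∧ ∃ k : ℤ, h = cOf τ _ g hg * cT τ _ ^ k}

theorem cQ_t (m r : ℕ) (h : r + 1 ≤ m) (x) (hx : x ∈ cQ τ b m r) : cT τ _ * x ∈ cQ τ b m (r + 1) := by
  obtain ⟨g, hg, hr, k, rfl⟩ := hx
  have h1 : τ * g * τ⁻¹ ∈ cB τ b (r + 1) := by
    simpa using cB_conj (s := r + 1) 1 (by simp) g hr
  refine ⟨_, cB_mono h h1, h1, 1 + k, ?_⟩
  rw [← mul_assoc, cT_of g hg (cB_mono h h1), mul_assoc, _root_.zpow_one_add]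

theorem cQ_t' (m r : ℕ) (h : r + 1 ≤ m) (x) (hx : x ∈ cQ τ b m r) : (cT τ _)⁻¹ * x ∈ cQ τ b m (r + 1) := by
  obtain ⟨g, hg, hr, k, rfl⟩ := hx
  have h1 : τ⁻¹ * g * τ ∈ cB τ b (r + 1) := by
    simpa using cB_conj (s := r + 1) (-1) (by simp) g hr
  refine ⟨_, cB_mono h h1, h1, -1 + k, ?_⟩
  rw [← mul_assoc, cT_inv_of g hg (cB_mono h h1), mul_assoc, _root_.zpow_add, _root_.zpow_neg_one]

theorem cQ_tpow (m r : ℕ) (n : ℕ) (h : r + n ≤ m) (x) (hx : x ∈ cQ τ b m r) :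
    cT τ _ ^ n * x ∈ cQ τ b m (r + n) ∧ (cT τ _)⁻¹ ^ n * x ∈ cQ τ b m (r + n) := by
  induction n with
  | zero => simpa using hx
  | succ n ih =>
    obtain ⟨h1, h2⟩ := ih (by omega)
    constructor
    · rw [pow_succ', mul_assoc]; exact cQ_t m (r + n) (by omega) _ h1
    · rw [pow_succ', mul_assoc]; exact cQ_t' m (r + n) (by omega) _ h2

theorem cQ_mono (m : ℕ) {r s : ℕ} (h : r ≤ s) : cQ τ b m r ⊆ cQ τ b m s := by
  rintro x ⟨g, hg, hr, k, rfl⟩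
  exact ⟨g, hg, cB_mono h hr, k, rfl⟩

theorem cQ_tzpow (m r s : ℕ) (n : ℤ) (h : r + n.natAbs ≤ s) (hs : s ≤ m) (x) (hx : x ∈ cQ τ b m r) :
    cT τ _ ^ n * x ∈ cQ τ b m s := by
  apply cQ_mono m h
  obtain ⟨h1, h2⟩ := cQ_tpow m r n.natAbs (by omega) x hx
  rcases Int.natAbs_eq n with e | e
  · generalize n.natAbs = k at *
    subst e
    rw [zpow_natCast]; exact h1
  · generalize n.natAbs = k at *
    subst e
    rw [_root_.zpow_neg, zpow_natCast, ← inv_pow]; exact h2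

theorem cQ_of (m r : ℕ) (g) (hg : g ∈ cB τ b m) (hr : g ∈ cB τ b r) (x) (hx : x ∈ cQ τ b m r) :
    cOf τ _ g hg * x ∈ cQ τ b m r := by
  obtain ⟨g', hg', hr', k, rfl⟩ := hx
  refine ⟨g * g', mul_mem hg hg', mul_mem hr hr', k, ?_⟩
  rw [← mul_assoc]
  congr 1
  rw [cOf, cOf, cOf, ← map_mul]; rfl

variable (n : I → ℤ)
variable (τ b) in
def cF (m : ℕ) : FreeGroup I →* cH τ (cB τ b m) :=
  FreeGroup.lift fun i => cT τ _ ^ (n i) * cOf τ _ (b i) (cB_b m i)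

theorem cF_mem (N m : ℕ) (hn : ∀ i, (n i).natAbs ≤ N) (l : List (I × Bool)) (hl : N * l.length ≤ m) :
    cF τ b n m (FreeGroup.mk l) ∈ cQ τ b m (N * l.length) := by
  induction l with
  | nil =>
    refine ⟨1, one_mem _, one_mem _, 0, ?_⟩
    rw [← FreeGroup.one_eq_mk, map_one, zpow_zero, mul_one]
    exact (map_one HNNExtension.of).symm
  | cons x l ih =>
    have e : FreeGroup.mk (x :: l) = FreeGroup.mk [x] * FreeGroup.mk l := by
      simp [FreeGroup.mul_mk]
    rw [List.length_cons, mul_add, mul_one] at hl ⊢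
    have ih' := ih (by omega)
    rw [e, map_mul]
    obtain ⟨i, _ | _⟩ := x
    · have : cF τ b n m (FreeGroup.mk [(i, false)]) =
          cOf τ _ (b i)⁻¹ (inv_mem (cB_b m i)) * cT τ _ ^ (-n i) := by
        simp only [cF, FreeGroup.lift_mk, List.map_cons, List.map_nil, List.prod_singleton, cond_false]
        rw [_root_.mul_inv_rev, _root_.zpow_neg]
        congr 1
      rw [this, mul_assoc]
      refine cQ_of m _ _ _ (inv_mem (cB_b _ i)) _ (cQ_tzpow m _ _ _ ?_ hl _ ih')
      rw [Int.natAbs_neg]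
      have := hn i; omega
    · have : cF τ b n m (FreeGroup.mk [(i, true)]) =
          cT τ _ ^ (n i) * cOf τ _ (b i) (cB_b m i) := by
        simp [cF, FreeGroup.lift_mk]
      rw [this, mul_assoc]
      refine cQ_tzpow m _ _ _ ?_ hl _ (cQ_of m _ _ _ (cB_b _ i) _ ih')
      have := hn i; omega

theorem c_conj (m : ℕ) (l : ℕ) (hl : l ≤ m) (i : I) (e : ℤ) (he : e = 1 ∨ e = -1)
    (h : τ ^ (e * l) * b i * τ ^ (-(e * l)) ∈ cB τ b m) :
    cOf τ _ _ h = cT τ _ ^ (e * l) * cOf τ _ (b i) (cB_b m i) * cT τ _ ^ (-(e * l)) := by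
  induction l with
  | zero => simp
  | succ l ih =>
    have h0 := cB_gen (τ := τ) (b := b) m (e * l) (by rcases he with rfl | rfl <;> simp <;> omega) i
    have h1 := ih (by omega) h0
    rcases he with rfl | rfl
    · have := cT_of (τ := τ) _ h0 (by convert h using 1; push_cast; group)
      rw [h1, ← mul_inv_eq_iff_eq_mul] at this
      refine (Eq.trans ?_ this.symm).trans ?_
      · exact cOf_congr (by push_cast; group) _ _
      · push_cast; group
    · have := cT_inv_of (τ := τ) _ h0 (by convert h using 1; push_cast; group)
      rw [h1, ← mul_inv_eq_iff_eq_mul] at this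
      refine (Eq.trans ?_ this.symm).trans ?_
      · exact cOf_congr (by push_cast; group) _ _
      · push_cast; group
end BS

theorem bieri_strebel {Γ : Type*} [Group Γ] {I : Type*} [Finite I] (π : FreeGroup I →* Γ)
    (hπ : Function.Surjective π) (R : Set (FreeGroup I)) (hR : R.Finite) (hR1 : ∀ r ∈ R, π r = 1)
    (hker : ∀ w, π w = 1 → w ∈ Subgroup.normalClosure R) (χ : Γ →* Multiplicative ℤ) (τ : Γ)
    (hτ : χ τ = Multiplicative.ofAdd 1) :
    HasF2 Γ ∨ ∃ B : Subgroup Γ, B.FG ∧ (∀ b ∈ B, χ b = 1) ∧ Subgroup.closure (insert τ (B : Set Γ)) = ⊤ ∧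
      ((∀ b ∈ B, τ * b * τ⁻¹ ∈ B) ∨ (∀ b ∈ B, τ⁻¹ * b * τ⁻¹⁻¹ ∈ B)) := by
  classical
  have := Fintype.ofFinite I
  obtain ⟨wτ, hwτ⟩ := hπ τ
  let n : I → ℤ := fun i => (χ (π (FreeGroup.of i))).toAdd
  let b : I → Γ := fun i => τ ^ (-n i) * π (FreeGroup.of i)
  have χτ : ∀ k : ℤ, χ (τ ^ k) = Multiplicative.ofAdd k := by
    intro k; rw [map_zpow, hτ, ← ofAdd_zsmul]; simp
  have hχb : ∀ i, χ (b i) = 1 := by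
    intro i
    simp only [b, map_mul, χτ]
    rw [ofAdd_neg]; simp [n]
  have hχB : ∀ r, ∀ g ∈ cB τ b r, χ g = 1 := by
    intro r
    have : cB τ b r ≤ χ.ker := by
      rw [cB, Subgroup.closure_le]
      rintro g ⟨l, -, i, rfl⟩
      simp [MonoidHom.mem_ker, hχb]
    exact fun g hg => this hg
  obtain ⟨N, hN⟩ : ∃ N : ℕ, ∀ i, (n i).natAbs ≤ N :=
    ⟨Finset.univ.sup fun i => (n i).natAbs, fun i => Finset.le_sup (f := fun i => (n i).natAbs) (Finset.mem_univ i)⟩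
  obtain ⟨ℓ, hℓ⟩ : ∃ ℓ : ℕ, ∀ r ∈ insert wτ R, r.toWord.length ≤ ℓ := by
    have := (hR.insert wτ).image (fun r => r.toWord.length)
    obtain ⟨M, hM⟩ := this.bddAbove
    exact ⟨M, fun r hr => hM ⟨r, hr, rfl⟩⟩
  let m := N * ℓ
  let B := cB τ b m
  let F := cF τ b n m
  have hμF : (cMu τ B).comp F = π := by
    ext i
    simp only [MonoidHom.comp_apply, F, cF, FreeGroup.lift_apply_of, map_mul, map_zpow]
    rw [cMu_of, cMu_t]; simp [b]
  have hμF' : ∀ w, cMu τ B (F w) = π w := fun w => by rw [← hμF]; rfl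
  have key : ∀ w ∈ insert wτ R, ∀ k : ℤ, π w = τ ^ k → F w = cT τ B ^ k := by
    intro w hw k hk
    have h1 := cF_mem (τ := τ) (b := b) n N m hN w.toWord (Nat.mul_le_mul_left _ (hℓ w hw))
    rw [FreeGroup.mk_toWord] at h1
    obtain ⟨g, hg, -, j, hj⟩ := h1
    have h2 : F w = cOf τ B g hg * cT τ B ^ j := hj
    have h3 := hμF' w
    rw [h2, map_mul, map_zpow, cMu_of, cMu_t, hk] at h3
    have h4 := congrArg χ h3
    rw [map_mul, hχB m g hg, one_mul, χτ, χτ] at h4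
    have h5 : j = k := Multiplicative.ofAdd.injective h4
    subst h5
    have h6 : g = 1 := by simpa using h3
    subst h6
    rw [h2]
    have : cOf τ B 1 hg = 1 := map_one HNNExtension.of
    rw [this, one_mul]
  have hF : ∀ w, π w = 1 → F w = 1 := by
    intro w hw
    have : Subgroup.normalClosure R ≤ F.ker := Subgroup.normalClosure_le_normal (by
      intro r hr
      have := key r (Set.mem_insert_of_mem _ hr) 0 (by rw [hR1 r hr, zpow_zero])
      rw [zpow_zero] at this
      exact this)
    exact this (hker w hw)
  have hTF : cT τ B = F wτ := by
    rw [key wτ (Set.mem_insert _ _) 1 (by rw [hwτ, zpow_one]), zpow_one]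
  have hb : ∀ i, cOf τ B (b i) (cB_b m i) ∈ F.range := by
    intro i
    have : cOf τ B (b i) (cB_b m i) = (cT τ B ^ (n i))⁻¹ * F (FreeGroup.of i) := by
      simp [F, cF, B]
    rw [this, hTF]
    exact mul_mem (inv_mem (zpow_mem (MonoidHom.mem_range.2 ⟨_, rfl⟩) _)) (MonoidHom.mem_range.2 ⟨_, rfl⟩)
  have hBr : ∀ g (hg : g ∈ B), cOf τ B g hg ∈ F.range := by
    intro g hg
    have : B ≤ Subgroup.map B.subtype (F.range.comap HNNExtension.of) := by
      refine (Subgroup.closure_le _).2 ?_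
      rintro g ⟨l, hl, i, rfl⟩
      have hg := cB_gen (τ := τ) (b := b) m l hl i
      refine ⟨⟨_, hg⟩, ?_, rfl⟩
      obtain ⟨e, he, hle⟩ : ∃ e : ℤ, (e = 1 ∨ e = -1) ∧ l = e * l.natAbs := by
        rcases Int.natAbs_eq l with h | h
        · exact ⟨1, Or.inl rfl, by omega⟩
        · exact ⟨-1, Or.inr rfl, by omega⟩
      change cOf τ B _ _ ∈ F.range
      generalize l.natAbs = k at *
      subst hle
      rw [c_conj m k hl i e he hg]
      have : cT τ (cB τ b m) ∈ F.range := ⟨_, hTF.symm⟩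
      exact mul_mem (mul_mem (zpow_mem this _) (hb i)) (zpow_mem this _)
    obtain ⟨g', h1, h2⟩ := this hg
    have : g' = ⟨g, hg⟩ := Subtype.ext h2
    subst this
    exact h1
  have hsurj : ∀ h : cH τ B, h ∈ F.range := by
    intro h
    induction h using HNNExtension.induction_on with
    | of g => exact hBr g.1 g.2
    | t => exact ⟨_, hTF.symm⟩
    | mul x y hx hy => exact mul_mem hx hy
    | inv x hx => exact inv_mem hx
  have hinj : Function.Injective (cMu τ B) := by
    rw [injective_iff_map_eq_one]
    intro h hh
    obtain ⟨w, rfl⟩ := hsurj h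
    exact hF w (by rw [← hμF', hh])
  by_cases h1 : ∀ g ∈ B, τ * g * τ⁻¹ ∈ B
  rotate_left
  by_cases h2 : ∀ g ∈ B, τ⁻¹ * g * τ⁻¹⁻¹ ∈ B
  rotate_left
  · left
    push Not at h1 h2
    obtain ⟨g, hg, hg'⟩ := h1
    obtain ⟨g2, hg2, hg2'⟩ := h2
    exact (hnn_free (φ := cPhi τ B) ⟨g, hg⟩ ⟨g2, hg2⟩ hg' hg2').of_inj _ hinj
  all_goals
    right
    refine ⟨B, ?_, hχB m, ?_, by tauto⟩
    · rw [Subgroup.fg_iff]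
      refine ⟨_, rfl, ?_⟩
      have : ((fun p : ℤ × I => τ ^ p.1 * b p.2 * τ ^ (-p.1)) '' (Set.Icc (-(m : ℤ)) m ×ˢ Set.univ)).Finite :=
        ((Set.finite_Icc _ _).prod Set.finite_univ).image _
      refine this.subset ?_
      rintro g ⟨l, hl, i, rfl⟩
      exact ⟨(l, i), ⟨⟨by omega, by omega⟩, trivial⟩, rfl⟩
    · rw [eq_top_iff]
      rintro g -
      obtain ⟨w, rfl⟩ := hπ g
      have h3 : τ ∈ Subgroup.closure (insert τ (B : Set Γ)) := Subgroup.subset_closure (Set.mem_insert _ _)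
      induction w using FreeGroup.induction_on with
      | C1 => rw [map_one]; exact one_mem _
      | of i =>
        have : π (FreeGroup.of i) = τ ^ (n i) * b i := by simp [b]
        rw [this]
        exact mul_mem (zpow_mem h3 _) (Subgroup.subset_closure (Set.mem_insert_of_mem _ (cB_b m i)))
      | inv_of i h => rw [map_inv]; exact inv_mem h
      | mul x y hx hy => rw [map_mul]; exact mul_mem hx hy

theorem deriv_inner {Γ L Γ₀ : Type*} [Group Γ] [Field L] [LinearOrderedCommGroupWithZero Γ₀]
    (v : Valuation L Γ₀) (ρ : Γ →* Lˣ) (δ : Γ → L) (hδ : ∀ g h, δ (g * h) = δ g + ρ g * δ h)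
    (τ : Γ) (B : Subgroup Γ) (hB : B.FG) (hvB : ∀ b ∈ B, v (ρ b) = 1) (hvτ : 1 < v (ρ τ))
    (hgen : Subgroup.closure (insert τ (B : Set Γ)) = ⊤) (hconj : ∀ b ∈ B, τ * b * τ⁻¹ ∈ B) :
    ∃ a, ∀ g, δ g = a * (ρ g - 1) := by
  have h1 : (ρ τ : L) - 1 ≠ 0 := by
    intro h
    rw [sub_eq_zero.1 h, map_one] at hvτ
    exact lt_irrefl _ hvτ
  refine ⟨δ τ / (ρ τ - 1), ?_⟩
  set a := δ τ / (ρ τ - 1) with ha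
  set d : Γ → L := fun g => δ g - a * (ρ g - 1) with hd
  have hdm : ∀ g h, d (g * h) = d g + ρ g * d h := by
    intro g h; simp only [hd, hδ, map_mul, Units.val_mul]; ring
  have hd1 : d 1 = 0 := by
    have := hdm 1 1
    simpa using this
  have hdinv : ∀ g, d g⁻¹ = - ((ρ g⁻¹ : Lˣ) : L) * d g := by
    intro g
    have := hdm g⁻¹ g
    rw [inv_mul_cancel, hd1] at this
    linear_combination -this
  have hdτ : d τ = 0 := by
    simp only [hd, ha]; field_simp; simp
  have hdc : ∀ g, d (τ * g * τ⁻¹) = ρ τ * d g := by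
    intro g
    rw [hdm, hdm, hdτ, hdinv, hdτ]; ring
  have hdB : ∀ b ∈ B, d b = 0 := by
    obtain ⟨S, hS⟩ := hB
    have hle : ∀ M, (∀ s ∈ S, v (d s) ≤ M) → ∀ b ∈ B, v (d b) ≤ M := by
      intro M hM b hb
      rw [← hS] at hb
      induction hb using Subgroup.closure_induction with
      | mem x hx => exact hM x hx
      | one => rw [hd1, map_zero]; exact zero_le'
      | mul x y hx hy h1 h2 =>
        rw [hdm]
        refine (v.map_add _ _).trans (max_le h1 ?_)
        rw [map_mul, hvB x (hS ▸ hx), one_mul]; exact h2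
      | inv x hx h =>
        rw [hdinv, map_mul, Valuation.map_neg, hvB _ (inv_mem (hS ▸ hx)), one_mul]; exact h
    rcases S.eq_empty_or_nonempty with h0 | h0
    · intro b hb
      have := hle 0 (by simp [h0]) b hb
      simpa using this
    · obtain ⟨s, hs, hmax⟩ := S.exists_max_image (fun s => v (d s)) h0
      have hsB : s ∈ B := hS ▸ Subgroup.subset_closure hs
      have h2 := hle _ hmax _ (hconj s hsB)
      rw [hdc, map_mul] at h2
      have h3 : v (d s) = 0 := by
        by_contra h
        have h4 : 0 < v (d s) := zero_lt_iff.2 h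
        have := mul_lt_mul_of_pos_right hvτ h4
        rw [one_mul] at this
        exact absurd h2 (not_le.2 this)
      intro b hb
      have := hle _ hmax b hb
      rw [h3] at this
      simpa using this
  have hall : ∀ g, d g = 0 := by
    intro g
    have hg : g ∈ Subgroup.closure (insert τ (B : Set Γ)) := hgen ▸ Subgroup.mem_top g
    induction hg using Subgroup.closure_induction with
    | mem x hx =>
      rcases hx with rfl | hx
      · exact hdτ
      · exact hdB x hx
    | one => exact hd1
    | mul x y _ _ h1 h2 => rw [hdm, h1, h2]; ring
    | inv x _ h => rw [hdinv, h]; ring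
  intro g
  have := hall g
  simp only [hd] at this
  exact sub_eq_zero.1 this

theorem no_deriv {Γ L Γ₀ : Type*} [Group Γ] [Field L] [LinearOrderedCommGroupWithZero Γ₀]
    {I : Type*} [Finite I] (π : FreeGroup I →* Γ)
    (hπ : Function.Surjective π) (R : Set (FreeGroup I)) (hR : R.Finite) (hR1 : ∀ r ∈ R, π r = 1)
    (hker : ∀ w, π w = 1 → w ∈ Subgroup.normalClosure R) (χ : Γ →* Multiplicative ℤ) (τ : Γ)
    (hτ : χ τ = Multiplicative.ofAdd 1)
    (v : Valuation L Γ₀) (ρ : Γ →* Lˣ) (δ : Γ → L) (hδ : ∀ g h, δ (g * h) = δ g + ρ g * δ h)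
    (hv1 : ∀ g, χ g = 1 → v (ρ g) = 1) (hvτ : 1 < v (ρ τ))
    (σ : Γ ≃* Γ) (hσ : ∀ g, ρ (σ g) = (ρ g)⁻¹)
    (γ : Γ) (hγ : ρ γ ≠ 1) (hδγ : δ γ = 0) (γ' : Γ) (hγ' : δ γ' ≠ 0) : HasF2 Γ := by
  rcases bieri_strebel π hπ R hR hR1 hker χ τ hτ with h | ⟨B, hB, hχB, hgen, h⟩
  · exact h
  exfalso
  have hin : ∃ a, ∀ g, δ g = a * (ρ g - 1) := by
    rcases h with h | h
    · exact deriv_inner v ρ δ hδ τ B hB (fun b hb => hv1 b (hχB b hb)) hvτ hgen h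
    · obtain ⟨a, ha⟩ := deriv_inner v (ρ.comp σ.toMonoidHom) (fun g => δ (σ g)) (by
        intro g h; simp [hδ]) τ⁻¹ B hB (by
        intro b hb
        have : (ρ.comp σ.toMonoidHom) b = (ρ b)⁻¹ := hσ b
        rw [this, Units.val_inv_eq_inv_val, map_inv₀, hv1 b (hχB b hb), inv_one]) (by
        have : (ρ.comp σ.toMonoidHom) τ⁻¹ = ρ τ := by
          change ρ (σ τ⁻¹) = _
          rw [hσ, map_inv, inv_inv]
        rw [this]; exact hvτ) (by
        rw [eq_top_iff, ← hgen, Subgroup.closure_le]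
        rintro g (rfl | hg)
        · exact inv_mem_iff.1 (Subgroup.subset_closure (Set.mem_insert _ _))
        · exact Subgroup.subset_closure (Set.mem_insert_of_mem _ hg)) h
      refine ⟨a, fun g => ?_⟩
      have := ha (σ.symm g)
      simpa using this
  obtain ⟨a, ha⟩ := hin
  have h1 := ha γ
  rw [hδγ] at h1
  have h2 : (ρ γ : L) - 1 ≠ 0 := fun h => hγ (Units.ext (sub_eq_zero.1 h))
  have h3 : a = 0 := (mul_eq_zero.1 h1.symm).resolve_right h2
  apply hγ'
  rw [ha, h3, zero_mul]

abbrev K5 := ZMod 5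
instance : Fact (Nat.Prime 5) := ⟨by norm_num⟩
abbrev L5 := AlgebraicClosure (RatFunc K5)
noncomputable def X5 : L5 := algebraMap (RatFunc K5) L5 RatFunc.X

theorem X5_trans : Transcendental K5 X5 := by
  unfold X5
  rw [transcendental_algebraMap_iff (algebraMap (RatFunc K5) L5).injective]
  exact RatFunc.transcendental_X

theorem val_sum {R Γ₀ ι : Type*} [Ring R] [LinearOrderedCommGroupWithZero Γ₀] (v : Valuation R Γ₀)
    (s : Finset ι) (hs : s.Nonempty) (f : ι → R) (h0 : ∀ i ∈ s, v (f i) ≠ 0)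
    (hinj : Set.InjOn (fun i => v (f i)) s) : ∃ i ∈ s, v (∑ j ∈ s, f j) = v (f i) := by
  classical
  obtain ⟨i, hi, hmax⟩ := s.exists_max_image (fun i => v (f i)) hs
  refine ⟨i, hi, ?_⟩
  rw [← Finset.add_sum_erase s f hi]
  apply Valuation.map_add_eq_of_lt_left
  apply v.map_sum_lt (h0 i hi)
  intro j hj
  rw [Finset.mem_erase] at hj
  exact lt_of_le_of_ne (hmax j hj.2) (fun h => hj.1 (hinj hj.2 hi h))

theorem val_exists : ∃ V : ValuationSubring L5, 1 < V.valuation X5 := by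
  have h : X5 ∉ (integralClosure K5 L5).toSubring := by
    intro h
    exact X5_trans (IsIntegral.isAlgebraic h)
  obtain ⟨V, -, hV⟩ := Subring.exists_le_valuationSubring_of_isIntegrallyClosedIn h
  refine ⟨V, ?_⟩
  rw [← V.valuation_le_one_iff] at hV
  exact not_le.1 hV

section
variable {Γ₀ : Type*} [LinearOrderedCommGroupWithZero Γ₀]

theorem val_const (v : Valuation L5 Γ₀) (c : K5) (hc : c ≠ 0) : v (algebraMap K5 L5 c) = 1 := by
  have h : c ^ 4 = 1 := ZMod.pow_card_sub_one_eq_one hc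
  have : v (algebraMap K5 L5 c) ^ 4 = 1 := by
    rw [← map_pow, ← map_pow, h, map_one, map_one]
  exact (pow_eq_one_iff_of_nonneg zero_le (by norm_num)).1 this

theorem val_poly (v : Valuation L5 Γ₀) (hX : 1 < v X5) (p : K5[X]) (hp : p ≠ 0) :
    ∃ n : ℕ, v (aeval X5 p) = v X5 ^ n := by
  have hv (i) (hi : i ∈ p.support) : v (algebraMap K5 L5 (p.coeff i) * X5 ^ i) = v X5 ^ i := by
    rw [map_mul, val_const v _ (mem_support_iff.1 hi), one_mul, map_pow]
  have hX0 : v X5 ≠ 0 := (zero_lt_one.trans hX).ne'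
  obtain ⟨i, hi, h⟩ := val_sum v p.support (support_nonempty.2 hp)
    (fun i => algebraMap K5 L5 (p.coeff i) * X5 ^ i)
    (fun i hi => by rw [hv i hi]; exact pow_ne_zero _ hX0)
    (fun i hi j hj hij => by
      simp only [] at hij
      rw [hv i hi, hv j hj] at hij
      exact (pow_right_injective₀ (zero_lt_one.trans hX) hX.ne') hij)
  refine ⟨i, ?_⟩
  rw [aeval_eq_sum_range, ← hv i hi, ← h]
  rw [← p.sum_over_range (f := fun i c => c • X5 ^ i) (by simp), Polynomial.sum]
  simp only [Algebra.smul_def]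

theorem val_alg (v : Valuation L5 Γ₀) (hX : 1 < v X5) (z : L5) (hz : z ≠ 0) :
    ∃ (n : ℕ) (d : ℤ), n ≠ 0 ∧ v z ^ n = v X5 ^ d := by
  have hX0 : v X5 ≠ 0 := (zero_lt_one.trans hX).ne'
  have hz0 : v z ≠ 0 := (v.ne_zero_iff).2 hz
  have h1 : IsAlgebraic (RatFunc K5) z := (AlgebraicClosure.isAlgebraic _).isAlgebraic z
  have h2 : IsAlgebraic K5[X] z := (IsFractionRing.isAlgebraic_iff K5[X] (RatFunc K5) L5).2 h1
  obtain ⟨p, hp, hpz⟩ := h2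
  have hal (q : K5[X]) : algebraMap K5[X] L5 q = aeval X5 q := by
    rw [IsScalarTower.algebraMap_apply K5[X] (RatFunc K5) L5]
    have : (IsScalarTower.toAlgHom K5 (RatFunc K5) L5).comp (IsScalarTower.toAlgHom K5 K5[X] (RatFunc K5))
        = aeval X5 := by
      apply Polynomial.algHom_ext
      simp [X5]
    exact DFunLike.congr_fun this q
  have hv (i) (hi : i ∈ p.support) : ∃ m : ℕ, v (algebraMap K5[X] L5 (p.coeff i) * z ^ i) =
      v X5 ^ m * v z ^ i := by
    obtain ⟨m, hm⟩ := val_poly v hX _ (mem_support_iff.1 hi)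
    exact ⟨m, by rw [map_mul, hal, hm, map_pow]⟩
  by_contra! hcon
  have main (i j : ℕ) (hi : i ∈ p.support) (hj : j ∈ p.support) (hlt : i < j)
      (hij : v (algebraMap K5[X] L5 (p.coeff i) * z ^ i) =
        v (algebraMap K5[X] L5 (p.coeff j) * z ^ j)) : False := by
    obtain ⟨m, hm⟩ := hv i hi
    obtain ⟨l, hl⟩ := hv j hj
    rw [hm, hl] at hij
    refine hcon (j - i) ((m : ℤ) - l) (by omega) ?_
    rw [zpow_sub₀ hX0, zpow_natCast, zpow_natCast, eq_div_iff (pow_ne_zero _ hX0)]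
    have h3 : v z ^ i ≠ 0 := pow_ne_zero _ hz0
    apply mul_right_cancel₀ h3
    rw [hij, mul_right_comm, ← pow_add, Nat.sub_add_cancel hlt.le, mul_comm]
  obtain ⟨i, hi, h⟩ := val_sum v p.support (support_nonempty.2 hp)
    (fun i => algebraMap K5[X] L5 (p.coeff i) * z ^ i)
    (fun i hi => by
      obtain ⟨m, hm⟩ := hv i hi
      rw [hm]; exact mul_ne_zero (pow_ne_zero _ hX0) (pow_ne_zero _ hz0))
    (fun i hi j hj hij => by
      rcases lt_trichotomy i j with h | h | h
      · exact (main i j hi hj h hij).elim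
      · exact h
      · exact (main j i hj hi h hij.symm).elim)
  have h4 : ∑ j ∈ p.support, algebraMap K5[X] L5 (p.coeff j) * z ^ j = 0 := by
    rw [← hpz, aeval_eq_sum_range, ← p.sum_over_range (f := fun i c => c • z ^ i) (by simp),
      Polynomial.sum]
    simp only [Algebra.smul_def]
  rw [h4, map_zero] at h
  obtain ⟨m, hm⟩ := hv i hi
  rw [hm] at h
  exact mul_ne_zero (pow_ne_zero _ hX0) (pow_ne_zero _ hz0) h.symm

theorem pow_inj₀' {a b : Γ₀} {n : ℕ} (hn : n ≠ 0) (h : a ^ n = b ^ n) : a = b :=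
  (pow_left_inj₀ zero_le zero_le hn).1 h

theorem val_coprime (v : Valuation L5 Γ₀) (hX : 1 < v X5) (z : L5) (hz : z ≠ 0) :
    ∃ (n : ℕ) (d : ℤ), n ≠ 0 ∧ IsCoprime (n : ℤ) d ∧ v z ^ n = v X5 ^ d := by
  obtain ⟨n, d, hn, h⟩ := val_alg v hX z hz
  have hg : (n.gcd d.natAbs) ≠ 0 := fun h => hn (Nat.gcd_eq_zero_iff.1 h).1
  set g := n.gcd d.natAbs with hgd
  obtain ⟨n', hn'⟩ : g ∣ n := Nat.gcd_dvd_left _ _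
  obtain ⟨d', hd'⟩ : (g : ℤ) ∣ d := Int.natCast_dvd.2 (Nat.gcd_dvd_right _ _)
  refine ⟨n', d', fun h => hn (by rw [hn', h, mul_zero]), ?_, ?_⟩
  · rw [Int.isCoprime_iff_gcd_eq_one]
    have : g * (Int.gcd n' d') = g * 1 := by
      have e : g = Int.gcd (n : ℤ) d := rfl
      conv_rhs => rw [mul_one, e, hn', hd']
      push_cast
      rw [Int.gcd_mul_left]; simp
    exact Nat.eq_of_mul_eq_mul_left (Nat.pos_of_ne_zero hg) this
  · apply pow_inj₀' hg
    rw [← pow_mul, mul_comm n', ← hn', h, hd', mul_comm, _root_.zpow_mul, zpow_natCast]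

/-- the final use of the valuation -/
theorem final_val {Γ : Type*} [Group Γ]
    {I : Type} [Finite I] (π : FreeGroup I →* Γ) (hπ : Function.Surjective π)
    (R : Set (FreeGroup I)) (hR : R.Finite) (hR1 : ∀ r ∈ R, π r = 1)
    (hker : ∀ w, π w = 1 → w ∈ Subgroup.normalClosure R)
    (t u : Γ →* Multiplicative ℤ)
    (hsurj : ∀ m n : ℤ, ∃ γ, t γ = Multiplicative.ofAdd m ∧ u γ = Multiplicative.ofAdd n)
    (σ : Γ ≃* Γ) (hσt : ∀ g, t (σ g) = (t g)⁻¹) (hσu : ∀ g, u (σ g) = (u g)⁻¹)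
    (t₀ : L5) (ht₀ : t₀ ≠ 0) (δ : Γ → L5)
    (hδ : ∀ g h, δ (g * h) = δ g + t₀ ^ (t g).toAdd * X5 ^ (u g).toAdd * δ h)
    (γ' : Γ) (hγ' : δ γ' ≠ 0) (γ : Γ) (hδγ : δ γ = 0)
    (hγ : t₀ ^ (t γ).toAdd * X5 ^ (u γ).toAdd ≠ 1) : HasF2 Γ := by
  obtain ⟨V, hX⟩ := val_exists
  set v := V.valuation
  have hX0 : X5 ≠ 0 := fun h => by
    rw [h, map_zero] at hX; exact absurd hX (not_lt.2 zero_le)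
  have hvX0 : v X5 ≠ 0 := (zero_lt_one.trans hX).ne'
  obtain ⟨n, d, hn, hnd, hz⟩ := val_coprime v hX t₀ ht₀
  let ρ : Γ →* L5ˣ := ((zpowersHom L5ˣ (Units.mk0 t₀ ht₀)).comp t) *
    ((zpowersHom L5ˣ (Units.mk0 X5 hX0)).comp u)
  have hρ (g : Γ) : ((ρ g : L5ˣ) : L5) = t₀ ^ (t g).toAdd * X5 ^ (u g).toAdd := by
    simp [ρ, zpowersHom_apply]
  let χ : Γ →* Multiplicative ℤ := (t ^ d) * (u ^ (n : ℤ))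
  have hχ (g : Γ) : (χ g).toAdd = d * (t g).toAdd + n * (u g).toAdd := by
    simp [χ]
  have hvρ (g : Γ) : v (ρ g) ^ n = v X5 ^ (χ g).toAdd := by
    rw [hρ, map_mul, map_zpow₀, map_zpow₀, mul_pow, ← zpow_natCast, ← zpow_natCast, ← _root_.zpow_mul,
      mul_comm _ (n : ℤ), _root_.zpow_mul, zpow_natCast, hz, hχ, zpow_add₀ hvX0, mul_comm (n : ℤ),
      _root_.zpow_mul, _root_.zpow_mul]
  obtain ⟨p, q, hpq⟩ := hnd
  obtain ⟨τ, hτ1, hτ2⟩ := hsurj q p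
  have hχτ : χ τ = Multiplicative.ofAdd 1 := by
    apply Multiplicative.toAdd.injective
    rw [hχ, hτ1, hτ2]
    simp only [toAdd_ofAdd]
    linarith
  refine no_deriv π hπ R hR hR1 hker χ τ hχτ v ρ δ (fun g h => by rw [hδ, hρ]) ?_ ?_ σ ?_ γ ?_ hδγ γ' hγ'
  · intro g hg
    apply pow_inj₀' hn
    rw [hvρ, hg, toAdd_one, zpow_zero, one_pow]
  · by_contra! hle
    have := pow_le_one₀ (n := n) zero_le hle
    rw [hvρ, hχτ, toAdd_ofAdd, zpow_one] at this
    exact absurd hX (not_lt.2 this)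
  · intro g
    simp [ρ, hσt, hσu, mul_comm]
  · intro h
    apply hγ
    rw [← hρ, h, Units.val_one]
end

abbrev LK := LaurentPolynomial K5
abbrev LLK := LaurentPolynomial LK

noncomputable def evL {S : Type*} [CommRing S] [Algebra K5 S] (T U : Sˣ) : LLK →+* S :=
  LaurentPolynomial.eval₂ (LaurentPolynomial.eval₂ (algebraMap K5 S) U) T

noncomputable def lT (A : Type*) [CommRing A] : (LaurentPolynomial A)ˣ :=
  ⟨LaurentPolynomial.T 1, LaurentPolynomial.T (-1), by rw [← LaurentPolynomial.T_add]; simp,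
    by rw [← LaurentPolynomial.T_add]; simp⟩

theorem lT_val (A : Type*) [CommRing A] : ((lT A : (LaurentPolynomial A)ˣ) : LaurentPolynomial A) =
  LaurentPolynomial.T 1 := rfl

noncomputable def TT : LLKˣ := lT LK
noncomputable def UU : LLKˣ := Units.map (LaurentPolynomial.C : LK →+* LLK).toMonoidHom (lT K5)

theorem evL_T {S : Type*} [CommRing S] [Algebra K5 S] (T U : Sˣ) :
    Units.map (evL T U).toMonoidHom TT = T := by
  ext; simp [evL, TT, lT_val]

theorem evL_U {S : Type*} [CommRing S] [Algebra K5 S] (T U : Sˣ) :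
    Units.map (evL T U).toMonoidHom UU = U := by
  ext; simp [evL, UU, lT_val]

theorem X5_ne : X5 ≠ 0 := by
  unfold X5
  rw [_root_.map_ne_zero]; exact RatFunc.X_ne_zero

noncomputable def X5u : L5ˣ := Units.mk0 X5 X5_ne

noncomputable def iotaX : LK →+* L5 := LaurentPolynomial.eval₂ (algebraMap K5 L5) X5u

theorem iotaX_inj : Function.Injective iotaX := by
  rw [injective_iff_map_eq_zero]
  intro p hp
  obtain ⟨n, q, hq⟩ := LaurentPolynomial.exists_T_pow p
  have h1 : iotaX (toLaurent q) = 0 := by rw [hq, map_mul, hp, zero_mul]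
  have h2 : aeval X5 q = 0 := by
    rw [iotaX, LaurentPolynomial.eval₂_toLaurent] at h1
    exact h1
  have h3 : q = 0 := by
    by_contra h
    exact X5_trans ⟨q, h, h2⟩
  rw [h3, map_zero] at hq
  exact ((LaurentPolynomial.isUnit_T n).mul_left_eq_zero).1 hq.symm

noncomputable def mapL {A B : Type*} [CommRing A] [CommRing B] (f : A →+* B) :
    LaurentPolynomial A →+* LaurentPolynomial B :=
  LaurentPolynomial.eval₂ (LaurentPolynomial.C.comp f) (lT B)

theorem lT_zpow {A : Type*} [CommRing A] (n : ℤ) :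
    ((lT A ^ n : (LaurentPolynomial A)ˣ) : LaurentPolynomial A) = LaurentPolynomial.T n := by
  have (n : ℕ) : ((lT A ^ n : (LaurentPolynomial A)ˣ) : LaurentPolynomial A) =
      LaurentPolynomial.T n := by
    rw [Units.val_pow_eq_pow_val, lT_val, LaurentPolynomial.T_pow, mul_one]
  obtain ⟨m, rfl | rfl⟩ := n.eq_nat_or_neg
  · rw [zpow_natCast, this]
  · rw [_root_.zpow_neg, zpow_natCast, ← one_mul (((lT A ^ m)⁻¹ : (LaurentPolynomial A)ˣ) : LaurentPolynomial A)]
    rw [Units.mul_inv_eq_iff_eq_mul, this, ← LaurentPolynomial.T_add]; simp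

theorem mapL_coeff {A B : Type*} [CommRing A] [CommRing B] (f : A →+* B) (p : LaurentPolynomial A)
    (k : ℤ) : (mapL f p).coeff k = f (p.coeff k) := by
  induction p using LaurentPolynomial.induction_on' with
  | add p q hp hq => rw [map_add]; simp [hp, hq]
  | C_mul_T n a =>
    rw [mapL, LaurentPolynomial.eval₂_C_mul_T, lT_zpow, RingHom.comp_apply,
      ← LaurentPolynomial.single_eq_C_mul_T, ← LaurentPolynomial.single_eq_C_mul_T]
    simp only [AddMonoidAlgebra.coeff_single, Finsupp.single_apply]
    split_ifs <;> simp

theorem mapL_inj {A B : Type*} [CommRing A] [CommRing B] (f : A →+* B) (hf : Function.Injective f) :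
    Function.Injective (mapL f) := by
  intro p q h
  apply LaurentPolynomial.ext
  intro k
  apply hf
  rw [← mapL_coeff, ← mapL_coeff, h]

theorem laurent_mono (f : LaurentPolynomial L5)
    (h : ∀ t : L5ˣ, LaurentPolynomial.eval₂ (RingHom.id L5) t f ≠ 0) :
    ∃ (c : L5) (n : ℤ), c ≠ 0 ∧ f = LaurentPolynomial.C c * LaurentPolynomial.T n := by
  obtain ⟨n, q, hq⟩ := LaurentPolynomial.exists_T_pow f
  have h1 (t : L5) (ht : t ≠ 0) : q.eval t ≠ 0 := by
    have := congrArg (LaurentPolynomial.eval₂ (RingHom.id L5) (Units.mk0 t ht)) hq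
    rw [LaurentPolynomial.eval₂_toLaurent, map_mul, LaurentPolynomial.eval₂_T] at this
    change q.eval t = _ at this
    rw [this]
    exact mul_ne_zero (h _) (Units.ne_zero _)
  have hq0 : q ≠ 0 := by
    rintro rfl
    exact h1 1 one_ne_zero (by simp)
  have h2 := (IsAlgClosed.splits q).eq_prod_roots
  have h3 : q.roots = Multiset.replicate (Multiset.card q.roots) 0 := by
    rw [Multiset.eq_replicate]
    refine ⟨rfl, fun b hb => ?_⟩
    by_contra hb0
    exact h1 b hb0 (isRoot_of_mem_roots hb)
  generalize Multiset.card q.roots = m at h3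
  rw [h3] at h2
  simp only [Multiset.map_replicate, map_zero, sub_zero, Multiset.prod_replicate] at h2
  refine ⟨q.leadingCoeff, (m : ℤ) - n, leadingCoeff_ne_zero.2 hq0, ?_⟩
  have h4 : f = toLaurent q * LaurentPolynomial.T (-n) := by
    rw [hq, LaurentPolynomial.mul_T_assoc]; simp
  generalize q.leadingCoeff = c at *
  rw [h4, h2, map_mul, toLaurent_C, toLaurent_X_pow, mul_assoc, ← LaurentPolynomial.T_add]
  simp [sub_eq_add_neg]

noncomputable def epsu : (DualNumber K5)ˣ :=
  ⟨1 + DualNumber.eps, 1 - DualNumber.eps, by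
    have := DualNumber.eps_mul_eps (R := K5)
    linear_combination -this, by
    have := DualNumber.eps_mul_eps (R := K5)
    linear_combination -this⟩

theorem evL_alg {S : Type} [CommRing S] [Algebra K5 S] (p : LK) :
    LaurentPolynomial.eval₂ (algebraMap K5 S) 1 p =
      algebraMap K5 S (LaurentPolynomial.eval₂ (RingHom.id K5) 1 p) := by
  induction p using LaurentPolynomial.induction_on' with
  | add p q hp hq => rw [map_add, map_add, map_add, hp, hq]
  | C_mul_T n a =>
    rw [LaurentPolynomial.eval₂_C_mul_T, LaurentPolynomial.eval₂_C_mul_T]; simp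

theorem alg_core (Dt Du : LLK) (hrel : ((UU : LLK) - 1) * Dt = ((TT : LLK) - 1) * Du)
    (hdual : evL epsu 1 Dt = 0) :
    evL X5u 1 Dt = 0 ∨ ∃ t₀ : L5ˣ, evL t₀ X5u Du = 0 := by
  by_contra! hcon
  obtain ⟨hA, hB⟩ := hcon
  have hev (t : L5ˣ) (p : LLK) : LaurentPolynomial.eval₂ (RingHom.id L5) t (mapL iotaX p) =
      evL t X5u p := by
    induction p using LaurentPolynomial.induction_on' with
    | add p q hp hq => rw [map_add, map_add, hp, hq, map_add]
    | C_mul_T n a =>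
      rw [mapL, LaurentPolynomial.eval₂_C_mul_T, lT_zpow, RingHom.comp_apply,
        LaurentPolynomial.eval₂_C_mul_T, evL, LaurentPolynomial.eval₂_C_mul_T]
      rfl
  obtain ⟨c, n, hc, hDu⟩ := laurent_mono (mapL iotaX Du) (fun t => by rw [hev]; exact hB t)
  have hX1 : X5 - 1 ≠ 0 := by
    intro h
    apply X5_trans
    rw [sub_eq_zero.1 h]
    exact isAlgebraic_one
  have h1 : mapL iotaX Dt = LaurentPolynomial.C (c / (X5 - 1)) *
      (LaurentPolynomial.T (n + 1) - LaurentPolynomial.T n) := by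
    have h2 := congrArg (mapL iotaX) hrel
    have hT : mapL iotaX (TT : LLK) = LaurentPolynomial.T 1 := by
      simp [mapL, TT, lT_val]
    have hU : mapL iotaX (UU : LLK) = LaurentPolynomial.C X5 := by
      simp [mapL, UU, lT_val, iotaX, X5u]
    rw [map_mul, map_mul, map_sub, map_sub, map_one, hT, hU, hDu] at h2
    have h3 : (LaurentPolynomial.C (X5 - 1)⁻¹ : LaurentPolynomial L5) * (LaurentPolynomial.C X5 - 1) = 1 := by
      rw [← map_one LaurentPolynomial.C, ← map_sub, ← map_mul, inv_mul_cancel₀ hX1]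
    rw [LaurentPolynomial.T_add, div_eq_mul_inv, map_mul]
    linear_combination LaurentPolynomial.C (X5 - 1)⁻¹ * h2 - mapL iotaX Dt * h3
  obtain ⟨p, hp⟩ : ∃ p : LK, Dt = LaurentPolynomial.C p *
      (LaurentPolynomial.T (n + 1) - LaurentPolynomial.T n) := by
    refine ⟨Dt.coeff (n + 1), mapL_inj iotaX iotaX_inj ?_⟩
    have h2 : iotaX (Dt.coeff (n + 1)) = c / (X5 - 1) := by
      rw [← mapL_coeff, h1, mul_sub, ← LaurentPolynomial.single_eq_C_mul_T,
        ← LaurentPolynomial.single_eq_C_mul_T]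
      rw [AddMonoidAlgebra.coeff_sub, AddMonoidAlgebra.coeff_single, AddMonoidAlgebra.coeff_single,
        Finsupp.sub_apply]
      simp
    rw [h1, map_mul, map_sub, ← h2]
    simp [mapL, lT_zpow]
  have hp1 {S : Type} [CommRing S] [Algebra K5 S] (T : Sˣ) : evL T 1 Dt =
      algebraMap K5 S (LaurentPolynomial.eval₂ (RingHom.id K5) 1 p) * ((T : S) - 1) * (T ^ n : Sˣ) := by
    have := evL_alg (S := S) p
    rw [hp, evL, map_mul, LaurentPolynomial.eval₂_C, this, map_sub, LaurentPolynomial.eval₂_T,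
      LaurentPolynomial.eval₂_T, _root_.zpow_add, zpow_one, Units.val_mul]
    ring
  rw [hp1] at hdual
  rw [hp1] at hA
  set e := LaurentPolynomial.eval₂ (RingHom.id K5) 1 p
  have he : e ≠ 0 := by
    rintro h
    rw [h] at hA; simp at hA
  rw [Units.mul_left_eq_zero] at hdual
  have := congrArg TrivSqZeroExt.snd hdual
  simp [epsu] at this
  exact he this

section Fox
variable {I S : Type*} [CommRing S]

/-- crossed homomorphisms -/
def IsCr {F : Type*} [Group F] (ρ : F →* Sˣ) (δ : F → S) : Prop :=
  ∀ g h, δ (g * h) = δ g + ρ g * δ h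

theorem IsCr.one {F : Type*} [Group F] {ρ : F →* Sˣ} {δ : F → S} (h : IsCr ρ δ) : δ 1 = 0 := by
  have := h 1 1
  rw [mul_one, map_one, Units.val_one, one_mul] at this
  linear_combination -this

theorem IsCr.inv {F : Type*} [Group F] {ρ : F →* Sˣ} {δ : F → S} (h : IsCr ρ δ) (g : F) :
    δ g⁻¹ = - (((ρ g)⁻¹ : Sˣ) : S) * δ g := by
  have h1 := h g⁻¹ g
  rw [inv_mul_cancel, h.one, map_inv] at h1
  linear_combination -h1

theorem IsCr.ext {ρ : FreeGroup I →* Sˣ} {δ δ' : FreeGroup I → S} (h : IsCr ρ δ) (h' : IsCr ρ δ')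
    (e : ∀ i, δ (FreeGroup.of i) = δ' (FreeGroup.of i)) (g : FreeGroup I) : δ g = δ' g := by
  induction g using FreeGroup.induction_on with
  | C1 => rw [h.one, h'.one]
  | of i => exact e i
  | inv_of i _ => rw [h.inv, h'.inv, e i]
  | mul a b ha hb => rw [h, h', ha, hb]

theorem cr_exists (ρ : FreeGroup I →* Sˣ) (v : I → S) : ∃ δ : FreeGroup I → S, IsCr ρ δ ∧
    ∀ i, δ (FreeGroup.of i) = v i := by
  let A : FreeGroup I →* Equiv.Perm S := FreeGroup.lift fun i =>
    ⟨fun x => ρ (FreeGroup.of i) * x + v i, fun x => ((ρ (FreeGroup.of i))⁻¹ : Sˣ) * (x - v i),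
      fun x => by simp, fun x => by simp⟩
  have hA (g : FreeGroup I) : ∀ x, A g x = ρ g * x + A g 0 := by
    induction g using FreeGroup.induction_on with
    | C1 => simp
    | of i => intro x; simp [A]
    | inv_of i h =>
      intro x
      rw [map_inv, map_inv, Equiv.Perm.inv_eq_iff_eq, h,
        mul_add, Units.mul_inv_cancel_left, add_assoc, ← h]
      simp
    | mul a b ha hb =>
      intro x
      rw [map_mul, map_mul, Equiv.Perm.mul_apply, Equiv.Perm.mul_apply, ha, hb x, ha (A b 0)]
      push_cast; ring
  refine ⟨fun g => A g 0, fun g h => ?_, fun i => by simp [A]⟩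
  change A (g * h) 0 = _
  rw [map_mul, Equiv.Perm.mul_apply, hA, add_comm]

variable [DecidableEq I]
noncomputable def fox (ρ : FreeGroup I →* Sˣ) (g : FreeGroup I) (j : I) : S :=
  (cr_exists ρ (Pi.single j 1)).choose g

theorem fox_cr (ρ : FreeGroup I →* Sˣ) (j : I) : IsCr ρ (fun g => fox ρ g j) :=
  (cr_exists ρ (Pi.single j 1)).choose_spec.1

theorem fox_of (ρ : FreeGroup I →* Sˣ) (i j : I) : fox ρ (FreeGroup.of i) j =
    (Pi.single j 1 : I → S) i := (cr_exists ρ (Pi.single j 1)).choose_spec.2 i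

theorem fox_sum_cr [Fintype I] (ρ : FreeGroup I →* Sˣ) (v : I → S) :
    IsCr ρ (fun g => ∑ j, fox ρ g j * v j) := by
  intro g h
  simp only [fox_cr ρ _ g h, add_mul, Finset.sum_add_distrib, Finset.mul_sum, mul_assoc]

theorem fox_sum_of [Fintype I] (ρ : FreeGroup I →* Sˣ) (v : I → S) (i : I) :
    ∑ j, fox ρ (FreeGroup.of i) j * v j = v i := by
  simp [fox_of, Pi.single_apply]

theorem IsCr.fox [Fintype I] {ρ : FreeGroup I →* Sˣ} {δ : FreeGroup I → S} (h : IsCr ρ δ)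
    (g : FreeGroup I) : ∑ j, fox ρ g j * δ (FreeGroup.of j) = δ g :=
  (fox_sum_cr ρ _).ext h (fun i => fox_sum_of ρ _ i) g

theorem fox_map {S' : Type*} [CommRing S'] (f : S →+* S') (ρ : FreeGroup I →* Sˣ)
    (g : FreeGroup I) (j : I) :
    fox ((Units.map f.toMonoidHom).comp ρ) g j = f (fox ρ g j) := by
  have h : IsCr ((Units.map f.toMonoidHom).comp ρ) (fun g => f (fox ρ g j)) := by
    intro g h
    have := fox_cr ρ j g h
    simp only [] at this
    simp [this]
  refine (fox_cr _ j).ext h (fun i => ?_) g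
  rw [fox_of, fox_of]
  simp only [Pi.single_apply]
  split_ifs <;> simp

variable {n : ℕ}
abbrev Fr (n : ℕ) := FreeGroup (Fin (n + 1))

noncomputable def Jm (r : Fin n → Fr n) (γ : Fr n) (ρ : Fr n →* Sˣ) :
    Matrix (Fin (n + 1)) (Fin (n + 1)) S :=
  Matrix.of fun i j => fox ρ ((Fin.cons γ r : Fin (n + 1) → Fr n) i) j

theorem Jm_map {S' : Type*} [CommRing S'] (f : S →+* S') (r : Fin n → Fr n) (γ : Fr n)
    (ρ : Fr n →* Sˣ) : (Jm r γ ((Units.map f.toMonoidHom).comp ρ)).det = f (Jm r γ ρ).det := by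
  rw [RingHom.map_det]
  congr 1
  ext i j
  simp only [Jm, Matrix.of_apply, RingHom.mapMatrix_apply, Matrix.map_apply]
  exact fox_map f ρ _ j

theorem Jm_mulVec (r : Fin n → Fr n) (γ : Fr n) (ρ : Fr n →* Sˣ) (δ : Fr n → S) (h : IsCr ρ δ)
    (hr : ∀ i, δ (r i) = 0) : (Jm r γ ρ) *ᵥ (fun j => δ (FreeGroup.of j)) = Pi.single 0 (δ γ) := by
  ext i
  simp only [mulVec, dotProduct, Jm, Matrix.of_apply]
  rw [h.fox]
  refine Fin.cases ?_ (fun i => ?_) i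
  · simp
  · simp [hr]

theorem Jm_rel (r : Fin n → Fr n) (γ γ' : Fr n) (ρ : Fr n →* Sˣ) (hr : ∀ i, ρ (r i) = 1) :
    ((ρ γ' : S) - 1) * (Jm r γ ρ).det = ((ρ γ : S) - 1) * (Jm r γ' ρ).det := by
  let δ : Fr n → S := fun g => ρ g - 1
  have hδ : IsCr ρ δ := by intro g h; simp [δ]; ring
  have hδr : ∀ i, δ (r i) = 0 := by intro i; simp [δ, hr]
  have h1 := Jm_mulVec r γ ρ δ hδ hδr
  have h2 := congrArg (fun w => (Jm r γ ρ).adjugate *ᵥ w) h1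
  simp only [mulVec_mulVec, adjugate_mul] at h2
  have h3 (j) : (Jm r γ ρ).det * δ (FreeGroup.of j) = (Jm r γ ρ).adjugate j 0 * δ γ := by
    have := congrFun h2 j
    simpa [smul_mulVec, mulVec_single] using this
  have h4 (j) : (Jm r γ' ρ).adjugate j 0 = (Jm r γ ρ).adjugate j 0 := by
    rw [adjugate_apply, adjugate_apply]
    congr 1
    ext i k
    rw [updateRow_apply, updateRow_apply]
    split_ifs with h
    · rfl
    · obtain ⟨i', rfl⟩ := Fin.exists_succ_eq.2 h
      simp [Jm]
  have h5 : (Jm r γ' ρ).det = ∑ j, fox ρ γ' j * (Jm r γ ρ).adjugate j 0 := by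
    have := congrFun (congrFun (mul_adjugate (Jm r γ' ρ)) 0) 0
    simp only [Matrix.mul_apply, h4] at this
    simpa [Jm] using this.symm
  change δ γ' * _ = δ γ * _
  rw [h5, ← hδ.fox γ', Finset.sum_mul, Finset.mul_sum]
  refine Finset.sum_congr rfl fun j _ => ?_
  linear_combination fox ρ γ' j * h3 j

end Fox

theorem corank2 {k : Type*} [Field k] {m : Type*} [Fintype m] [DecidableEq m] (J : Matrix m m k)
    (a b : m → k) (ha : J *ᵥ a = 0) (hb : J *ᵥ b = 0)
    (hab : ∀ p q : k, p • a + q • b = 0 → p = 0 ∧ q = 0) : J.adjugate = 0 := by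
  ext i j
  rw [adjugate_apply, Matrix.zero_apply, ← exists_mulVec_eq_zero_iff]
  obtain ⟨p, q, hpq, h⟩ : ∃ p q : k, (p ≠ 0 ∨ q ≠ 0) ∧ p * a i + q * b i = 0 := by
    by_cases h : a i = 0
    · exact ⟨1, 0, by simp, by simp [h]⟩
    · exact ⟨b i, - a i, by simp [h], by ring⟩
  refine ⟨p • a + q • b, fun h0 => ?_, ?_⟩
  · have := hab p q h0; tauto
  · have hJ : J *ᵥ (p • a + q • b) = 0 := by
      rw [mulVec_add, mulVec_smul, mulVec_smul, ha, hb]; simp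
    ext l
    by_cases hl : l = j
    · subst hl
      simp [mulVec, updateRow_self, h]
    · have := congrFun hJ l
      simpa [mulVec, updateRow_ne hl] using this

open TrivSqZeroExt in
theorem dual_det {m : Type*} [Fintype m] [DecidableEq m] [Nonempty m] (J : Matrix m m (DualNumber K5))
    (a b : m → K5) (ha : (J.map TrivSqZeroExt.fst) *ᵥ a = 0) (hb : (J.map TrivSqZeroExt.fst) *ᵥ b = 0)
    (hab : ∀ p q : K5, p • a + q • b = 0 → p = 0 ∧ q = 0) : J.det = 0 := by
  have h0 := corank2 _ a b ha hb hab
  obtain ⟨i, hi⟩ : ∃ i, a i ≠ 0 := by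
    by_contra! h
    have := (hab 1 0 (by ext i; simp [h])).1
    exact one_ne_zero this
  have h1 : ∀ i j, (J.adjugate i j).fst = 0 := by
    intro i j
    have h2 : (fstHom K5 K5 K5).toRingHom.mapMatrix J.adjugate =
      ((fstHom K5 K5 K5).toRingHom.mapMatrix J).adjugate := RingHom.map_adjugate _ _
    have h3 := congrFun (congrFun h2 i) j
    have h4 : (fstHom K5 K5 K5).toRingHom.mapMatrix J = J.map TrivSqZeroExt.fst := rfl
    rw [h4, h0] at h3
    exact h3
  let A : m → DualNumber K5 := fun i => inl (a i)
  have h2 : ∀ i, ((J *ᵥ A) i).fst = 0 := by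
    intro i
    have := congrFun ha i
    simp only [mulVec, dotProduct, Matrix.map_apply, Pi.zero_apply] at this ⊢
    rw [← this, TrivSqZeroExt.fst_sum]
    simp [A]
  have h3 : J.det * A i = 0 := by
    have h5 : J.adjugate *ᵥ (J *ᵥ A) = J.det • A := by
      rw [mulVec_mulVec, adjugate_mul, smul_mulVec, one_mulVec]
    have h6 := congrFun h5 i
    rw [Pi.smul_apply, smul_eq_mul] at h6
    rw [← h6]
    simp only [mulVec, dotProduct]
    apply Finset.sum_eq_zero
    intro j _
    have h7 := h2 j
    simp only [mulVec, dotProduct] at h7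
    ext
    · simp [h1]
    · rw [DualNumber.snd_mul, h1, h7]; simp
  have h4 : A i * inl (a i)⁻¹ = 1 := by
    simp only [A]
    rw [← inl_mul, mul_inv_cancel₀ hi, inl_one]
  calc J.det = J.det * (A i * inl (a i)⁻¹) := by rw [h4, mul_one]
    _ = 0 := by rw [← mul_assoc, h3, zero_mul]

noncomputable def rhoTU {F S : Type*} [Group F] [CommRing S] (t u : F →* Multiplicative ℤ) (T U : Sˣ) :
    F →* Sˣ := ((zpowersHom Sˣ T).comp t) * ((zpowersHom Sˣ U).comp u)

theorem rhoTU_apply {F S : Type*} [Group F] [CommRing S] (t u : F →* Multiplicative ℤ) (T U : Sˣ)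
    (g : F) : rhoTU t u T U g = T ^ (t g).toAdd * U ^ (u g).toAdd := by
  simp [rhoTU, zpowersHom_apply]

theorem rhoTU_map {F S S' : Type*} [Group F] [CommRing S] [CommRing S'] (f : S →+* S')
    (t u : F →* Multiplicative ℤ) (T U : Sˣ) : (Units.map f.toMonoidHom).comp (rhoTU t u T U) =
      rhoTU t u (Units.map f.toMonoidHom T) (Units.map f.toMonoidHom U) := by
  ext g
  rw [MonoidHom.comp_apply, rhoTU_apply, rhoTU_apply, map_mul, map_zpow, map_zpow]

theorem fifth_zero {Γ : Type*} [Group Γ] (t : Γ →* Multiplicative ℤ) (g : Γ) (h : g ^ 5 = 1) :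
    t g = 1 := by
  have : (t g) ^ 5 = 1 := by rw [← map_pow, h, map_one]
  have h2 := congrArg Multiplicative.toAdd this
  rw [toAdd_pow, toAdd_one] at h2
  apply Multiplicative.toAdd.injective
  rw [toAdd_one]
  simpa using h2

theorem IsCr.pow5 {F S : Type*} [Group F] [CommRing S] {ρ : F →* Sˣ} {δ : F → S} (h : IsCr ρ δ)
    (h5 : (5 : S) = 0) (g : F) (hg : ρ g = 1) : δ (g ^ 5) = 0 := by
  have h2 (x y : F) (hx : ρ x = 1) : δ (x * y) = δ x + δ y := by rw [h, hx]; simp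
  have : g ^ 5 = g * (g * (g * (g * g))) := by simp only [pow_succ, pow_zero, one_mul, mul_assoc]
  rw [this, h2 _ _ hg, h2 _ _ hg, h2 _ _ hg, h2 _ _ hg]
  linear_combination δ g * h5

theorem cr_descend {Γ S : Type*} [Group Γ] [CommRing S] {F : Type*} [Group F] (π : F →* Γ)
    (hπ : Function.Surjective π) (R : Set F) (hR1 : ∀ r ∈ R, π r = 1)
    (hker : ∀ w, π w = 1 → w ∈ Subgroup.normalClosure R)
    (ρ : Γ →* Sˣ) (δ : F → S) (hδ : IsCr (ρ.comp π) δ) (hR : ∀ r ∈ R, δ r = 0) :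
    ∃ δ' : Γ → S, IsCr ρ δ' ∧ ∀ w, δ' (π w) = δ w := by
  let N : Subgroup F :=
    { carrier := {g | π g = 1 ∧ δ g = 0}
      one_mem' := ⟨map_one _, hδ.one⟩
      mul_mem' := by
        rintro a b ⟨ha, ha'⟩ ⟨hb, hb'⟩
        exact ⟨by rw [map_mul, ha, hb, mul_one], by rw [hδ, ha', hb']; simp⟩
      inv_mem' := by
        rintro a ⟨ha, ha'⟩
        exact ⟨by rw [map_inv, ha, inv_one], by rw [hδ.inv, ha']; simp⟩ }
  have hN : N.Normal := by
    refine ⟨fun a ha g => ?_⟩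
    obtain ⟨ha, ha'⟩ := ha
    refine ⟨by simp [ha], ?_⟩
    rw [hδ, hδ, hδ.inv, ha']
    simp [ha]
  have h1 : ∀ w, π w = 1 → δ w = 0 := by
    intro w hw
    have : Subgroup.normalClosure R ≤ N :=
      Subgroup.normalClosure_le_normal (fun r hr => ⟨hR1 r hr, hR r hr⟩)
    exact (this (hker w hw)).2
  have h2 : ∀ w w', π w = π w' → δ w = δ w' := by
    intro w w' h
    have h3 : δ (w' * (w'⁻¹ * w)) = δ w' := by
      rw [hδ, h1 (w'⁻¹ * w) (by rw [map_mul, map_inv, h, inv_mul_cancel])]; simp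
    rwa [mul_inv_cancel_left] at h3
  refine ⟨fun g => δ (Function.surjInv hπ g), fun g h => ?_, fun w => ?_⟩
  · simp only []
    rw [h2 _ (Function.surjInv hπ g * Function.surjInv hπ h), hδ]
    · simp [Function.surjInv_eq]
    · simp [Function.surjInv_eq]
  · exact h2 _ _ (Function.surjInv_eq hπ _)

theorem from_det {Γ : Type*} [Group Γ] {n : ℕ} (π : Fr n →* Γ) (hπ : Function.Surjective π)
    (r : Fin n → Fr n) (C : Set (Fr n)) (hC : C.Finite) (hr : ∀ i, π (r i) = 1)
    (hC5 : ∀ c ∈ C, (π c) ^ 5 = 1)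
    (hker : ∀ w, π w = 1 → w ∈ Subgroup.normalClosure (Set.range r ∪ (fun c => c ^ 5) '' C))
    (t u : Γ →* Multiplicative ℤ)
    (hsurj : ∀ m n : ℤ, ∃ γ, t γ = Multiplicative.ofAdd m ∧ u γ = Multiplicative.ofAdd n)
    (σ : Γ ≃* Γ) (hσt : ∀ g, t (σ g) = (t g)⁻¹) (hσu : ∀ g, u (σ g) = (u g)⁻¹)
    (γ : Fr n) (hγt : t (π γ) = 1) (hγu : u (π γ) = Multiplicative.ofAdd 1) (t₀ : L5ˣ)
    (hdet : (Jm r γ ((rhoTU t u t₀ X5u).comp π)).det = 0) : HasF2 Γ := by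
  have hRfin : (Set.range r ∪ (fun c => c ^ 5) '' C).Finite := (Set.finite_range r).union (hC.image _)
  have hR1 : ∀ w ∈ (Set.range r ∪ (fun c => c ^ 5) '' C), π w = 1 := by
    rintro w (⟨i, rfl⟩ | ⟨c, hc, rfl⟩)
    · exact hr i
    · simp only [map_pow]; exact hC5 c hc
  obtain ⟨v, hv, hJv⟩ := exists_mulVec_eq_zero_iff.2 hdet
  set ρ := rhoTU t u t₀ X5u with hρ
  have hcr := fox_sum_cr (ρ.comp π) v
  set δ : Fr n → L5 := fun g => ∑ j, fox (ρ.comp π) g j * v j with hδ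
  have hδr (i) : δ (r i) = 0 := by
    have := congrFun hJv i.succ
    simpa [Jm, mulVec, dotProduct] using this
  have hδγ : δ γ = 0 := by
    have := congrFun hJv 0
    simpa [Jm, mulVec, dotProduct] using this
  have h5 : (5 : L5) = 0 := by
    have := map_ofNat (algebraMap K5 L5) 5
    rw [← this]
    have : (OfNat.ofNat 5 : K5) = 0 := by decide
    rw [this, map_zero]
  obtain ⟨δ', hδ', hδδ'⟩ := cr_descend π hπ _ hR1 hker ρ δ hcr (by
    rintro w (⟨i, rfl⟩ | ⟨c, hc, rfl⟩)
    · exact hδr i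
    · apply hcr.pow5 h5
      rw [MonoidHom.comp_apply, hρ, rhoTU_apply, fifth_zero t _ (hC5 c hc),
        fifth_zero u _ (hC5 c hc)]
      simp)
  obtain ⟨j, hj⟩ : ∃ j, v j ≠ 0 := by
    by_contra! h
    exact hv (funext h)
  refine final_val π hπ _ hRfin hR1 hker t u hsurj σ hσt hσu t₀ t₀.ne_zero δ' ?_
    (π (FreeGroup.of j)) ?_ (π γ) ?_ ?_
  · intro g h
    rw [hδ' g h, hρ, rhoTU_apply, Units.val_mul, Units.val_zpow_eq_zpow_val,
      Units.val_zpow_eq_zpow_val]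
    rfl
  · rw [hδδ', hδ]
    simp only []
    rw [fox_sum_of]; exact hj
  · rw [hδδ', hδγ]
  · rw [hγt, hγu, toAdd_one, zpow_zero, one_mul, toAdd_ofAdd, zpow_one]
    intro h
    apply X5_trans
    rw [h]
    exact isAlgebraic_one

theorem pres_F2 {Γ : Type*} [Group Γ] {n : ℕ} (π : Fr n →* Γ) (hπ : Function.Surjective π)
    (r : Fin n → Fr n) (C : Set (Fr n)) (hC : C.Finite) (hr : ∀ i, π (r i) = 1)
    (hC5 : ∀ c ∈ C, (π c) ^ 5 = 1)
    (hker : ∀ w, π w = 1 → w ∈ Subgroup.normalClosure (Set.range r ∪ (fun c => c ^ 5) '' C))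
    (t u : Γ →* Multiplicative ℤ)
    (hsurj : ∀ m n : ℤ, ∃ γ, t γ = Multiplicative.ofAdd m ∧ u γ = Multiplicative.ofAdd n)
    (σ : Γ ≃* Γ) (hσt : ∀ g, t (σ g) = (t g)⁻¹) (hσu : ∀ g, u (σ g) = (u g)⁻¹)
    (ω : Γ →* Multiplicative (ZMod 5)) (y : Γ) (hy : ω y = Multiplicative.ofAdd 1)
    (hy5 : y ^ 5 = 1) : HasF2 Γ := by
  have hωex : ∀ γ : Γ, ∃ k : ℕ, ω (γ * y ^ k) = 1 := by
    intro γ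
    refine ⟨(-(ω γ).toAdd).val, ?_⟩
    apply Multiplicative.toAdd.injective
    rw [map_mul, map_pow, hy]
    simp
  have hadj : ∀ a b : ℤ, ∃ w : Fr n, t (π w) = Multiplicative.ofAdd a ∧
      u (π w) = Multiplicative.ofAdd b ∧ ω (π w) = 1 := by
    intro a b
    obtain ⟨γ, h1, h2⟩ := hsurj a b
    obtain ⟨k, hk⟩ := hωex γ
    obtain ⟨w, hw⟩ := hπ (γ * y ^ k)
    refine ⟨w, ?_, ?_, by rw [hw, hk]⟩
    · rw [hw, map_mul, map_pow, fifth_zero t y hy5, one_pow, mul_one, h1]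
    · rw [hw, map_mul, map_pow, fifth_zero u y hy5, one_pow, mul_one, h2]
  obtain ⟨γt, ht1, ht2, ht3⟩ := hadj 1 0
  obtain ⟨γu, hu1, hu2, hu3⟩ := hadj 0 1
  obtain ⟨yw, hyw⟩ := hπ y
  let ρ := (rhoTU t u TT UU).comp π
  have hmap {S : Type} [CommRing S] [Algebra K5 S] (T U : Sˣ) (γ : Fr n) :
      evL T U (Jm r γ ρ).det = (Jm r γ ((rhoTU t u T U).comp π)).det := by
    rw [← Jm_map, ← MonoidHom.comp_assoc, rhoTU_map, evL_T, evL_U]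
  have hρt : ρ γt = TT := by simp [ρ, rhoTU_apply, ht1, ht2]
  have hρu : ρ γu = UU := by simp [ρ, rhoTU_apply, hu1, hu2]
  have hrel := Jm_rel r γt γu ρ (fun i => by simp [ρ, hr])
  rw [hρt, hρu] at hrel
  have hdual : evL epsu 1 (Jm r γt ρ).det = 0 := by
    rw [hmap]
    set ρ' := (rhoTU t u epsu 1).comp π
    have htr : (Units.map (TrivSqZeroExt.fstHom K5 K5 K5).toRingHom.toMonoidHom).comp ρ' = 1 := by
      have e : Units.map (TrivSqZeroExt.fstHom K5 K5 K5).toRingHom.toMonoidHom epsu = 1 := by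
        ext; simp [epsu]
      rw [← MonoidHom.comp_assoc, rhoTU_map, map_one, e]
      ext g
      simp [rhoTU_apply]
    have hJ : (Jm r γt ρ').map TrivSqZeroExt.fst = Jm r γt (1 : Fr n →* K5ˣ) := by
      rw [← htr]
      ext i j
      exact (fox_map (TrivSqZeroExt.fstHom K5 K5 K5).toRingHom ρ' _ j).symm
    let δ1 : Fr n → K5 := fun g => (ω (π g)).toAdd
    let δ2 : Fr n → K5 := fun g => ((u (π g)).toAdd : K5)
    have hc1 : IsCr (1 : Fr n →* K5ˣ) δ1 := by intro g h; simp [δ1]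
    have hc2 : IsCr (1 : Fr n →* K5ˣ) δ2 := by intro g h; simp [δ2]
    apply dual_det _ (fun j => δ1 (FreeGroup.of j)) (fun j => δ2 (FreeGroup.of j))
    · rw [hJ, Jm_mulVec r γt 1 δ1 hc1 (fun i => by simp [δ1, hr])]
      simp [δ1, ht3]
    · rw [hJ, Jm_mulVec r γt 1 δ2 hc2 (fun i => by simp [δ2, hr])]
      simp [δ2, ht2]
    · intro p q hpq
      have key (g : Fr n) : p * δ1 g + q * δ2 g = 0 := by
        rw [← hc1.fox g, ← hc2.fox g, Finset.mul_sum, Finset.mul_sum, ← Finset.sum_add_distrib]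
        apply Finset.sum_eq_zero
        intro j _
        have := congrFun hpq j
        simp only [Pi.add_apply, Pi.smul_apply, smul_eq_mul, Pi.zero_apply] at this
        linear_combination fox 1 g j * this
      constructor
      · have := key yw
        simpa [δ1, δ2, hyw, hy, fifth_zero u y hy5] using this
      · have := key γu
        simpa [δ1, δ2, hu2, hu3] using this
  rcases alg_core _ _ hrel hdual with h | ⟨t₀, h⟩
  · rw [hmap] at h
    refine from_det π hπ r C hC hr hC5 hker u t (fun a b => ?_) σ hσu hσt γt ht2 ht1 1 ?_
    · obtain ⟨γ, h1, h2⟩ := hsurj b a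
      exact ⟨γ, h2, h1⟩
    · rw [← h]
      congr 3
      ext g
      simp [rhoTU_apply]
  · rw [hmap] at h
    exact from_det π hπ r C hC hr hC5 hker t u hsurj σ hσt hσu γu hu1 hu2 t₀ h

/-- cocycles over a permutation representation -/
def IsCo {F Ω H : Type*} [Group F] [Group H] (A : F →* Equiv.Perm Ω) (c : F → Ω → H) : Prop :=
  ∀ g h i, c (g * h) i = c g (A h i) * c h i

section
variable {F Ω H : Type*} [Group F] [Group H] {A : F →* Equiv.Perm Ω} {c : F → Ω → H}

theorem IsCo.one (h : IsCo A c) (i : Ω) : c 1 i = 1 := by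
  have := h 1 1 i
  rw [mul_one, map_one, Equiv.Perm.one_apply] at this
  exact left_eq_mul.1 this

theorem IsCo.inv (h : IsCo A c) (g : F) (i : Ω) : c g⁻¹ (A g i) = (c g i)⁻¹ := by
  have := h g⁻¹ g i
  rw [inv_mul_cancel, h.one] at this
  exact eq_inv_of_mul_eq_one_left this.symm

theorem IsCo.map (h : IsCo A c) {H' : Type*} [Group H'] (f : H →* H') :
    IsCo A (fun g i => f (c g i)) := by
  intro g k i
  simp only [h g k i, map_mul]

theorem IsCo.ext {J : Type*} {A : FreeGroup J →* Equiv.Perm Ω} {c c' : FreeGroup J → Ω → H}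
    (h : IsCo A c) (h' : IsCo A c')
    (e : ∀ j i, c (FreeGroup.of j) i = c' (FreeGroup.of j) i) (g : FreeGroup J) :
    ∀ i, c g i = c' g i := by
  induction g using FreeGroup.induction_on with
  | C1 => intro i; rw [h.one, h'.one]
  | of j => exact e j
  | inv_of j _ =>
    intro i
    obtain ⟨k, rfl⟩ := (A (FreeGroup.of j)).surjective i
    rw [h.inv, h'.inv, e]
  | mul a b ha hb => intro i; rw [h, h', ha, hb]

theorem co_exists {J : Type*} (A : FreeGroup J →* Equiv.Perm Ω) (l : J → Ω → H) :
    ∃ c : FreeGroup J → Ω → H, IsCo A c ∧ ∀ j i, c (FreeGroup.of j) i = l j i := by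
  let B : FreeGroup J →* Equiv.Perm (Ω × H) := FreeGroup.lift fun j =>
    ⟨fun p => (A (FreeGroup.of j) p.1, l j p.1 * p.2),
     fun p => ((A (FreeGroup.of j))⁻¹ p.1, (l j ((A (FreeGroup.of j))⁻¹ p.1))⁻¹ * p.2),
     fun p => by simp, fun p => by simp⟩
  have hB (g : FreeGroup J) : ∀ i h, B g (i, h) = (A g i, (B g (i, 1)).2 * h) := by
    induction g using FreeGroup.induction_on with
    | C1 => simp
    | of j => intro i h; simp [B]
    | inv_of j hj =>
      intro i h
      rw [map_inv, map_inv, Equiv.Perm.inv_eq_iff_eq, hj]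
      obtain ⟨i, rfl⟩ := (A (FreeGroup.of j)).surjective i
      have h3 : (B (FreeGroup.of j))⁻¹ (A (FreeGroup.of j) i, 1) =
          (i, ((B (FreeGroup.of j) (i, 1)).2)⁻¹) := by
        rw [Equiv.Perm.inv_eq_iff_eq, hj]; simp
      rw [h3]
      simp
    | mul a b ha hb =>
      intro i h
      have h3 : (B (a * b) (i, 1)).2 = (B a (A b i, 1)).2 * (B b (i, 1)).2 := by
        rw [map_mul, Equiv.Perm.mul_apply, hb i 1, ha]
      rw [h3, map_mul, map_mul, Equiv.Perm.mul_apply, Equiv.Perm.mul_apply, hb, ha, mul_assoc]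
  refine ⟨fun g i => (B g (i, 1)).2, fun g h i => ?_, fun j i => by simp [B]⟩
  simp only [map_mul, Equiv.Perm.mul_apply]
  rw [hB h i 1, hB g]

theorem IsCo.kerNormal (h : IsCo A c) : ∃ N : Subgroup F, N.Normal ∧
    ∀ g, g ∈ N ↔ A g = 1 ∧ ∀ i, c g i = 1 := by
  let N : Subgroup F :=
    { carrier := {g | A g = 1 ∧ ∀ i, c g i = 1}
      one_mem' := ⟨map_one _, h.one⟩
      mul_mem' := by
        rintro a b ⟨ha, ha'⟩ ⟨hb, hb'⟩
        exact ⟨by rw [map_mul, ha, hb, mul_one], fun i => by rw [h, ha', hb', mul_one]⟩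
      inv_mem' := by
        rintro a ⟨ha, ha'⟩
        refine ⟨by rw [map_inv, ha, inv_one], fun i => ?_⟩
        have := h.inv a i
        rw [ha, Equiv.Perm.one_apply, ha', inv_one] at this
        exact this }
  refine ⟨N, ⟨fun a ha g => ?_⟩, fun g => Iff.rfl⟩
  obtain ⟨ha, ha'⟩ := ha
  refine ⟨by simp [ha], fun i => ?_⟩
  obtain ⟨i, rfl⟩ := (A g).surjective i
  rw [h, h.inv, h]
  simp [ha, ha']

theorem IsCo.conj (h : IsCo A c) (z : F) (m : ℕ) (hz : A z ^ m = 1) (N : Subgroup H) (hN : N.Normal)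
    (i : Ω) (hi : c (z ^ m) i ∈ N) (k : ℕ) : c (z ^ m) ((A z ^ k) i) ∈ N := by
  induction k with
  | zero => simpa using hi
  | succ k ih =>
    set i' := (A z ^ k) i
    have h1 : c (z ^ m) (A z i') * c z i' = c z i' * c (z ^ m) i' := by
      rw [← h, ← pow_succ, pow_succ', h, map_pow, hz, Equiv.Perm.one_apply]
    rw [pow_succ', Equiv.Perm.mul_apply]
    rw [eq_mul_inv_of_mul_eq h1]
    exact hN.conj_mem _ ih _
end

theorem invol_reps (s : Equiv.Perm (Fin 12)) (h2 : s ^ 2 = 1) (hf : ∀ i, s i ≠ i) :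
    ∃ f : Fin 6 → Fin 12, ∀ i, ∃ k, ∃ j : ℕ, (s ^ j) (f k) = i := by
  have hss (i) : s (s i) = i := by
    rw [← Equiv.Perm.mul_apply, ← pow_two, h2, Equiv.Perm.one_apply]
  let S : Finset (Fin 12) := Finset.univ.filter (fun i => i < s i)
  have h1 : Sᶜ = S.map s.toEmbedding := by
    ext i
    rw [Finset.mem_compl, Finset.mem_map_equiv]
    have : s.symm i = s i := by rw [Equiv.symm_apply_eq, hss]
    simp only [S, Finset.mem_filter, Finset.mem_univ, true_and, this, hss]
    have := hf i
    constructor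
    · intro h; exact lt_of_le_of_ne (not_lt.1 h) this
    · intro h; exact not_lt.2 h.le
  have h3 : S.card = 6 := by
    have h4 := Finset.card_compl_add_card S
    rw [h1, Finset.card_map, Fintype.card_fin] at h4
    omega
  refine ⟨fun k => (S.equivFin.symm (Fin.cast h3.symm k)).1, fun i => ?_⟩
  have key (i) (hi : i ∈ S) : ∃ k : Fin 6, (S.equivFin.symm (Fin.cast h3.symm k)).1 = i :=
    ⟨Fin.cast h3 (S.equivFin ⟨i, hi⟩), by simp⟩
  by_cases hi : i ∈ S
  · obtain ⟨k, hk⟩ := key i hi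
    exact ⟨k, 0, by simpa using hk⟩
  · have : i ∈ Sᶜ := Finset.mem_compl.2 hi
    rw [h1, Finset.mem_map] at this
    obtain ⟨a, ha, rfl⟩ := this
    obtain ⟨k, hk⟩ := key a ha
    exact ⟨k, 1, by simp [hk]⟩

def rels3 (w : FreeGroup (Fin 2)) : Set (FreeGroup (Fin 2)) := {xgen ^ 3, ygen ^ 5, w ^ 2}

theorem schreier (A : FreeGroup (Fin 2) →* Equiv.Perm (Fin 12)) (w : FreeGroup (Fin 2))
    (Ab : PresentedGroup (rels3 w) →* Equiv.Perm (Fin 12))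
    (hAb : ∀ g, Ab (PresentedGroup.mk _ g) = A g)
    (hx3 : A xgen ^ 3 = 1) (hy5 : A ygen ^ 5 = 1) (hw2 : A w ^ 2 = 1)
    (rx : Fin 4 → Fin 12) (hrx : ∀ i, ∃ k, ∃ j : ℕ, (A xgen ^ j) (rx k) = i)
    (ry : Fin 2 → Fin 12) (hry : ∀ i, A ygen i = i ∨ ∃ k, ∃ j : ℕ, (A ygen ^ j) (ry k) = i)
    (hwf : ∀ i, A w i ≠ i)
    (tr : Fin 12 → FreeGroup (Fin 2)) (htr0 : tr 0 = 1) (htr : ∀ i, A (tr i) 0 = i)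
    (Γ : Subgroup (PresentedGroup (rels3 w))) (hΓ : ∀ g, g ∈ Γ ↔ Ab g 0 = 0) :
    ∃ (π : Fr 23 →* Γ) (r : Fin 23 → Fr 23) (C : Set (Fr 23)),
      Function.Surjective π ∧ C.Finite ∧ (∀ i, π (r i) = 1) ∧ (∀ c ∈ C, (π c) ^ 5 = 1) ∧
      ∀ w, π w = 1 → w ∈ Subgroup.normalClosure (Set.range r ∪ (fun c => c ^ 5) '' C) := by
  obtain ⟨rw, hrw⟩ := invol_reps (A w) hw2 hwf
  let e : Fin 2 × Fin 12 ≃ Fin 24 := finProdFinEquiv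
  obtain ⟨c, hc, hcof⟩ := co_exists A (fun j i => (FreeGroup.of (e (j, i)) : Fr 23))
  let mk := PresentedGroup.mk (rels3 w)
  -- the lift to the free group
  let μ : Fr 23 →* FreeGroup (Fin 2) := FreeGroup.lift fun l =>
    (tr (A (FreeGroup.of (e.symm l).1) (e.symm l).2))⁻¹ * FreeGroup.of (e.symm l).1 * tr (e.symm l).2
  have hμof (j i) : μ (FreeGroup.of (e (j, i))) =
      (tr (A (FreeGroup.of j) i))⁻¹ * FreeGroup.of j * tr i := by simp [μ]
  have htr' (i) : (A (tr i))⁻¹ i = 0 := by rw [Equiv.Perm.inv_eq_iff_eq, htr]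
  have hμ0 (v : Fr 23) : A (μ v) 0 = 0 := by
    induction v using FreeGroup.induction_on with
    | C1 => simp
    | of l =>
      obtain ⟨⟨j, i⟩, rfl⟩ := e.surjective l
      change A (μ (FreeGroup.of _)) 0 = 0
      rw [hμof, map_mul, map_mul, map_inv, Equiv.Perm.mul_apply, Equiv.Perm.mul_apply, htr, htr']
    | inv_of l h => rw [map_inv, map_inv, Equiv.Perm.inv_eq_iff_eq, h]
    | mul a b ha hb => rw [map_mul, map_mul, Equiv.Perm.mul_apply, hb, ha]
  let π : Fr 23 →* Γ := (mk.comp μ).codRestrict Γ (fun v => (hΓ _).2 (by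
    rw [MonoidHom.comp_apply, hAb]; exact hμ0 v))
  have hπv (v) : ((π v : Γ) : PresentedGroup (rels3 w)) = mk (μ v) := rfl
  have hπc (g) (i) : ((π (c g i) : Γ) : PresentedGroup (rels3 w)) = (mk (tr (A g i)))⁻¹ * mk g * mk (tr i) := by
    have h1 : IsCo A (fun g i => (mk.comp μ) (c g i)) := hc.map _
    have h2 : IsCo A (fun g i => (mk (tr (A g i)))⁻¹ * mk g * mk (tr i)) := by
      intro g h i; simp only [map_mul, Equiv.Perm.mul_apply]; group
    refine h1.ext h2 (fun j i => ?_) g i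
    simp only [MonoidHom.comp_apply]
    rw [hcof, hμof]
    simp
  have hrel1 (z) (hz : z ∈ rels3 w) : mk z = 1 := PresentedGroup.one_of_mem hz
  have hA1 (z) (hz : z ∈ rels3 w) : A z = 1 := by rw [← hAb, show PresentedGroup.mk _ z = 1 from hrel1 z hz, map_one]
  have hπrel (z) (hz : z ∈ rels3 w) (i) : π (c z i) = 1 := by
    apply Subtype.ext
    rw [hπc, hrel1 z hz, hA1 z hz]; simp
  have hx : xgen ^ 3 ∈ rels3 w := by simp [rels3]
  have hy : ygen ^ 5 ∈ rels3 w := by simp [rels3]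
  have hw : w ^ 2 ∈ rels3 w := by simp [rels3]
  let r : Fin 23 → Fr 23 := Fin.append (Fin.append (fun i : Fin 11 => c (tr i.succ) 0)
    (fun k => c (xgen ^ 3) (rx k))) (Fin.append (fun k => c (ygen ^ 5) (ry k)) (fun k => c (w ^ 2) (rw k)))
  let C : Set (Fr 23) := {v | ∃ i, A ygen i = i ∧ c ygen i = v}
  have hpow (i) (hi : A ygen i = i) (m : ℕ) : c (ygen ^ m) i = (c ygen i) ^ m := by
    induction m with
    | zero => simp [hc.one]
    | succ m ih => rw [pow_succ, hc, hi, ih, pow_succ]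
  refine ⟨π, r, C, ?_, ?_, ?_, ?_, ?_⟩
  · rintro ⟨g, hg⟩
    obtain ⟨g', rfl⟩ := PresentedGroup.mk_surjective _ g
    refine ⟨c g' 0, Subtype.ext ?_⟩
    rw [hΓ, hAb] at hg
    rw [hπc, hg, htr0]
    simp [mk]
  · exact (Set.finite_range (fun i => c ygen i)).subset (by rintro _ ⟨i, -, rfl⟩; exact ⟨i, rfl⟩)
  · have h1 (i : Fin 12) : π (c (tr i) 0) = 1 := by
      apply Subtype.ext
      rw [hπc, htr, htr0]; simp
    intro i
    refine Fin.addCases (fun i => Fin.addCases (fun i => ?_) (fun i => ?_) i)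
      (fun i => Fin.addCases (fun i => ?_) (fun i => ?_) i) (show Fin ((11 + 4) + (2 + 6)) from i)
    · simp only [r, Fin.append_left]; exact h1 _
    · simp only [r, Fin.append_left, Fin.append_right]; exact hπrel _ hx _
    · simp only [r, Fin.append_left, Fin.append_right]; exact hπrel _ hy _
    · simp only [r, Fin.append_right]; exact hπrel _ hw _
  · rintro _ ⟨i, hi, rfl⟩
    rw [← map_pow, ← hpow i hi]
    exact hπrel _ hy _
  · intro v hv
    set N := Subgroup.normalClosure (Set.range r ∪ (fun c => c ^ 5) '' C) with hNdef
    have hNn : N.Normal := Subgroup.normalClosure_normal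
    have hrN (i) : r i ∈ N := Subgroup.subset_normalClosure (Or.inl ⟨i, rfl⟩)
    have hN0 (i) : c (tr i) 0 ∈ N := by
      refine Fin.cases ?_ (fun i => ?_) i
      · rw [htr0, hc.one]; exact one_mem _
      · have := hrN (Fin.castAdd (2 + 6) (Fin.castAdd 4 i))
        simpa only [r, Fin.append_left] using this
    have hNx (i) : c (xgen ^ 3) i ∈ N := by
      obtain ⟨k, j, rfl⟩ := hrx i
      apply hc.conj _ _ hx3 _ hNn
      have := hrN (Fin.castAdd (2 + 6) (Fin.natAdd 11 k))
      simpa only [r, Fin.append_left, Fin.append_right] using this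
    have hNy (i) : c (ygen ^ 5) i ∈ N := by
      rcases hry i with h | ⟨k, j, rfl⟩
      · rw [hpow i h]
        exact Subgroup.subset_normalClosure (Or.inr ⟨_, ⟨i, h, rfl⟩, rfl⟩)
      apply hc.conj _ _ hy5 _ hNn
      have := hrN (Fin.natAdd (11 + 4) (Fin.castAdd 6 k))
      simpa only [r, Fin.append_left, Fin.append_right] using this
    have hNw (i) : c (w ^ 2) i ∈ N := by
      obtain ⟨k, j, rfl⟩ := hrw i
      apply hc.conj _ _ hw2 _ hNn
      have := hrN (Fin.natAdd (11 + 4) (Fin.natAdd 2 k))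
      simpa only [r, Fin.append_left, Fin.append_right] using this
    let q := QuotientGroup.mk' N
    have hq (v) : q v = 1 ↔ v ∈ N := QuotientGroup.eq_one_iff v
    have hqc := hc.map q
    obtain ⟨M, hMn, hM⟩ := hqc.kerNormal
    have hMr : Subgroup.normalClosure (rels3 w) ≤ M := by
      apply Subgroup.normalClosure_le_normal
      intro z hz
      refine (hM z).2 ⟨hA1 z hz, fun i => (hq _).2 ?_⟩
      rcases hz with rfl | rfl | rfl
      · exact hNx i
      · exact hNy i
      · exact hNw i
    have hqμ (v) : q (c (μ v) 0) = q v := by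
      induction v using FreeGroup.induction_on with
      | C1 => simp [hc.one]
      | of l =>
        obtain ⟨⟨j, i⟩, rfl⟩ := e.surjective l
        change q (c (μ (FreeGroup.of _)) 0) = q (FreeGroup.of _)
        have h1 : c (tr (A (FreeGroup.of j) i))⁻¹ (A (FreeGroup.of j) i) =
            (c (tr (A (FreeGroup.of j) i)) 0)⁻¹ := by
          have := hc.inv (tr (A (FreeGroup.of j) i)) 0
          rwa [htr] at this
        rw [hμof, hc, hc, htr, h1, map_mul, map_mul, map_inv, (hq _).2 (hN0 _), (hq _).2 (hN0 _), hcof]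
        simp
      | inv_of l h =>
        have := hc.inv (μ (FreeGroup.of l)) 0
        rw [hμ0] at this
        rw [map_inv, this, map_inv, h, map_inv]
      | mul a b ha hb => rw [map_mul, hc, hμ0, map_mul, ha, hb, map_mul]
    have h1 : μ v ∈ Subgroup.normalClosure (rels3 w) := by
      rw [← PresentedGroup.mk_eq_one_iff]
      have := congrArg Subtype.val hv
      rwa [hπv] at this
    have h2 := ((hM _).1 (hMr h1)).2 0
    rw [hqμ] at h2
    exact (hq v).1 h2

abbrev M2 := Matrix (Fin 2) (Fin 2) ℂ

theorem coeff1_mul (A B : Matrix (Fin 2) (Fin 2) ℂ[X]) :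
    (A * B).map (fun p => p.coeff 1) =
      A.map (fun p => p.coeff 1) * B.map (fun p => p.coeff 0) +
      A.map (fun p => p.coeff 0) * B.map (fun p => p.coeff 1) := by
  ext i j
  simp [Matrix.mul_apply, Fin.sum_univ_two, Polynomial.mul_coeff_one]
  ring

theorem coeff0_mul (A B : Matrix (Fin 2) (Fin 2) ℂ[X]) :
    (A * B).map (fun p => p.coeff 0) =
      A.map (fun p => p.coeff 0) * B.map (fun p => p.coeff 0) := by
  ext i j
  simp [Matrix.mul_apply, Fin.sum_univ_two, Polynomial.mul_coeff_zero]

/-- the derivation attached to a double root -/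
theorem deriv_exists (X0 Y0 : SL2) (hX : X0.1.trace = 1) (hY : Y0.1.trace = phi)
    (w : FreeGroup (Fin 2)) (τ : ℂ[X]) (hτ : IsTracePolynomial w τ) (α : ℂ)
    (hα : (X0 * Y0).1.trace = α) (hm : (Polynomial.X - Polynomial.C α) ^ 2 ∣ τ) :
    ∃ c : FreeGroup (Fin 2) → M2,
      (∀ g h, c (g * h) = c g + (wEval X0 Y0 g).1 * c h * (wEval X0 Y0 g)⁻¹.1) ∧
      c xgen = 0 ∧ c ygen = !![0, 1; 0, 0] - Y0.1 * !![0, 1; 0, 0] * Y0⁻¹.1 ∧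
      (∀ r ∈ rels3 w, c r = 0 ∧ (wEval X0 Y0 r).1 = -1) ∧ (wEval X0 Y0 w).1.trace = 0 := by
  let U : Matrix.SpecialLinearGroup (Fin 2) ℂ[X] := ⟨!![1, Polynomial.X; 0, 1], by simp [det_fin_two]⟩
  let Xs : Matrix.SpecialLinearGroup (Fin 2) ℂ[X] := X0.map (Polynomial.C)
  let Ys : Matrix.SpecialLinearGroup (Fin 2) ℂ[X] := U * Y0.map (Polynomial.C) * U⁻¹
  let M : FreeGroup (Fin 2) →* Matrix.SpecialLinearGroup (Fin 2) ℂ[X] := FreeGroup.lift ![Xs, Ys]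
  have hev (s : ℂ) (g) : (M g).map (evalRingHom s) =
      wEval X0 (Ys.map (evalRingHom s)) g := by
    have e1 : Xs.map (evalRingHom s) = X0 := by
      ext i j; simp [Xs]
    have : (Matrix.SpecialLinearGroup.map (evalRingHom s)).comp M =
        FreeGroup.lift ![X0, Ys.map (evalRingHom s)] := by
      ext i : 1; fin_cases i
      · simp [M, e1]
      · simp [M]
    rw [wEval, ← this]; rfl
  have e1 (s : ℂ) : Xs.map (evalRingHom s) = X0 := by
    ext i j; simp [Xs]
  have tm (s : ℂ) (B : Matrix.SpecialLinearGroup (Fin 2) ℂ[X]) :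
      eval s B.1.trace = (B.map (evalRingHom s)).1.trace := by
    rw [Matrix.trace_fin_two, Matrix.trace_fin_two, eval_add]; rfl
  have hY0 : Ys.map (evalRingHom 0) = Y0 := by
    have hU : U.map (evalRingHom 0) = 1 := by
      ext i j
      change eval 0 (U.1 i j) = _
      fin_cases i <;> fin_cases j <;> simp [U]
    simp only [Ys, map_mul, map_inv, hU]
    ext i j; simp
  have h0 (g) : (M g).1.map (fun p => p.coeff 0) = (wEval X0 Y0 g).1 := by
    have := hev 0 g
    rw [hY0] at this
    rw [← this]
    ext i j; simp [coeff_zero_eq_eval_zero]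
  have trY : Ys.1.trace = Polynomial.C phi := by
    have : Ys.1.trace = (Y0.map (Polynomial.C)).1.trace := by
      simp only [Ys, Matrix.SpecialLinearGroup.coe_mul]
      rw [Matrix.trace_mul_comm, ← mul_assoc, ← Matrix.SpecialLinearGroup.coe_mul,
        inv_mul_cancel, Matrix.SpecialLinearGroup.coe_one, one_mul]
    rw [this, ← hY]; simp [Matrix.trace_fin_two]
  have trX : Xs.1.trace = 1 := by
    have : Xs.1.trace = Polynomial.C (X0.1.trace) := by simp [Xs, Matrix.trace_fin_two]
    rw [this, hX]; simp
  have trW : (M w).1.trace = τ.comp ((Xs * Ys).1.trace) := by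
    apply Polynomial.funext
    intro s
    rw [eval_comp, tm, tm, hev, hτ, map_mul (Matrix.SpecialLinearGroup.map (evalRingHom s)) Xs Ys, e1]
    · exact hX
    · rw [← tm, trY]; simp [phi]
  have hdvd : Polynomial.X ^ 2 ∣ (M w).1.trace := by
    rw [trW]
    have h1 : Polynomial.X ∣ (Xs * Ys).1.trace - Polynomial.C α := by
      rw [Polynomial.X_dvd_iff, coeff_zero_eq_eval_zero, eval_sub, eval_C, ← hα]
      rw [tm, map_mul, hY0, e1, sub_self]
    obtain ⟨q, hq⟩ := hm
    rw [hq, mul_comp, pow_comp, sub_comp, X_comp, C_comp]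
    exact (pow_dvd_pow_of_dvd h1 2).mul_right _
  have x3 : (M (xgen ^ 3)).1 = -1 := by
    rw [map_pow, Matrix.SpecialLinearGroup.coe_pow]
    exact mat2_cube _ (by simpa [M, xgen] using Xs.2) (by simpa [M, xgen] using trX)
  have y5 : (M (ygen ^ 5)).1 = -1 := by
    rw [map_pow, Matrix.SpecialLinearGroup.coe_pow]
    exact mat2_five _ (M ygen).2 (Polynomial.C phi) (by rw [← C_pow, phi_sq]; simp) (by simpa [M, ygen] using trY)
  have w2 : (M (w ^ 2)).1 = (M w).1.trace • (M w).1 - 1 := by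
    rw [map_pow, Matrix.SpecialLinearGroup.coe_pow]
    exact mat2_sq _ (M w).2
  obtain ⟨q, hq⟩ := hdvd
  have c0 : (Polynomial.X ^ 2 * q : ℂ[X]).coeff 0 = 0 := by
    simp [mul_coeff_zero]
  have c1 : (Polynomial.X ^ 2 * q : ℂ[X]).coeff 1 = 0 := by
    simp [mul_coeff_one, coeff_X_pow]
  have neg1 : ((-1 : Matrix (Fin 2) (Fin 2) ℂ[X]).map (fun p => p.coeff 1) = 0) ∧
      ((-1 : Matrix (Fin 2) (Fin 2) ℂ[X]).map (fun p => p.coeff 0) = -1) := by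
    constructor <;> ext i j <;> fin_cases i <;> fin_cases j <;> simp [coeff_one]
  refine ⟨fun g => (M g).1.map (fun p => p.coeff 1) * (wEval X0 Y0 g)⁻¹.1, ?_, ?_, ?_, ?_, ?_⟩
  · intro g h
    have hw : wEval X0 Y0 (g * h) = wEval X0 Y0 g * wEval X0 Y0 h := map_mul _ _ _
    have e (B : SL2) : B.1 * B⁻¹.1 = 1 := by
      rw [← Matrix.SpecialLinearGroup.coe_mul, mul_inv_cancel, Matrix.SpecialLinearGroup.coe_one]
    simp only []
    rw [hw, map_mul, _root_.mul_inv_rev, Matrix.SpecialLinearGroup.coe_mul, Matrix.SpecialLinearGroup.coe_mul,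
      coeff1_mul, h0, h0, add_mul]
    congr 1
    · simp only [mul_assoc]
      rw [← mul_assoc (wEval X0 Y0 h).1, e, one_mul]
    · simp only [mul_assoc]
  · have : (M xgen).1.map (fun p => p.coeff 1) = 0 := by
      ext i j; simp [M, xgen, Xs, coeff_C]
    simp only [this, zero_mul]
  · have e0 : wEval X0 Y0 ygen = Y0 := by simp [wEval, ygen]
    have e (B : SL2) : B.1 * B⁻¹.1 = 1 := by
      rw [← Matrix.SpecialLinearGroup.coe_mul, mul_inv_cancel, Matrix.SpecialLinearGroup.coe_one]
    have : (M ygen).1.map (fun p => p.coeff 1) = !![0, 1; 0, 0] * Y0.1 - Y0.1 * !![0, 1; 0, 0] := by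
      have : M ygen = Ys := by simp [M, ygen]
      rw [this]
      simp only [Ys, Matrix.SpecialLinearGroup.coe_mul, coeff1_mul, coeff0_mul]
      have h1 : U.1.map (fun p => p.coeff 0) = 1 := by
        ext i j; fin_cases i <;> fin_cases j <;> simp [U, coeff_one]
      have h2 : U.1.map (fun p => p.coeff 1) = !![0, 1; 0, 0] := by
        ext i j; fin_cases i <;> fin_cases j <;> simp [U, coeff_one]
      have hUi : (U⁻¹).1 = !![1, -Polynomial.X; 0, 1] := by
        rw [Matrix.SpecialLinearGroup.coe_inv, Matrix.adjugate_fin_two]; simp [U]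
      have h3 : (U⁻¹).1.map (fun p => p.coeff 0) = 1 := by
        rw [hUi]; ext i j; fin_cases i <;> fin_cases j <;> simp [coeff_one]
      have h4 : (U⁻¹).1.map (fun p => p.coeff 1) = -!![0, 1; 0, 0] := by
        rw [hUi]; ext i j; fin_cases i <;> fin_cases j <;> simp [coeff_one]
      have h5 : (Y0.map (Polynomial.C)).1.map (fun p => p.coeff 0) = Y0.1 := by
        ext i j; simp
      have h6 : (Y0.map (Polynomial.C)).1.map (fun p => p.coeff 1) = 0 := by
        ext i j; simp [coeff_C]
      rw [h1, h2, h3, h4, h5, h6]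
      simp only [mul_one, mul_zero, one_mul, add_zero, mul_neg, sub_eq_add_neg]
    simp only [this, e0, sub_mul]
    rw [mul_assoc, e, mul_one]
  · intro r hr
    have hr' : (M r).1.map (fun p => p.coeff 1) = 0 ∧ (M r).1.map (fun p => p.coeff 0) = -1 := by
      rcases hr with rfl | rfl | hr
      · rw [x3]; exact neg1
      · rw [y5]; exact neg1
      · rw [Set.mem_singleton_iff.1 hr, w2, hq]
        constructor
        · ext i j
          have := congrFun (congrFun neg1.1 i) j
          simp only [Matrix.map_apply, Matrix.sub_apply, Matrix.smul_apply, smul_eq_mul, coeff_sub,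
            mul_coeff_one, c0, c1, Matrix.neg_apply, coeff_neg] at this ⊢
          simpa using this
        · ext i j
          have := congrFun (congrFun neg1.2 i) j
          simp only [Matrix.map_apply, Matrix.sub_apply, Matrix.smul_apply, smul_eq_mul, coeff_sub,
            mul_coeff_zero, c0, Matrix.neg_apply, coeff_neg] at this ⊢
          simpa using this
    refine ⟨by simp only [hr'.1, zero_mul], ?_⟩
    rw [← h0, hr'.2]
  · have : (wEval X0 Y0 w).1.trace = (M w).1.trace.coeff 0 := by
      rw [← h0]; simp [Matrix.trace_fin_two]
    rw [this, hq, c0]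

theorem co_descend {Ω H : Type*} [Group H] {rels : Set (FreeGroup (Fin 2))}
    (A : FreeGroup (Fin 2) →* Equiv.Perm Ω) (Ab : PresentedGroup rels →* Equiv.Perm Ω)
    (hAb : ∀ g, Ab (PresentedGroup.mk _ g) = A g) (c : FreeGroup (Fin 2) → Ω → H) (hc : IsCo A c)
    (hr : ∀ r ∈ rels, ∀ i, c r i = 1) :
    ∃ cb : PresentedGroup rels → Ω → H, IsCo Ab cb ∧ ∀ g i, cb (PresentedGroup.mk _ g) i = c g i := by
  obtain ⟨N, hN, hmem⟩ := hc.kerNormal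
  have hle : Subgroup.normalClosure rels ≤ N := by
    apply Subgroup.normalClosure_le_normal
    intro r h
    refine (hmem r).2 ⟨?_, hr r h⟩
    rw [← hAb, PresentedGroup.one_of_mem h, map_one]
  have hwd (g g') (h : PresentedGroup.mk rels g = PresentedGroup.mk rels g') (i) : c g i = c g' i := by
    have h1 : g⁻¹ * g' ∈ Subgroup.normalClosure rels := by
      rw [← PresentedGroup.mk_eq_one_iff, map_mul, map_inv, h, inv_mul_cancel]
    have h2 := (hmem _).1 (hle h1)
    have h3 := hc g (g⁻¹ * g') i
    rw [mul_inv_cancel_left, h2.1, h2.2, mul_one] at h3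
    exact h3.symm
  have hs := PresentedGroup.mk_surjective rels
  have key (g i) : c (Function.surjInv hs (PresentedGroup.mk rels g)) i = c g i :=
    hwd _ _ (Function.surjInv_eq hs _) i
  refine ⟨fun g => c (Function.surjInv hs g), ?_, key⟩
  intro g h i
  obtain ⟨g, rfl⟩ := hs g
  obtain ⟨h, rfl⟩ := hs h
  simp only []
  rw [← map_mul, key, key, key, hc, hAb]

theorem rank_dichotomy {Γ : Type*} [Group Γ] {n : ℕ} (π : Fr n →* Γ) (hπ : Function.Surjective π)
    (L : Γ →* Multiplicative ℂ) :
    (∃ z : ℂ, ∀ γ, ∃ m : ℤ, (L γ).toAdd = m * z) ∨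
    (∃ t u : Γ →* Multiplicative ℤ,
      (∀ m n : ℤ, ∃ γ, t γ = Multiplicative.ofAdd m ∧ u γ = Multiplicative.ofAdd n) ∧
      ∀ γ γ', L γ' = (L γ)⁻¹ → t γ' = (t γ)⁻¹ ∧ u γ' = (u γ)⁻¹) := by
  let V : Submodule ℤ ℂ := Submodule.span ℤ (Set.range fun j : Fin (n + 1) => (L (π (FreeGroup.of j))).toAdd)
  have hV (γ) : (L γ).toAdd ∈ V := by
    obtain ⟨g, rfl⟩ := hπ γ
    induction g using FreeGroup.induction_on with
    | C1 => simp
    | of j => exact Submodule.subset_span ⟨j, rfl⟩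
    | inv_of j h => rw [map_inv, map_inv, toAdd_inv]; exact V.neg_mem h
    | mul a b ha hb => rw [map_mul, map_mul, toAdd_mul]; exact V.add_mem ha hb
  have hV' (v) (hv : v ∈ V) : ∃ γ, (L γ).toAdd = v := by
    induction hv using Submodule.span_induction with
    | mem v h => obtain ⟨j, rfl⟩ := h; exact ⟨_, rfl⟩
    | zero => exact ⟨1, by simp⟩
    | add a b _ _ ha hb =>
      obtain ⟨a, rfl⟩ := ha; obtain ⟨b, rfl⟩ := hb
      exact ⟨a * b, by rw [map_mul, toAdd_mul]⟩
    | smul m a _ ha =>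
      obtain ⟨a, rfl⟩ := ha
      exact ⟨a ^ m, by rw [map_zpow, toAdd_zpow]⟩
  have : Module.Finite ℤ V := Module.Finite.span_of_finite ℤ (Set.finite_range _)
  have : Module.Free ℤ V := inferInstance
  let B := Module.finBasis ℤ V
  by_cases h2 : 2 ≤ Module.finrank ℤ V
  · right
    let co (k : Fin (Module.finrank ℤ V)) : Γ →* Multiplicative ℤ :=
      { toFun := fun γ => Multiplicative.ofAdd (B.repr ⟨_, hV γ⟩ k)
        map_one' := by
          have : (⟨_, hV 1⟩ : V) = 0 := by ext; simp
          rw [this]; simp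
        map_mul' := fun a b => by
          have : (⟨_, hV (a * b)⟩ : V) = ⟨_, hV a⟩ + ⟨_, hV b⟩ := by ext; simp
          rw [this, map_add, Finsupp.add_apply, ofAdd_add] }
    refine ⟨co ⟨0, by omega⟩, co ⟨1, by omega⟩, ?_, ?_⟩
    · intro m n
      obtain ⟨γ, hγ⟩ := hV' (m • B ⟨0, by omega⟩ + n • B ⟨1, by omega⟩ : V) (Subtype.prop _)
      have : (⟨_, hV γ⟩ : V) = m • B ⟨0, by omega⟩ + n • B ⟨1, by omega⟩ := Subtype.ext hγ
      refine ⟨γ, ?_, ?_⟩ <;> simp [co, this, Finsupp.single_apply]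
    · intro γ γ' h
      have : (⟨_, hV γ'⟩ : V) = - ⟨_, hV γ⟩ := by ext; simp [h]
      constructor <;> simp [co, this]
  · left
    have h3 : Module.finrank ℤ V = 0 ∨ Module.finrank ℤ V = 1 := by omega
    rcases h3 with h3 | h3
    · refine ⟨0, fun γ => ⟨0, ?_⟩⟩
      have : IsEmpty (Fin (Module.finrank ℤ V)) := by rw [h3]; infer_instance
      have h4 := B.sum_repr ⟨_, hV γ⟩
      rw [Finset.univ_eq_empty, Finset.sum_empty] at h4
      simpa using (congrArg Subtype.val h4).symm
    · refine ⟨(B ⟨0, by omega⟩ : V), fun γ => ⟨B.repr ⟨_, hV γ⟩ ⟨0, by omega⟩, ?_⟩⟩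
      have h4 := B.sum_repr ⟨_, hV γ⟩
      have : Unique (Fin (Module.finrank ℤ V)) :=
        ⟨⟨⟨0, by omega⟩⟩, fun a => Fin.ext (by have := a.2; change a.1 = 0; omega)⟩
      rw [Fintype.sum_eq_single ⟨0, by omega⟩ (fun x hx => absurd (Fin.ext (by have := x.2; change x.1 = 0; omega)) hx)] at h4
      have := (congrArg Subtype.val h4).symm
      simpa using this

/-- pure quaternions as matrices -/
noncomputable def qvec (a b c : ℂ) : M2 :=
  !![a * Complex.I, b + c * Complex.I; -b + c * Complex.I, -(a * Complex.I)]

noncomputable def zval (m : ℤ × ℤ) : ℂ := m.1 + m.2 * phi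

/-- coordinates of the vertices of the icosahedron in `ℤ[φ]` -/
def icoT : Fin 12 → Fin 3 → ℤ × ℤ :=
  ![![(0,0),(1,0),(0,1)], ![(0,0),(1,0),(0,-1)], ![(0,1),(0,0),(1,0)], ![(0,-1),(0,0),(1,0)],
    ![(1,0),(0,1),(0,0)], ![(1,0),(0,-1),(0,0)],
    ![(0,0),(-1,0),(0,-1)], ![(0,0),(-1,0),(0,1)], ![(0,-1),(0,0),(-1,0)], ![(0,1),(0,0),(-1,0)],
    ![(-1,0),(0,-1),(0,0)], ![(-1,0),(0,1),(0,0)]]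

noncomputable def icoP (i : Fin 12) : M2 :=
  qvec (zval (icoT i 0)) (zval (icoT i 1)) (zval (icoT i 2))

/-- cyclically ordered neighbours -/
def icoN5 : Fin 12 → Fin 5 → Fin 12 :=
  ![![2, 4, 11, 3, 7], ![4, 9, 6, 8, 11], ![0, 7, 5, 9, 4], ![0, 11, 8, 10, 7],
    ![0, 2, 9, 1, 11], ![2, 7, 10, 6, 9], ![1, 9, 5, 10, 8], ![0, 3, 10, 5, 2], ![1, 6, 10, 3, 11],
    ![1, 4, 2, 5, 6], ![3, 8, 6, 5, 7], ![4, 1, 8, 3, 0]]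

def icoN : Fin 12 → ZMod 5 → Fin 12 := icoN5

def icoAp (i : Fin 12) : Fin 12 := i + 6

theorem zval_inj : Function.Injective zval := by
  have h5 : Irrational (Real.sqrt 5) := by
    have := (show Nat.Prime 5 by norm_num).irrational_sqrt
    simpa using this
  rintro ⟨m, n⟩ ⟨m', n'⟩ h
  have h1 : (2 * (m - m') + (n - n') : ℂ) + (n - n') * (Real.sqrt 5 : ℂ) = 0 := by
    simp only [zval, phi] at h
    linear_combination 2 * h
  have h2 : (2 * (m - m') + (n - n') : ℝ) + (n - n') * (Real.sqrt 5) = 0 := by exact_mod_cast h1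
  have hn : n = n' := by
    by_contra hn
    have hn' : ((n - n' : ℤ) : ℝ) ≠ 0 := by exact_mod_cast sub_ne_zero.2 hn
    refine h5 ⟨-(2 * (m - m') + (n - n') : ℤ) / (n - n' : ℤ), ?_⟩
    push_cast at hn' ⊢
    field_simp
    linear_combination -h2
  subst hn
  have : (m : ℝ) = m' := by linear_combination h2 / 2
  have : m = m' := by exact_mod_cast this
  rw [this]

theorem qvec_inj {a b c a' b' c' : ℂ} (h : qvec a b c = qvec a' b' c') : a = a' ∧ b = b' ∧ c = c' := by
  have hI := Complex.I_ne_zero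
  have h1 := congrFun (congrFun h 0) 0
  have h2 := congrFun (congrFun h 0) 1
  have h3 := congrFun (congrFun h 1) 0
  simp only [qvec, Matrix.of_apply, Matrix.cons_val', Matrix.cons_val_zero, Matrix.cons_val_one,
    Matrix.cons_val_fin_one] at h1 h2 h3
  refine ⟨mul_right_cancel₀ hI h1, ?_, mul_right_cancel₀ hI (?_ : c * Complex.I = c' * Complex.I)⟩
  · linear_combination (h2 - h3) / 2
  · linear_combination (h2 + h3) / 2

theorem icoP_inj : Function.Injective icoP := by
  intro i j h
  obtain ⟨h0, h1, h2⟩ := qvec_inj h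
  have key : ∀ i j : Fin 12, icoT i 0 = icoT j 0 → icoT i 1 = icoT j 1 → icoT i 2 = icoT j 2 → i = j := by
    decide
  exact key i j (zval_inj h0) (zval_inj h1) (zval_inj h2)

theorem icoP_ap (i : Fin 12) : icoP (icoAp i) = - icoP i := by
  have key : ∀ i : Fin 12, ∀ j, icoT (icoAp i) j = - icoT i j := by decide
  have hz (m) : zval (-m) = - zval m := by simp [zval]; ring
  ext k l
  fin_cases k <;> fin_cases l <;> simp [icoP, key, hz, qvec] <;> ring

theorem qvec_tr (a b c : ℂ) : (qvec a b c).trace = 0 := by simp [qvec, Matrix.trace_fin_two]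

theorem qvec_sq (a b c : ℂ) : qvec a b c * qvec a b c = (-(a ^ 2 + b ^ 2 + c ^ 2)) • (1 : M2) := by
  have hI := Complex.I_sq
  ext k l
  fin_cases k <;> fin_cases l <;> simp [qvec, Matrix.mul_apply, Fin.sum_univ_two]
  · linear_combination (a ^ 2 + c ^ 2) * hI
  · ring
  · ring
  · linear_combination (a ^ 2 + c ^ 2) * hI

theorem icoP_sq (i : Fin 12) : icoP i * icoP i = (-(phi + 2)) • (1 : M2) := by
  rw [icoP, qvec_sq]
  congr 2
  fin_cases i <;> simp [icoT, zval] <;> linear_combination phi_sq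

theorem icoP_sum : ∑ j, icoP (icoN 0 j) = (2 * phi - 1) • icoP 0 := by
  have h : ∑ j, icoP (icoN 0 j) = icoP 2 + icoP 4 + icoP 11 + icoP 3 + icoP 7 :=
    Fin.sum_univ_five (fun j => icoP (icoN 0 j))
  rw [h]
  ext k l
  have := phi_sq
  fin_cases k <;> fin_cases l <;> simp [icoP, qvec, icoT, zval]
  · linear_combination (-2 * Complex.I) * phi_sq
  · linear_combination (-2 * Complex.I) * phi_sq

theorem icoN_inj : ∀ i k l, icoN i k = icoN i l → k = l := by
  have : ∀ i, ∀ k l, icoN5 i k = icoN5 i l → k = l := by decide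
  exact this

theorem icoN_ne : ∀ i, icoN i 0 ≠ i ∧ icoN i 0 ≠ icoAp i := by
  have : ∀ i, icoN5 i 0 ≠ i ∧ icoN5 i 0 ≠ icoAp i := by decide
  exact this

noncomputable def qmat (t a b c : ℂ) : M2 :=
  !![t + a * Complex.I, b + c * Complex.I; -b + c * Complex.I, t - a * Complex.I]

theorem qmat_det (t a b c : ℂ) : (qmat t a b c).det = t ^ 2 + a ^ 2 + b ^ 2 + c ^ 2 := by
  rw [qmat, det_fin_two_of]
  linear_combination (- a ^ 2 - c ^ 2) * Complex.I_sq

theorem qconj (t a b c x y z x' y' z' : ℂ) (h0 : a * x + b * y + c * z = a * x' + b * y' + c * z')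
    (h1 : t * (x - x') + (b * (z + z') - c * (y + y')) = 0)
    (h2 : t * (y - y') + (c * (x + x') - a * (z + z')) = 0)
    (h3 : t * (z - z') + (a * (y + y') - b * (x + x')) = 0) :
    qmat t a b c * qvec x y z = qvec x' y' z' * qmat t a b c := by
  have hI := Complex.I_sq
  ext k l
  fin_cases k <;> fin_cases l <;> simp [qvec, qmat, Matrix.mul_apply, Fin.sum_univ_two]
  · linear_combination -h0 + Complex.I * h1 + (a * x + c * z - a * x' - c * z') * hI
  · linear_combination h2 + Complex.I * h3 + (a * z - c * x + a * z' - c * x') * hI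
  · linear_combination -h2 + Complex.I * h3 - (a * z - c * x + a * z' - c * x') * hI
  · linear_combination -h0 - Complex.I * h1 + (a * x + c * z - a * x' - c * z') * hI

noncomputable def icoX : SL2 := ⟨qmat (1/2) (1/2) (1/2) (1/2), by rw [qmat_det]; norm_num⟩
noncomputable def icoX' : SL2 := ⟨qmat (1/2) (-1/2) (1/2) (-1/2), by rw [qmat_det]; norm_num⟩
noncomputable def icoY : SL2 := ⟨qmat (phi/2) 0 ((phi-1)/2) (1/2), by
  rw [qmat_det]; linear_combination phi_sq / 2⟩

def icopx : Equiv.Perm (Fin 12) :=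
  ⟨![2, 3, 4, 5, 0, 1, 8, 9, 10, 11, 6, 7], ![4, 5, 0, 1, 2, 3, 10, 11, 6, 7, 8, 9], by decide, by decide⟩
def icopx' : Equiv.Perm (Fin 12) :=
  ⟨![9, 8, 5, 4, 6, 7, 3, 2, 11, 10, 0, 1], ![10, 11, 7, 6, 3, 2, 4, 5, 1, 0, 9, 8], by decide, by decide⟩
def icopy : Equiv.Perm (Fin 12) :=
  ⟨![0, 8, 4, 7, 11, 9, 6, 2, 10, 1, 5, 3], ![0, 9, 7, 11, 2, 10, 6, 3, 1, 5, 8, 4], by decide, by decide⟩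

theorem icoX_conj (i) : icoX.1 * icoP i = icoP (icopx i) * icoX.1 := by
  apply qconj <;> fin_cases i <;> simp [icoT, zval, icopx] <;> ring

theorem icoX'_conj (i) : icoX'.1 * icoP i = icoP (icopx' i) * icoX'.1 := by
  apply qconj <;> fin_cases i <;> simp [icoT, zval, icopx'] <;> ring

theorem icoY_conj (i) : icoY.1 * icoP i = icoP (icopy i) * icoY.1 := by
  have hp := phi_sq
  apply qconj <;> fin_cases i <;> simp [icoT, zval, icopy] <;> grind

theorem icoYi_conj (i) : (icoY⁻¹).1 * icoP i = icoP (icopy⁻¹ i) * (icoY⁻¹).1 := by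
  obtain ⟨j, rfl⟩ := icopy.surjective i
  have h1 : icoY⁻¹.1 * icoY.1 = 1 := by
    rw [← Matrix.SpecialLinearGroup.coe_mul, inv_mul_cancel, Matrix.SpecialLinearGroup.coe_one]
  have h2 : icoY.1 * icoY⁻¹.1 = 1 := by
    rw [← Matrix.SpecialLinearGroup.coe_mul, mul_inv_cancel, Matrix.SpecialLinearGroup.coe_one]
  rw [show icopy⁻¹ (icopy j) = j from icopy.symm_apply_apply j]
  calc icoY⁻¹.1 * icoP (icopy j) = icoY⁻¹.1 * (icoP (icopy j) * icoY.1) * icoY⁻¹.1 := by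
        rw [mul_assoc, mul_assoc, h2, mul_one]
    _ = _ := by rw [← icoY_conj, ← mul_assoc, h1, one_mul]

theorem sl2_mul_inv (B : SL2) : B.1 * B⁻¹.1 = 1 := by
  rw [← Matrix.SpecialLinearGroup.coe_mul, mul_inv_cancel, Matrix.SpecialLinearGroup.coe_one]

theorem sl2_inv_mul (B : SL2) : B⁻¹.1 * B.1 = 1 := by
  rw [← Matrix.SpecialLinearGroup.coe_mul, inv_mul_cancel, Matrix.SpecialLinearGroup.coe_one]

theorem icoP_tr (i) : (icoP i).trace = 0 := qvec_tr _ _ _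

theorem mat2_anti (M P : M2) (hM : M.trace = 0) (hP : P.trace = 0) :
    M * P + P * M = (M * P).trace • (1 : M2) := by
  rw [Matrix.trace_fin_two] at hM hP
  have e1 : M 1 1 = - M 0 0 := by linear_combination hM
  have e2 : P 1 1 = - P 0 0 := by linear_combination hP
  ext i j
  fin_cases i <;> fin_cases j <;>
    simp [Matrix.mul_apply, Fin.sum_univ_two, Matrix.trace_fin_two, e1, e2] <;> ring

/-- an element of trace zero commuting with a vertex is parallel to it -/
theorem comm_par (M : SL2) (hM : M.1.trace = 0) (i : Fin 12) (h : M.1 * icoP i = icoP i * M.1) :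
    ∃ a : ℂ, icoP i = a • M.1 ∧ a ^ 2 = phi + 2 := by
  have h1 := mat2_anti M.1 (icoP i) hM (icoP_tr i)
  have h2 := mat2_sq M.1 M.2
  rw [hM, zero_smul, zero_sub] at h2
  have h3 : icoP i = (-((M.1 * icoP i).trace / 2)) • M.1 := by
    have h4 : M.1 * (M.1 * icoP i + icoP i * M.1) = -2 • icoP i := by
      rw [← h, ← two_smul ℕ, mul_smul_comm, ← mul_assoc, ← pow_two, h2]
      ext k l; simp
    rw [h1, mul_smul_comm, mul_one] at h4
    ext k l
    have := congrFun (congrFun h4 k) l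
    simp only [Matrix.smul_apply, smul_eq_mul, zsmul_eq_mul] at this ⊢
    push_cast at this
    linear_combination this / 2
  refine ⟨_, h3, ?_⟩
  set a := (-((M.1 * icoP i).trace / 2)) with ha
  have h5 := icoP_sq i
  rw [h3, smul_mul_assoc, mul_smul_comm, ← pow_two, h2] at h5
  have := congrFun (congrFun h5 0) 0
  simp at this
  linear_combination -this

theorem not_fix (M : SL2) (hM : M.1.trace = 0) (i : Fin 12) (h : M.1 * icoP i = icoP i * M.1)
    (h' : M.1 * icoP (icoN i 0) = icoP (icoN i 0) * M.1) : False := by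
  obtain ⟨a, h1, h2⟩ := comm_par M hM _ h
  obtain ⟨b, h3, h4⟩ := comm_par M hM _ h'
  rcases sq_eq_sq_iff_eq_or_eq_neg.1 (h4.trans h2.symm) with h5 | h5
  · exact (icoN_ne i).1 (icoP_inj (by rw [h3, h1, h5]))
  · exact (icoN_ne i).2 (icoP_inj (by rw [h3, icoP_ap, h1, h5, neg_smul]))

theorem conj_all (X0 Y0 : SL2) (px py : Equiv.Perm (Fin 12))
    (hpx : ∀ i, X0.1 * icoP i = icoP (px i) * X0.1) (hpy : ∀ i, Y0.1 * icoP i = icoP (py i) * Y0.1)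
    (g : FreeGroup (Fin 2)) : ∀ i, (wEval X0 Y0 g).1 * icoP i =
      icoP (FreeGroup.lift ![px, py] g i) * (wEval X0 Y0 g).1 := by
  have hm (a b) : wEval X0 Y0 (a * b) = wEval X0 Y0 a * wEval X0 Y0 b := map_mul _ _ _
  have hi (a) : wEval X0 Y0 (a⁻¹) = (wEval X0 Y0 a)⁻¹ := map_inv _ _
  induction g using FreeGroup.induction_on with
  | C1 => intro i; simp [wEval]
  | of j => intro i; fin_cases j <;> simp [wEval, hpx, hpy]
  | inv_of j h =>
    intro i
    obtain ⟨i, rfl⟩ := (FreeGroup.lift ![px, py] (FreeGroup.of j)).surjective i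
    have h1 : (FreeGroup.lift ![px, py] (FreeGroup.of j)⁻¹)
        ((FreeGroup.lift ![px, py] (FreeGroup.of j)) i) = i := by
      rw [map_inv]; exact Equiv.symm_apply_apply _ _
    rw [h1, hi]
    have h2 := h i
    set M := wEval X0 Y0 (FreeGroup.of j)
    set p := icoP ((FreeGroup.lift ![px, py] (FreeGroup.of j)) i)
    calc M⁻¹.1 * p = M⁻¹.1 * (p * M.1) * M⁻¹.1 := by
          rw [mul_assoc, mul_assoc, sl2_mul_inv, mul_one]
      _ = _ := by rw [← h2, ← mul_assoc, sl2_inv_mul, one_mul]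
  | mul a b ha hb =>
    intro i
    rw [hm, Matrix.SpecialLinearGroup.coe_mul, mul_assoc, hb, ← mul_assoc, ha, mul_assoc, map_mul]
    rfl

section
variable {A : FreeGroup (Fin 2) →* Equiv.Perm (Fin 12)}

theorem IsCo.pow0 {H : Type*} [Group H] {c : FreeGroup (Fin 2) → Fin 12 → H} (hc : IsCo A c)
    (g) (i) (h : A g i = i) (n : ℕ) : c (g ^ n) i = c g i ^ n := by
  induction n with
  | zero => simp [hc.one]
  | succ n ih => rw [pow_succ, hc, h, ih, pow_succ]

/-- cocycles with values in a cyclic subgroup of `ℂ` on the stabiliser are coboundaries -/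
theorem rank_contra {f : FreeGroup (Fin 2) → Fin 12 → Multiplicative ℂ} (hf : IsCo A f)
    (hT : ∀ i, ∃ g, A g 0 = i)
    (hsum : ∀ g, A g = 1 → ∑ j, (f g (icoN 0 j)).toAdd = (2 * phi - 1) * (f g 0).toAdd)
    (z : ℂ) (hz : ∀ g, A g 0 = 0 → ∃ m : ℤ, (f g 0).toAdd = m * z) :
    ∃ F : Fin 12 → ℂ, ∀ g i, (f g i).toAdd = F (A g i) - F i := by
  choose tr htr using hT
  have hker (g) (hg : A g = 1) (i) : f g i = f ((tr i)⁻¹ * g * tr i) 0 := by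
    have h1 := hf g (tr i) 0
    have h2 := hf (tr i) ((tr i)⁻¹ * g * tr i) 0
    have h3 : A ((tr i)⁻¹ * g * tr i) = 1 := by rw [map_mul, map_mul, hg, mul_one, map_inv, inv_mul_cancel]
    rw [h3, mul_assoc, mul_inv_cancel_left, h1, htr, mul_comm] at h2
    rw [mul_assoc]
    exact mul_left_cancel h2
  have h0 (g) (hg : A g = 1) : f g 0 = 1 := by
    have h1 (i) : ∃ m : ℤ, (f g i).toAdd = m * z := by
      rw [hker g hg]
      apply hz
      rw [map_mul, map_mul, hg, mul_one, map_inv, inv_mul_cancel]; rfl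
    choose m hm using h1
    have h2 := hsum g hg
    simp only [hm, ← Finset.sum_mul] at h2
    rw [← mul_assoc] at h2
    apply Multiplicative.toAdd.injective
    rw [toAdd_one, hm]
    by_cases hz0 : z = 0
    · rw [hz0, mul_zero]
    have h3 := mul_right_cancel₀ hz0 h2
    have h4 : zval (∑ j, m (icoN 0 j) + m 0, 0) = zval (0, 2 * m 0) := by
      simp only [zval]; push_cast; linear_combination h3
    have h5 := zval_inj h4
    simp only [Prod.mk.injEq] at h5
    have : m 0 = 0 := by omega
    rw [this]; simp
  have hst (g) (hg : A g 0 = 0) : f g 0 = 1 := by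
    have h1 := h0 (g ^ (Nat.card (Equiv.Perm (Fin 12)))) (by rw [map_pow, pow_card_eq_one'])
    rw [hf.pow0 g 0 hg] at h1
    have h2 := congrArg Multiplicative.toAdd h1
    rw [toAdd_pow, toAdd_one, nsmul_eq_mul] at h2
    rcases mul_eq_zero.1 h2 with h3 | h3
    · exact absurd h3 (by exact_mod_cast Nat.card_pos.ne')
    · exact Multiplicative.toAdd.injective h3
  refine ⟨fun i => (f (tr i) 0).toAdd, fun g i => ?_⟩
  have h1 := hf g (tr i) 0
  have h2 := hf (tr (A g i)) ((tr (A g i))⁻¹ * (g * tr i)) 0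
  have h3 : A ((tr (A g i))⁻¹ * (g * tr i)) 0 = 0 := by
    rw [map_mul, map_mul, map_inv, Equiv.Perm.mul_apply, Equiv.Perm.mul_apply, htr,
      Equiv.Perm.inv_eq_iff_eq, htr]
  rw [mul_inv_cancel_left, h1, htr, h3, hst _ h3, mul_one] at h2
  simp only []
  rw [← h2, toAdd_mul]; ring
end

theorem ico_main (X0 Y0 : SL2) (hX : X0.1.trace = 1) (hY : Y0.1.trace = phi)
    (w : FreeGroup (Fin 2)) (τ : ℂ[X]) (hτ : IsTracePolynomial w τ) (α : ℂ)
    (hα : (X0 * Y0).1.trace = α) (hm : (Polynomial.X - Polynomial.C α) ^ 2 ∣ τ)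
    (px py : Equiv.Perm (Fin 12))
    (hpx : ∀ i, X0.1 * icoP i = icoP (px i) * X0.1) (hpy : ∀ i, Y0.1 * icoP i = icoP (py i) * Y0.1)
    (dx dy : Fin 12 → ZMod 5) (hdx : ∀ i k, px (icoN i k) = icoN (px i) (k + dx i))
    (hdy : ∀ i k, py (icoN i k) = icoN (py i) (k + dy i))
    (hT : ∀ S : Fin 12 → Prop, S 0 → (∀ i, S i → S (px i)) → (∀ i, S i → S (py i)) → ∀ i, S i)
    (rx : Fin 4 → Fin 12) (hrx : ∀ i, ∃ k, ∃ j : ℕ, (px ^ j) (rx k) = i)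
    (ry : Fin 2 → Fin 12) (hry : ∀ i, py i = i ∨ ∃ k, ∃ j : ℕ, (py ^ j) (ry k) = i)
    (hy0 : py 0 = 0) (e : ZMod 5) (he : e * dy 0 = 1)
    (hl : ∀ F G : Fin 12 → ℂ, (∀ i, F (px i) = F i) → (∀ i, G (py i) = G i) →
      (∀ i, F i - G i = (icoP i * !![0, 1; 0, 0]).trace) → False) :
    HasF2 (PresentedGroup (rels3 w)) := by
  obtain ⟨c, hc, cx, cy, hrel, hw0⟩ := deriv_exists X0 Y0 hX hY w τ hτ α hα hm
  let A : FreeGroup (Fin 2) →* Equiv.Perm (Fin 12) := FreeGroup.lift ![px, py]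
  have hAx : A xgen = px := by simp [A, xgen]
  have hAy : A ygen = py := by simp [A, ygen]
  have hM : ∀ g i, (wEval X0 Y0 g).1 * icoP i = icoP (A g i) * (wEval X0 Y0 g).1 :=
    conj_all X0 Y0 px py hpx hpy
  have hcancel (g) (P Q : M2) (h : P * (wEval X0 Y0 g).1 = Q * (wEval X0 Y0 g).1) : P = Q := by
    have := congrArg (· * (wEval X0 Y0 g)⁻¹.1) h
    simpa only [mul_assoc, sl2_mul_inv, mul_one] using this
  have hAr (r) (hr : r ∈ rels3 w) : A r = 1 := by
    ext1 i
    apply icoP_inj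
    have := hM r i
    rw [(hrel r hr).2] at this
    simp only [neg_mul, mul_neg, one_mul, mul_one, neg_inj] at this
    rw [← this]; rfl
  have hAap (g i) : A g (icoAp i) = icoAp (A g i) := by
    apply icoP_inj
    apply hcancel g
    rw [← hM, icoP_ap, icoP_ap, mul_neg, hM, neg_mul]
  let Ab : PresentedGroup (rels3 w) →* Equiv.Perm (Fin 12) := PresentedGroup.toGroup (f := ![px, py]) hAr
  have hAb (g) : Ab (PresentedGroup.mk _ g) = A g := rfl
  -- the additive cocycle
  let f : FreeGroup (Fin 2) → Fin 12 → Multiplicative ℂ := fun g i =>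
    Multiplicative.ofAdd ((icoP (A g i) * c g).trace)
  have hf : IsCo A f := by
    intro g h i
    apply Multiplicative.toAdd.injective
    simp only [f, toAdd_mul, toAdd_ofAdd, map_mul, Equiv.Perm.mul_apply]
    rw [hc, mul_add, Matrix.trace_add]
    congr 1
    rw [← mul_assoc, ← mul_assoc, ← hM, Matrix.trace_mul_comm, ← mul_assoc, ← mul_assoc,
      sl2_inv_mul, one_mul]
  have hfap (g i) : f g (icoAp i) = (f g i)⁻¹ := by
    simp only [f, hAap, icoP_ap, neg_mul, Matrix.trace_neg]; rfl
  have hfr (r) (hr : r ∈ rels3 w) (i) : f r i = 1 := by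
    simp only [f, (hrel r hr).1, mul_zero, Matrix.trace_zero]; rfl
  obtain ⟨fb, hfb, hfbm⟩ := co_descend A Ab hAb f hf hfr
  -- the rotation cocycle
  obtain ⟨d, hd, hdg⟩ := co_exists A (![fun i => Multiplicative.ofAdd (dx i),
    fun i => Multiplicative.ofAdd (dy i)] : Fin 2 → Fin 12 → Multiplicative (ZMod 5))
  have hD (g) : ∀ i k, A g (icoN i k) = icoN (A g i) (k + (d g i).toAdd) := by
    induction g using FreeGroup.induction_on with
    | C1 => intro i k; simp [hd.one]
    | of j =>
      intro i k
      rw [hdg]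
      fin_cases j
      · simpa [A] using hdx i k
      · simpa [A] using hdy i k
    | inv_of j h =>
      intro i k
      obtain ⟨i, rfl⟩ := (A (FreeGroup.of j)).surjective i
      have e1 (q) : A (FreeGroup.of j)⁻¹ (A (FreeGroup.of j) q) = q := by
        rw [map_inv]; exact Equiv.symm_apply_apply _ _
      rw [hd.inv, e1, toAdd_inv]
      conv_rhs => rw [← e1 (icoN _ _), h]
      simp
    | mul a b ha hb =>
      intro i k
      rw [map_mul, Equiv.Perm.mul_apply, hb, ha, hd, Equiv.Perm.mul_apply, toAdd_mul, add_assoc,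
        add_comm (Multiplicative.toAdd (d b i))]
  have hdr (r) (hr : r ∈ rels3 w) (i) : d r i = 1 := by
    have := hD r i 0
    rw [hAr r hr, Equiv.Perm.one_apply, Equiv.Perm.one_apply, zero_add] at this
    exact (icoN_inj _ _ _ this).symm
  obtain ⟨db, hdb, hdbm⟩ := co_descend A Ab hAb d hd hdr
  have hw2 : w ^ 2 ∈ rels3 w := by simp [rels3]
  have hwf (i) : A w i ≠ i := by
    intro hi
    have h1 := hdr _ hw2 i
    rw [hd.pow0 w i hi] at h1
    have h2 : d w i = 1 := by
      have h5 : ∀ q : ZMod 5, q + q = 0 → q = 0 := by decide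
      apply Multiplicative.toAdd.injective
      apply h5
      rw [← toAdd_mul, ← pow_two, h1]; rfl
    have h3 := hD w i 0
    rw [hi, h2, toAdd_one, add_zero] at h3
    refine not_fix (wEval X0 Y0 w) hw0 i ?_ ?_
    · rw [hM, hi]
    · rw [hM, h3]
  have htrans (i) : ∃ g, A g 0 = i := by
    refine hT (fun i => ∃ g, A g 0 = i) ⟨1, by simp⟩ ?_ ?_ i
    · rintro i ⟨g, rfl⟩
      exact ⟨xgen * g, by rw [map_mul, hAx]; rfl⟩
    · rintro i ⟨g, rfl⟩
      exact ⟨ygen * g, by rw [map_mul, hAy]; rfl⟩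
  let Γ : Subgroup (PresentedGroup (rels3 w)) := (MulAction.stabilizer (Equiv.Perm (Fin 12)) (0 : Fin 12)).comap Ab
  have hΓ (g) : g ∈ Γ ↔ Ab g 0 = 0 := Iff.rfl
  obtain ⟨tr, htr0, htr⟩ : ∃ tr : Fin 12 → FreeGroup (Fin 2), tr 0 = 1 ∧ ∀ i, A (tr i) 0 = i := by
    choose tr h using htrans
    refine ⟨Function.update tr 0 1, by simp, fun i => ?_⟩
    by_cases hi : i = 0
    · subst hi; simp
    · rw [Function.update_of_ne hi, h]
  obtain ⟨π, r, C, hπ, hC, hr, hC5, hker⟩ := schreier A w Ab hAb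
    (by rw [← map_pow]; exact hAr _ (by simp [rels3])) (by rw [← map_pow]; exact hAr _ (by simp [rels3]))
    (by rw [← map_pow]; exact hAr _ hw2) rx (by rw [hAx]; exact hrx) ry (by rw [hAy]; exact hry)
    hwf tr htr0 htr Γ hΓ
  let L : Γ →* Multiplicative ℂ :=
    { toFun := fun γ => fb γ.1 0
      map_one' := hfb.one 0
      map_mul' := fun a b => by
        have := hfb a.1 b.1 0
        rwa [(hΓ b.1).1 b.2] at this }
  let ω : Γ →* Multiplicative (ZMod 5) :=
    { toFun := fun γ => Multiplicative.ofAdd (e * (db γ.1 0).toAdd)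
      map_one' := by rw [Subgroup.coe_one, hdb.one]; simp
      map_mul' := fun a b => by
        have := hdb a.1 b.1 0
        rw [(hΓ b.1).1 b.2] at this
        rw [Subgroup.coe_mul, this, toAdd_mul, mul_add, ofAdd_add] }
  have hyΓ : PresentedGroup.mk (rels3 w) ygen ∈ Γ := by rw [hΓ, hAb, hAy, hy0]
  rcases rank_dichotomy π hπ L with ⟨z, hz⟩ | ⟨t, u, hsurj, hinv⟩
  · exfalso
    obtain ⟨F, hF⟩ := rank_contra hf htrans (by
      intro g hg
      simp only [f, hg, Equiv.Perm.one_apply, toAdd_ofAdd]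
      rw [← Matrix.trace_sum, ← Finset.sum_mul, icoP_sum, smul_mul_assoc, Matrix.trace_smul, smul_eq_mul])
      z (by
        intro g hg
        obtain ⟨m, hm⟩ := hz ⟨PresentedGroup.mk _ g, by rw [hΓ, hAb, hg]⟩
        refine ⟨m, ?_⟩
        rw [← hm, ← hfbm]; rfl)
    refine hl F (fun i => F i - (icoP i * !![0, 1; 0, 0]).trace) ?_ ?_ ?_
    · intro i
      have h1 := hF xgen i
      simp only [f, cx, mul_zero, Matrix.trace_zero, toAdd_ofAdd, hAx] at h1
      linear_combination -h1
    · intro i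
      have h1 := hF ygen i
      simp only [f, cy, toAdd_ofAdd, hAy] at h1
      rw [mul_sub, Matrix.trace_sub] at h1
      have h2 : (icoP (py i) * (Y0.1 * !![0, 1; 0, 0] * Y0⁻¹.1)).trace = (icoP i * !![0, 1; 0, 0]).trace := by
        rw [← mul_assoc, ← mul_assoc, ← hpy, Matrix.trace_mul_comm, ← mul_assoc, ← mul_assoc,
          sl2_inv_mul, one_mul]
      rw [h2] at h1
      linear_combination -h1
    · intro i; ring
  · let s := PresentedGroup.mk (rels3 w) (tr (icoAp 0))
    have hs0 : Ab s 0 = icoAp 0 := by rw [hAb, htr]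
    have hap2 : icoAp (icoAp 0) = 0 := by decide
    have hs1 : Ab s (icoAp 0) = 0 := by
      rw [hAb, hAap, htr, hap2]
    have hsi0 : Ab s⁻¹ 0 = icoAp 0 := by rw [map_inv, Equiv.Perm.inv_eq_iff_eq, hs1]
    have hapb (γ i) : Ab γ (icoAp i) = icoAp (Ab γ i) := by
      obtain ⟨g, rfl⟩ := PresentedGroup.mk_surjective _ γ
      rw [hAb, hAap]
    have hfapb (γ i) : fb γ (icoAp i) = (fb γ i)⁻¹ := by
      obtain ⟨g, rfl⟩ := PresentedGroup.mk_surjective _ γ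
      rw [hfbm, hfbm, hfap]
    have hsi1 : Ab s⁻¹ (icoAp 0) = 0 := by rw [map_inv, Equiv.Perm.inv_eq_iff_eq, hs0]
    let σ : Γ ≃* Γ :=
      { toFun := fun γ => ⟨s * γ.1 * s⁻¹, by
          rw [hΓ, map_mul, map_mul, Equiv.Perm.mul_apply, Equiv.Perm.mul_apply, hsi0, hapb,
            (hΓ _).1 γ.2, hs1]⟩
        invFun := fun γ => ⟨s⁻¹ * γ.1 * s, by
          rw [hΓ, map_mul, map_mul, Equiv.Perm.mul_apply, Equiv.Perm.mul_apply, hs0, hapb,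
            (hΓ _).1 γ.2, hsi1]⟩
        left_inv := fun γ => by ext1; simp [mul_assoc]
        right_inv := fun γ => by ext1; simp [mul_assoc]
        map_mul' := fun a b => by ext1; simp [mul_assoc] }
    have hσL (γ) : L (σ γ) = (L γ)⁻¹ := by
      change fb (s * γ.1 * s⁻¹) 0 = (fb γ.1 0)⁻¹
      rw [hfb, hfb, hsi0, hapb, (hΓ _).1 γ.2, hfapb γ.1]
      have h1 := hfb s s⁻¹ 0
      rw [mul_inv_cancel, hfb.one, hsi0] at h1
      rw [mul_right_comm, ← h1, one_mul]
    have := pres_F2 π hπ r C hC hr hC5 hker t u hsurj σ (fun g => (hinv _ _ (hσL g)).1)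
      (fun g => (hinv _ _ (hσL g)).2) ω ⟨_, hyΓ⟩ (by
        change Multiplicative.ofAdd (e * (db (PresentedGroup.mk _ ygen) 0).toAdd) = _
        rw [hdbm, ygen, hdg]
        simpa using he) (by
        ext1
        rw [SubgroupClass.coe_pow, ← map_pow]
        exact PresentedGroup.one_of_mem (by simp [rels3]))
    exact this.of_inj Γ.subtype Γ.subtype_injective

theorem icoX_tr : icoX.1.trace = 1 := by
  simp only [icoX, qmat, Matrix.trace_fin_two_of]; ring
theorem icoX'_tr : icoX'.1.trace = 1 := by
  simp only [icoX', qmat, Matrix.trace_fin_two_of]; ring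
theorem icoY_tr : icoY.1.trace = phi := by
  simp only [icoY, qmat, Matrix.trace_fin_two_of]; ring
theorem icoYi_coe : (icoY⁻¹).1 = qmat (phi/2) 0 (-(phi-1)/2) (-1/2) := by
  rw [Matrix.SpecialLinearGroup.coe_inv, Matrix.adjugate_fin_two]
  ext i j
  fin_cases i <;> fin_cases j <;> simp [icoY, qmat] <;> ring
theorem icoYi_tr : (icoY⁻¹).1.trace = phi := by
  rw [icoYi_coe]; simp only [qmat, Matrix.trace_fin_two_of]; ring

theorem qmat_mul_tr (t a b c t' a' b' c' : ℂ) :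
    (qmat t a b c * qmat t' a' b' c').trace = 2 * (t * t' - a * a' - b * b' - c * c') := by
  simp [qmat, Matrix.trace_fin_two, Matrix.mul_apply, Fin.sum_univ_two]
  linear_combination (2 * a * a' + 2 * c * c') * Complex.I_sq

theorem tr_XY : (icoX * icoY).1.trace = 0 := by
  rw [Matrix.SpecialLinearGroup.coe_mul]; simp only [icoX, icoY]; rw [qmat_mul_tr]; ring
theorem tr_XYi : (icoX * icoY⁻¹).1.trace = phi := by
  rw [Matrix.SpecialLinearGroup.coe_mul, icoYi_coe]; simp only [icoX]; rw [qmat_mul_tr]; ring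
theorem tr_X'Y : (icoX' * icoY).1.trace = 1 := by
  rw [Matrix.SpecialLinearGroup.coe_mul]; simp only [icoX', icoY]; rw [qmat_mul_tr]; ring
theorem tr_X'Yi : (icoX' * icoY⁻¹).1.trace = phi - 1 := by
  rw [Matrix.SpecialLinearGroup.coe_mul, icoYi_coe]; simp only [icoX']; rw [qmat_mul_tr]; ring

theorem icoP_n (i) : (icoP i * !![0, 1; 0, 0]).trace = -zval (icoT i 1) + zval (icoT i 2) * Complex.I := by
  simp [icoP, qvec, Matrix.trace_fin_two, Matrix.mul_apply, Fin.sum_univ_two]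

theorem cpx_ne (a b : ℤ) (c : ℝ) (h : (a : ℂ) + b * (Real.sqrt 5 : ℂ) + c * Complex.I = 0) (hb : b ≠ 0) : False := by
  have h1 := congrArg Complex.re h
  simp at h1
  have h5 : Irrational (Real.sqrt 5) := by
    have := (show Nat.Prime 5 by norm_num).irrational_sqrt
    simpa using this
  have hb' : (b : ℝ) ≠ 0 := by exact_mod_cast hb
  refine h5 ⟨-a / b, ?_⟩
  push_cast
  field_simp
  linear_combination -h1

def dX : Fin 12 → Fin 5 := ![4, 0, 1, 0, 0, 0, 3, 2, 0, 3, 2, 0]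
def dX' : Fin 12 → Fin 5 := ![3, 1, 4, 2, 1, 3, 2, 3, 2, 1, 1, 2]
def dY : Fin 12 → Fin 5 := ![1, 4, 0, 0, 4, 1, 4, 0, 1, 3, 1, 1]
def dYi : Fin 12 → Fin 5 := ![4, 2, 0, 4, 0, 4, 1, 0, 1, 4, 4, 1]

theorem hdX : ∀ i k, icopx (icoN5 i k) = icoN5 (icopx i) (k + dX i) := by decide
theorem hdX' : ∀ i k, icopx' (icoN5 i k) = icoN5 (icopx' i) (k + dX' i) := by decide
theorem hdY : ∀ i k, icopy (icoN5 i k) = icoN5 (icopy i) (k + dY i) := by decide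
theorem hdYi : ∀ i k, icopy⁻¹ (icoN5 i k) = icoN5 (icopy⁻¹ i) (k + dYi i) := by decide

theorem hrX (i : Fin 12) : ∃ k, ∃ j : ℕ, (icopx ^ j) ((![0, 1, 6, 7] : Fin 4 → Fin 12) k) = i := by
  have : ∀ i, ∃ k, ∃ j : Fin 3, (icopx ^ j.1) ((![0, 1, 6, 7] : Fin 4 → Fin 12) k) = i := by decide
  obtain ⟨k, j, h⟩ := this i
  exact ⟨k, j, h⟩
theorem hrX' (i : Fin 12) : ∃ k, ∃ j : ℕ, (icopx' ^ j) ((![0, 1, 2, 3] : Fin 4 → Fin 12) k) = i := by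
  have : ∀ i, ∃ k, ∃ j : Fin 3, (icopx' ^ j.1) ((![0, 1, 2, 3] : Fin 4 → Fin 12) k) = i := by decide
  obtain ⟨k, j, h⟩ := this i
  exact ⟨k, j, h⟩
theorem hrY (i : Fin 12) : icopy i = i ∨ ∃ k, ∃ j : ℕ, (icopy ^ j) ((![1, 2] : Fin 2 → Fin 12) k) = i := by
  have : ∀ i, icopy i = i ∨ ∃ k, ∃ j : Fin 5, (icopy ^ j.1) ((![1, 2] : Fin 2 → Fin 12) k) = i := by decide
  rcases this i with h | ⟨k, j, h⟩
  · exact Or.inl h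
  · exact Or.inr ⟨k, j, h⟩
theorem hrYi (i : Fin 12) : icopy⁻¹ i = i ∨ ∃ k, ∃ j : ℕ, (icopy⁻¹ ^ j) ((![1, 2] : Fin 2 → Fin 12) k) = i := by
  have : ∀ i, icopy⁻¹ i = i ∨ ∃ k, ∃ j : Fin 5, (icopy⁻¹ ^ j.1) ((![1, 2] : Fin 2 → Fin 12) k) = i := by decide
  rcases this i with h | ⟨k, j, h⟩
  · exact Or.inl h
  · exact Or.inr ⟨k, j, h⟩

theorem S_inv {S : Fin 12 → Prop} (h : ∀ i, S i → S (icopy⁻¹ i)) (i) (hi : S i) : S (icopy i) := by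
  have e : ∀ i, icopy⁻¹ (icopy⁻¹ (icopy⁻¹ (icopy⁻¹ i))) = icopy i := by decide
  rw [← e]; exact h _ (h _ (h _ (h _ hi)))

theorem hTX (S : Fin 12 → Prop) (h0 : S 0) (hx : ∀ i, S i → S (icopx i)) (hy : ∀ i, S i → S (icopy i)) :
    ∀ i, S i := by
  have h2 : S 2 := hx 0 h0
  have h4 : S 4 := hx 2 h2
  have h11 : S 11 := hy 4 h4
  have h3 : S 3 := hy 11 h11
  have h7 : S 7 := hy 3 h3
  have h5 : S 5 := hx 3 h3
  have h1 : S 1 := hx 5 h5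
  have h9 : S 9 := hx 7 h7
  have h8 : S 8 := hy 1 h1
  have h10 : S 10 := hx 8 h8
  have h6 : S 6 := hx 10 h10
  intro i; fin_cases i <;> assumption

theorem hTX' (S : Fin 12 → Prop) (h0 : S 0) (hx : ∀ i, S i → S (icopx' i)) (hy : ∀ i, S i → S (icopy i)) :
    ∀ i, S i := by
  have h9 : S 9 := hx 0 h0
  have h10 : S 10 := hx 9 h9
  have h1 : S 1 := hy 9 h9
  have h8 : S 8 := hy 1 h1
  have h5 : S 5 := hy 10 h10
  have h7 : S 7 := hx 5 h5
  have h2 : S 2 := hx 7 h7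
  have h4 : S 4 := hy 2 h2
  have h11 : S 11 := hy 4 h4
  have h3 : S 3 := hy 11 h11
  have h6 : S 6 := hx 4 h4
  intro i; fin_cases i <;> assumption

theorem G_inv {G : Fin 12 → ℂ} (h : ∀ i, G (icopy⁻¹ i) = G i) (i) : G (icopy i) = G i := by
  rw [← h (icopy i)]; congr 1; exact icopy.symm_apply_apply i

theorem hlX (F G : Fin 12 → ℂ) (hF : ∀ i, F (icopx i) = F i) (hG : ∀ i, G (icopy i) = G i)
    (h : ∀ i, F i - G i = (icoP i * !![0, 1; 0, 0]).trace) : False := by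
  have f1 : F 3 = F 1 := hF 1
  have f2 : F 11 = F 9 := hF 9
  have g1 : G 3 = G 11 := hG 11
  have g2 : G 1 = G 9 := hG 9
  have e1 := h 1
  have e3 := h 3
  have e11 := h 11
  have e9 := h 9
  rw [icoP_n] at e1 e3 e11 e9
  simp [icoT, zval, phi] at e1 e3 e11 e9
  refine cpx_ne (-3) (-1) (-(1 + Real.sqrt 5)) ?_ (by norm_num)
  push_cast
  linear_combination (2 : ℂ) * (f2 - f1 + g1 - g2 - e1 + e3 - e11 + e9)

theorem hlX' (F G : Fin 12 → ℂ) (hF : ∀ i, F (icopx' i) = F i) (hG : ∀ i, G (icopy i) = G i)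
    (h : ∀ i, F i - G i = (icoP i * !![0, 1; 0, 0]).trace) : False := by
  have f1 : F 1 = F 11 := hF 11
  have f2 : F 5 = F 2 := hF 2
  have g1 : G 11 = G 2 := (hG 4).trans (hG 2)
  have g2 : G 5 = G 1 := ((hG 10).trans (hG 8)).trans (hG 1)
  have e1 := h 1
  have e2 := h 2
  have e11 := h 11
  have e5 := h 5
  rw [icoP_n] at e1 e2 e11 e5
  simp [icoT, zval, phi] at e1 e2 e11 e5
  have key : (-1 : ℂ) + (((1 - Real.sqrt 5) / 2 : ℝ) : ℂ) * Complex.I = 0 := by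
    push_cast
    linear_combination f1 - f2 + g1 + g2 - e1 + e11 - e2 + e5
  have := congrArg Complex.re key
  simp at this

theorem final_cases (w : FreeGroup (Fin 2)) (τ : ℂ[X]) (hτ : IsTracePolynomial w τ) (α : ℂ)
    (hm : (Polynomial.X - Polynomial.C α) ^ 2 ∣ τ) (h : α = 0 ∨ α = phi ∨ α = 1 ∨ α = phi - 1) :
    HasF2 (PresentedGroup (rels3 w)) := by
  rcases h with rfl | rfl | rfl | rfl
  · exact ico_main icoX icoY icoX_tr icoY_tr w τ hτ _ tr_XY hm icopx icopy icoX_conj icoY_conj dX dY hdX hdY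
      hTX _ hrX _ hrY rfl 1 (by decide) hlX
  · exact ico_main icoX icoY⁻¹ icoX_tr icoYi_tr w τ hτ _ tr_XYi hm icopx icopy⁻¹ icoX_conj icoYi_conj dX dYi hdX hdYi
      (fun S h0 hx hy => hTX S h0 hx (S_inv hy)) _ hrX _ hrYi rfl 4 (by decide)
      (fun F G hF hG => hlX F G hF (G_inv hG))
  · exact ico_main icoX' icoY icoX'_tr icoY_tr w τ hτ _ tr_X'Y hm icopx' icopy icoX'_conj icoY_conj dX' dY hdX' hdY
      hTX' _ hrX' _ hrY rfl 1 (by decide) hlX'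
  · exact ico_main icoX' icoY⁻¹ icoX'_tr icoYi_tr w τ hτ _ tr_X'Yi hm icopx' icopy⁻¹ icoX'_conj icoYi_conj dX' dYi hdX' hdYi
      (fun S h0 hx hy => hTX' S h0 hx (S_inv hy)) _ hrX' _ hrYi rfl 4 (by decide)
      (fun F G hF hG => hlX' F G hF (G_inv hG))

/-- **Theorem 4 (multiple roots)**: if the trace polynomial of `W` has a multiple root,
then the generalised triangle group `⟨x, y ∣ x³ = y⁵ = W² = 1⟩` of type (3,5,2)
contains a nonabelian free subgroup. -/
theorem trigroup_free_of_multiple_root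
    (k : ℕ) (hk : 1 ≤ k) (a b : Fin k → ℕ)
    (ha : ∀ i, 0 < a i ∧ a i < 3) (hb : ∀ i, 0 < b i ∧ b i < 5)
    (τ : Polynomial ℂ) (hτ : IsTracePolynomial (Wword k a b) τ)
    (hmult : ∃ α : ℂ, (Polynomial.X - Polynomial.C α) ^ 2 ∣ τ) :
    ∃ H : Subgroup (TriGroup k a b), Nonempty (H ≃* FreeGroup (Fin 2)) := by
  obtain ⟨α, hm⟩ := hmult
  have h0 : τ.eval α = 0 := by
    obtain ⟨q, hq⟩ := hm
    rw [hq]; simp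
  rcases roots_four k hk a b ha hb τ hτ α h0 with h | h
  · exact h.subgroup
  · exact HasF2.subgroup (final_cases (Wword k a b) τ hτ α hm h)
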